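/- arXiv:1106.2256 — 2 statements merged into one kernel-verified Lean document; each statement's English description precedes it below -/
import Mathlib

section
/- (Optimal entropy production, sandwiched case.) Let ρ be a smooth probability density on ℝ with mean zero, unit variance, finite entropy S(ρ) > −∞ and finite relative Fisher information J(ρ) < ∞, and suppose that 1/K ≤ ρ(x)/g(x) ≤ K for all x, for some constant K ≥ 1. Then the entropy production under rescaled self-convolution satisfies S(ρ⊛ρ) − S(ρ) ≥ c_K D(ρ), where c_K > 0 is a constant depending only on K (one may take c_K = 1/(2K)). -/
open MeasureTheory Real Set

noncomputable section

/-- The standard Gaussian density on ℝ. -/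
def gaussPDF (x : ℝ) : ℝ := (Real.sqrt (2 * Real.pi))⁻¹ * Real.exp (-x ^ 2 / 2)

/-- Convolution of two densities on ℝ. -/
def convDens (f g : ℝ → ℝ) (x : ℝ) : ℝ := ∫ y, f (x - y) * g y

/-- `iterConv ρ n` is the `(n+1)`-fold convolution of `ρ` with itself. -/
def iterConv (ρ : ℝ → ℝ) : ℕ → ℝ → ℝ
  | 0 => ρ
  | n + 1 => convDens (iterConv ρ n) ρ

/-- `rescaledConv ρ n` is the density of `n^{-1/2}(X₁ + ⋯ + Xₙ)` for i.i.d. `Xⱼ`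
with density `ρ`, i.e. `x ↦ √n (ρ∗⋯∗ρ)(√n x)` with the `n`-fold convolution. -/
def rescaledConv (ρ : ℝ → ℝ) (n : ℕ) (x : ℝ) : ℝ :=
  Real.sqrt n * iterConv ρ (n - 1) (Real.sqrt n * x)

/-- The density of `(X+Y)/√2` for independent `X`, `Y` with densities `ρ`, `η`. -/
def rescaledConvPair (ρ η : ℝ → ℝ) (x : ℝ) : ℝ :=
  Real.sqrt 2 * convDens ρ η (Real.sqrt 2 * x)

/-- The rescaled self-convolution `ρ ⊛ ρ`. -/
def selfConv (ρ : ℝ → ℝ) : ℝ → ℝ := rescaledConvPair ρ ρ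

/-- Entropy `S(ρ) = -∫ ρ ln ρ`. -/
def entropy (ρ : ℝ → ℝ) : ℝ := -∫ x, ρ x * Real.log (ρ x)

/-- Relative entropy `D(ρ) = ∫ ρ ln (ρ/g)` with respect to the standard Gaussian. -/
def relEntropy (ρ : ℝ → ℝ) : ℝ := ∫ x, ρ x * Real.log (ρ x / gaussPDF x)

/-- Fisher information `I(ρ) = 4 ∫ |(√ρ)'|²`. -/
def fisherInfo (ρ : ℝ → ℝ) : ℝ := 4 * ∫ x, (deriv (fun y => Real.sqrt (ρ y)) x) ^ 2

/-- Relative Fisher information `J(ρ) = 4 ∫ |((d/dx) + x/2)√ρ|²`. -/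
def relFisher (ρ : ℝ → ℝ) : ℝ :=
  4 * ∫ x, (deriv (fun y => Real.sqrt (ρ y)) x + (x / 2) * Real.sqrt (ρ x)) ^ 2

/-- The ψ-function `ψ_ρ(R) = ∫_{|x| ≥ R} x² ρ(x) dx`. -/
def psiFun (ρ : ℝ → ℝ) (R : ℝ) : ℝ := ∫ x in {x : ℝ | R ≤ |x|}, x ^ 2 * ρ x

/-- A nonnegative function is log-concave if
`F((1-t)x + ty) ≥ F(x)^{1-t} F(y)^{t}` for `t ∈ [0,1]`. -/
def LogConcaveFun (F : ℝ → ℝ) : Prop :=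
  (∀ x, 0 ≤ F x) ∧
  ∀ x y t : ℝ, 0 ≤ t → t ≤ 1 → F x ^ (1 - t) * F y ^ t ≤ F ((1 - t) * x + t * y)


/-! ### Gaussian measure -/

/-- The standard Gaussian measure. -/
abbrev gam : Measure ℝ := ProbabilityTheory.gaussianReal 0 1

lemma gaussPDF_eq (x : ℝ) : ProbabilityTheory.gaussianPDFReal 0 1 x = gaussPDF x := by
  simp [ProbabilityTheory.gaussianPDFReal, gaussPDF]

lemma gaussPDF_pos (x : ℝ) : 0 < gaussPDF x := by
  unfold gaussPDF; positivity

lemma gaussPDF_continuous : Continuous gaussPDF := by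
  unfold gaussPDF; fun_prop

lemma gam_integral (f : ℝ → ℝ) : ∫ x, f x ∂gam = ∫ x, f x * gaussPDF x := by
  rw [ProbabilityTheory.integral_gaussianReal_eq_integral_smul (by norm_num)]
  simp only [gaussPDF_eq, smul_eq_mul, mul_comm]

lemma gam_integrable_iff (f : ℝ → ℝ) :
    Integrable f gam ↔ Integrable (fun x => f x * gaussPDF x) := by
  unfold gam
  rw [ProbabilityTheory.gaussianReal_of_var_ne_zero _ (by norm_num),
    integrable_withDensity_iff (ProbabilityTheory.measurable_gaussianPDF _ _)
      (ae_of_all _ fun _ => ProbabilityTheory.gaussianPDF_lt_top)]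
  simp only [ProbabilityTheory.toReal_gaussianPDF, gaussPDF_eq]

lemma gam_pow_integrable (k : ℕ) : Integrable (fun x : ℝ => x ^ k) gam := by
  have h := (ProbabilityTheory.memLp_id_gaussianReal (μ := 0) (v := 1) (k : NNReal))
  rcases Nat.eq_zero_or_pos k with rfl | hk
  · simp
  have h2 := h.integrable_norm_rpow (by simpa using hk.ne') (by simp)
  have h3 : Integrable (fun x : ℝ => |x| ^ k) gam := by simpa using h2
  refine h3.mono' (by fun_prop) (ae_of_all _ fun x => ?_)
  simp

lemma gam_abs_pow_integrable (k : ℕ) : Integrable (fun x : ℝ => |x| ^ k) gam := by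
  refine (gam_pow_integrable k).norm.congr (ae_of_all _ fun x => ?_)
  simp

lemma gam_m1 : ∫ x, x ∂gam = 0 := by
  simp

lemma gam_m2 : ∫ x, x ^ 2 ∂gam = 1 := by
  have h := ProbabilityTheory.variance_id_gaussianReal (μ := 0) (v := 1)
  rw [ProbabilityTheory.variance_eq_integral (by fun_prop)] at h
  simpa using h

/-- rotation invariance -/
lemma gam_rot (t : ℝ) (f : ℝ × ℝ → ℝ) (hf : Continuous f) :
    ∫ p, f (cos t * p.1 + sin t * p.2, -sin t * p.1 + cos t * p.2) ∂(gam.prod gam)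
      = ∫ p, f p ∂(gam.prod gam) := by
  have h : (gam.prod gam).map (ContinuousLinearMap.rotation t) = gam.prod gam := by
    apply ProbabilityTheory.IsGaussian.map_rotation_eq_self_of_forall_strongDual_eq_zero
    intro L
    have : ∀ x, L x = L 1 * x := fun x => by
      have := L.map_smul x 1
      simp only [smul_eq_mul, mul_one] at this
      rw [this]; ring
    rw [integral_congr_ae (ae_of_all _ this), integral_const_mul, gam_m1, mul_zero]
  conv_rhs => rw [← h]
  rw [integral_map (by fun_prop) hf.aestronglyMeasurable]
  rfl

lemma gam_prod_integrable (f : ℝ × ℝ → ℝ) (hf : Continuous f) (C : ℝ)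
    (hC : ∀ y z, |f (y, z)| ≤ C * ((1 + y ^ 2) * (1 + z ^ 2))) :
    Integrable f (gam.prod gam) := by
  have h1 : Integrable (fun y : ℝ => 1 + y ^ 2) gam := (integrable_const _).add (gam_pow_integrable 2)
  exact ((h1.mul_prod h1).const_mul C).mono' hf.aestronglyMeasurable
    (ae_of_all _ fun p => hC p.1 p.2)

lemma gaussPDF_hasDerivAt (y : ℝ) : HasDerivAt gaussPDF (-y * gaussPDF y) y := by
  unfold gaussPDF
  have : HasDerivAt (fun x : ℝ => -x ^ 2 / 2) (-y) y := by
    have := ((hasDerivAt_pow 2 y).neg).div_const 2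
    exact this.congr_deriv (by simp; ring)
  exact (this.exp.const_mul (√(2 * π))⁻¹).congr_deriv (by ring)

/-- Gaussian integration by parts. -/
lemma gam_ibp (f f' : ℝ → ℝ) (hd : ∀ y, HasDerivAt f (f' y) y) (hf'c : Continuous f')
    (C : ℝ) (hf : ∀ y, |f y| ≤ C) (hf' : ∀ y, |f' y| ≤ C) :
    ∫ y, y * f y ∂gam = ∫ y, f' y ∂gam := by
  have hfc : Continuous f := continuous_iff_continuousAt.2 fun y => (hd y).continuousAt
  have i0 : Integrable f gam := (integrable_const C).mono' hfc.aestronglyMeasurable (ae_of_all _ hf)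
  have i1 : Integrable f' gam :=
    (integrable_const C).mono' hf'c.aestronglyMeasurable (ae_of_all _ hf')
  have i2 : Integrable (fun y => y * f y) gam := by
    refine ((gam_abs_pow_integrable 1).const_mul C).mono' (by fun_prop) (ae_of_all _ fun y => ?_)
    rw [norm_mul, pow_one, mul_comm]
    exact mul_le_mul_of_nonneg_right (hf y) (abs_nonneg _)
  rw [← sub_eq_zero, ← integral_sub i2 i1, gam_integral]
  have hg := gaussPDF_hasDerivAt
  have hp : ∀ y, HasDerivAt (fun y => -(f y * gaussPDF y)) ((y * f y - f' y) * gaussPDF y) y := by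
    intro y
    exact ((hd y).mul (hg y)).neg.congr_deriv (by ring)
  exact integral_eq_zero_of_hasDerivAt_of_integrable hp ((gam_integrable_iff _).1 (i2.sub i1))
    ((gam_integrable_iff _).1 i0).neg

/-! ### Differentiating the Gaussian averages -/

lemma gaussPDF_le (x : ℝ) : gaussPDF x ≤ exp (-x ^ 2 / 2) := by
  unfold gaussPDF
  have h1 : 1 ≤ √(2 * π) := by
    rw [Real.one_le_sqrt]; nlinarith [Real.pi_gt_three]
  have h2 : (√(2 * π))⁻¹ ≤ 1 := inv_le_one_of_one_le₀ h1
  have := exp_pos (-x ^ 2 / 2)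
  nlinarith

/-- polynomial times Gaussian bound -/
lemma pow_gauss_le (j : ℕ) (ξ : ℝ) :
    |ξ| ^ j * gaussPDF ξ ≤ (j.factorial * exp 1) * exp (-ξ ^ 2 / 4) := by
  have h1 : |ξ| ^ j ≤ j.factorial * exp |ξ| := by
    have := Real.pow_div_factorial_le_exp _ (abs_nonneg ξ) j
    rw [div_le_iff₀ (by positivity)] at this
    linarith
  have h2 : |ξ| ≤ 1 + ξ ^ 2 / 4 := by
    have := sq_nonneg (|ξ| - 2)
    have h := sq_abs ξ
    nlinarith
  calc |ξ| ^ j * gaussPDF ξ ≤ (j.factorial * exp |ξ|) * exp (-ξ ^ 2 / 2) :=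
        mul_le_mul h1 (gaussPDF_le ξ) (gaussPDF_pos ξ).le (by positivity)
    _ ≤ (j.factorial * exp (1 + ξ ^ 2 / 4)) * exp (-ξ ^ 2 / 2) := by gcongr
    _ = (j.factorial * exp 1) * exp (-ξ ^ 2 / 4) := by
        rw [mul_assoc, mul_assoc, ← exp_add, ← exp_add]; ring_nf

/-- kernel -/
def ker (k : ℕ) (m s x : ℝ) : ℝ := ((x - m) / s) ^ k * gaussPDF ((x - m) / s) / s

lemma ker_bound (k : ℕ) (m s x R s0 : ℝ) (hm : |m| ≤ R) (hs0 : 0 < s0) (hs : s0 ≤ s) (hs1 : s ≤ 1) :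
    |ker k m s x| ≤ (k.factorial * exp 1 / s0 * exp (R ^ 2 / 4)) * exp (-(1/8) * x ^ 2) := by
  have hs' : 0 < s := hs0.trans_le hs
  have hR : m ^ 2 ≤ R ^ 2 := by
    rw [← sq_abs m]; exact pow_le_pow_left₀ (abs_nonneg _) hm 2
  have h1 : (x - m) ^ 2 ≤ ((x - m) / s) ^ 2 := by
    rw [div_pow, le_div_iff₀ (by positivity)]
    have : s ^ 2 ≤ 1 := by nlinarith
    exact mul_le_of_le_one_right (sq_nonneg _) this
  have h2 : -((x - m) / s) ^ 2 / 4 ≤ R ^ 2 / 4 + -(1/8) * x ^ 2 := by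
    nlinarith [sq_nonneg (x - 2 * m)]
  unfold ker
  rw [abs_div, abs_mul, abs_pow, abs_of_pos (gaussPDF_pos _), abs_of_pos hs']
  calc |(x - m) / s| ^ k * gaussPDF ((x - m) / s) / s
      ≤ ((k.factorial * exp 1) * exp (-((x - m) / s) ^ 2 / 4)) / s := by
        exact div_le_div_of_nonneg_right (pow_gauss_le _ _) hs'.le
    _ ≤ ((k.factorial * exp 1) * exp (R ^ 2 / 4 + -(1/8) * x ^ 2)) / s0 := by gcongr
    _ = _ := by rw [exp_add]; ring

lemma ker_continuous (k : ℕ) (m s : ℝ) : Continuous (ker k m s) := by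
  unfold ker
  have := gaussPDF_continuous
  fun_prop

lemma ker_hasDerivAt (k : ℕ) (m s : ℝ → ℝ) (m' s' τ x : ℝ) (hm : HasDerivAt m m' τ)
    (hs : HasDerivAt s s' τ) (hs0 : 0 < s τ) :
    HasDerivAt (fun τ => ker k (m τ) (s τ) x)
      (m' / s τ * (ker (k+1) (m τ) (s τ) x - k * ker (k-1) (m τ) (s τ) x)
        + s' / s τ * (ker (k+2) (m τ) (s τ) x - (k+1) * ker k (m τ) (s τ) x)) τ := by
  have hξ : HasDerivAt (fun τ => (x - m τ) / s τ) (-(m' + (x - m τ) / s τ * s') / s τ) τ := by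
    refine ((hm.const_sub x).div hs hs0.ne').congr_deriv ?_
    field_simp
    ring
  have h1 := ((hξ.pow k).mul ((gaussPDF_hasDerivAt _).comp τ hξ)).div hs hs0.ne'
  refine h1.congr_deriv ?_
  unfold ker
  set ξ := (x - m τ) / s τ with hξd
  rcases k with _ | k
  · simp
    field_simp
    ring
  · simp
    field_simp
    ring

lemma int_bound_ker (h : ℝ → ℝ) (hc : Continuous h) (B : ℝ) (hB : ∀ x, |h x| ≤ B) (k : ℕ)
    (m s : ℝ) (hs : 0 < s) (hs1 : s ≤ 1) : Integrable (fun x => h x * ker k m s x) := by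
  have hB0 : 0 ≤ B := (abs_nonneg _).trans (hB 0)
  refine (((integrable_exp_neg_mul_sq (b := 1/8) (by norm_num)).const_mul
    (k.factorial * exp 1 / s * exp (|m| ^ 2 / 4))).const_mul B).mono'
    (hc.mul (ker_continuous k m s)).aestronglyMeasurable (ae_of_all _ fun x => ?_)
  rw [norm_mul]
  exact mul_le_mul (hB x) (ker_bound k m s x |m| s le_rfl hs le_rfl hs1) (norm_nonneg _) hB0

lemma N_hasDerivAt (h : ℝ → ℝ) (hc : Continuous h) (B : ℝ) (hB : ∀ x, |h x| ≤ B) (k : ℕ)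
    (m s m' s' : ℝ → ℝ) (τ0 δ R s0 : ℝ) (hδ : 0 < δ) (hs0 : 0 < s0)
    (hloc : ∀ τ ∈ Metric.ball τ0 δ, HasDerivAt m (m' τ) τ ∧ HasDerivAt s (s' τ) τ ∧ |m τ| ≤ R ∧
      |m' τ| ≤ R ∧ |s' τ| ≤ R ∧ s0 ≤ s τ ∧ s τ ≤ 1) :
    HasDerivAt (fun τ => ∫ x, h x * ker k (m τ) (s τ) x)
      (m' τ0 / s τ0 * ((∫ x, h x * ker (k+1) (m τ0) (s τ0) x)
          - k * ∫ x, h x * ker (k-1) (m τ0) (s τ0) x)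
        + s' τ0 / s τ0 * ((∫ x, h x * ker (k+2) (m τ0) (s τ0) x)
          - (k+1) * ∫ x, h x * ker k (m τ0) (s τ0) x)) τ0 := by
  have hB0 : 0 ≤ B := (abs_nonneg _).trans (hB 0)
  have hτ0 : τ0 ∈ Metric.ball τ0 δ := Metric.mem_ball_self hδ
  obtain ⟨-, -, hm0, hm'0, hs'0, hss0, hss1⟩ := hloc τ0 hτ0
  have hR : 0 ≤ R := (abs_nonneg _).trans hm0
  set D : ℕ → ℝ := fun j => j.factorial * exp 1 / s0 * exp (R ^ 2 / 4) with hD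
  set F' : ℝ → ℝ → ℝ := fun τ x => h x *
    (m' τ / s τ * (ker (k+1) (m τ) (s τ) x - k * ker (k-1) (m τ) (s τ) x)
        + s' τ / s τ * (ker (k+2) (m τ) (s τ) x - (k+1) * ker k (m τ) (s τ) x)) with hF'
  have hpos : 0 < s τ0 := hs0.trans_le hss0
  have hi : ∀ j, Integrable (fun x => h x * ker j (m τ0) (s τ0) x) := fun j =>
    int_bound_ker h hc B hB j _ _ hpos hss1
  have key := hasDerivAt_integral_of_dominated_loc_of_deriv_le (μ := volume)
    (F := fun τ x => h x * ker k (m τ) (s τ) x) (F' := F') (x₀ := τ0)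
    (bound := fun x => B * (R / s0 * (D (k+1) + k * D (k-1)) + R / s0 * (D (k+2) + (k+1) * D k))
      * exp (-(1/8) * x ^ 2)) (Metric.ball_mem_nhds τ0 hδ)
    (Filter.Eventually.of_forall fun τ => (hc.mul (ker_continuous k _ _)).aestronglyMeasurable)
    (hi k) ?_ ?_ ?_ ?_
  · refine key.2.congr_deriv ?_
    simp only [hF']
    rw [← integral_const_mul, ← integral_const_mul, ← integral_sub (hi _) ((hi _).const_mul _),
      ← integral_sub (hi _) ((hi _).const_mul _), ← integral_const_mul, ← integral_const_mul,
      ← integral_add]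
    · congr 1; ext x; ring
    · exact ((hi _).sub ((hi _).const_mul _)).const_mul _
    · exact ((hi _).sub ((hi _).const_mul _)).const_mul _
  · have := ker_continuous
    exact Continuous.aestronglyMeasurable (by fun_prop)
  · refine ae_of_all _ fun x τ hτ => ?_
    obtain ⟨-, -, h1, h2, h3, h4, h5⟩ := hloc τ hτ
    have hkb : ∀ j, |ker j (m τ) (s τ) x| ≤ D j * exp (-(1/8) * x ^ 2) := fun j =>
      ker_bound j _ _ x R s0 h1 hs0 h4 h5
    have hsp : 0 < s τ := hs0.trans_le h4
    simp only [hF']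
    rw [norm_mul, mul_assoc]
    refine mul_le_mul (hB x) ?_ (norm_nonneg _) hB0
    set E := exp (-(1/8) * x ^ 2)
    have q1 : |m' τ / s τ| ≤ R / s0 := by
      rw [abs_div, abs_of_pos hsp]; gcongr
    have q2 : |s' τ / s τ| ≤ R / s0 := by
      rw [abs_div, abs_of_pos hsp]; gcongr
    have q3 : |ker (k+1) (m τ) (s τ) x - k * ker (k-1) (m τ) (s τ) x| ≤
        D (k+1) * E + k * (D (k-1) * E) := by
      refine (abs_sub _ _).trans ?_
      rw [abs_mul, Nat.abs_cast]
      have a1 := hkb (k+1)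
      have a2 := hkb (k-1)
      gcongr
    have q4 : |ker (k+2) (m τ) (s τ) x - (k+1) * ker k (m τ) (s τ) x| ≤
        D (k+2) * E + (k+1) * (D k * E) := by
      refine (abs_sub _ _).trans ?_
      rw [abs_mul, abs_of_pos (by positivity : (0:ℝ) < (k:ℝ) + 1)]
      have a1 := hkb (k+2)
      have a2 := hkb k
      gcongr
    rw [Real.norm_eq_abs]
    refine (abs_add_le _ _).trans ?_
    rw [abs_mul, abs_mul]
    calc _ ≤ R / s0 * (D (k+1) * E + k * (D (k-1) * E)) +
          R / s0 * (D (k+2) * E + (k+1) * (D k * E)) := by gcongr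
      _ = _ := by ring
  · exact (integrable_exp_neg_mul_sq (b := 1/8) (by norm_num)).const_mul _
  · refine ae_of_all _ fun x τ hτ => ?_
    obtain ⟨h1, h2, -, -, -, h4, -⟩ := hloc τ hτ
    exact (ker_hasDerivAt k m s _ _ τ x h1 h2 (hs0.trans_le h4)).const_mul (h x)

/-! ### The moment functions -/

/-- Gaussian average moments. -/
def Mo (k : ℕ) (h : ℝ → ℝ) (t y : ℝ) : ℝ := ∫ z, z ^ k * h (cos t * y + sin t * z) ∂gam

/-- Absolute Gaussian moments. -/
def cM (k : ℕ) : ℝ := ∫ z, |z| ^ k ∂gam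

lemma cM_nonneg (k : ℕ) : 0 ≤ cM k := integral_nonneg fun z => by positivity

lemma cont_gam {X : Type*} [TopologicalSpace X] [FirstCountableTopology X] (k : ℕ)
    (Φ : X → ℝ → ℝ) (hΦ : Continuous (fun p : X × ℝ => Φ p.1 p.2)) (B : ℝ)
    (hB : ∀ x z, |Φ x z| ≤ B) : Continuous fun x => ∫ z, z ^ k * Φ x z ∂gam := by
  refine continuous_of_dominated (bound := fun z => |z| ^ k * B) ?_ ?_ ?_ ?_
  · intro x
    have : Continuous (Φ x) := hΦ.comp (by fun_prop : Continuous fun z : ℝ => (x, z))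
    exact Continuous.aestronglyMeasurable (by fun_prop)
  · intro x
    refine ae_of_all _ fun z => ?_
    rw [norm_mul, norm_pow]
    exact mul_le_mul_of_nonneg_left (hB x z) (by positivity)
  · exact (gam_abs_pow_integrable k).mul_const B
  · refine ae_of_all _ fun z => ?_
    have : Continuous fun x => Φ x z := hΦ.comp (by fun_prop : Continuous fun x : X => (x, z))
    fun_prop

lemma cont_gam0 {X : Type*} [TopologicalSpace X] [FirstCountableTopology X]
    (Φ : X → ℝ → ℝ) (hΦ : Continuous (fun p : X × ℝ => Φ p.1 p.2)) (B : ℝ)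
    (hB : ∀ x z, |Φ x z| ≤ B) : Continuous fun x => ∫ z, Φ x z ∂gam := by
  simpa using cont_gam 0 Φ hΦ B hB

lemma bdd_integrable (f : ℝ → ℝ) (hf : Continuous f) (B : ℝ) (hB : ∀ x, |f x| ≤ B) :
    Integrable f gam :=
  (integrable_const B).mono' hf.aestronglyMeasurable (ae_of_all _ hB)

lemma pow_bdd_integrable (k : ℕ) (f : ℝ → ℝ) (hf : Continuous f) (B : ℝ) (hB : ∀ x, |f x| ≤ B) :
    Integrable (fun z => z ^ k * f z) gam := by
  refine ((gam_abs_pow_integrable k).mul_const B).mono' (by fun_prop) (ae_of_all _ fun z => ?_)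
  rw [norm_mul, norm_pow]
  exact mul_le_mul_of_nonneg_left (hB z) (by positivity)

lemma abs_int_le (f : ℝ → ℝ) (B : ℝ) (hB : ∀ x, |f x| ≤ B) :
    |∫ z, f z ∂gam| ≤ B := by
  have := norm_integral_le_of_norm_le_const (μ := gam) (f := f) (C := B) (ae_of_all _ hB)
  simpa using this

section
variable (h : ℝ → ℝ) (hc : Continuous h) (B : ℝ) (hB : ∀ x, |h x| ≤ B)
include hc hB

lemma Mo_integrable (k : ℕ) (t y : ℝ) :
    Integrable (fun z => z ^ k * h (cos t * y + sin t * z)) gam :=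
  pow_bdd_integrable k _ (by fun_prop) B (fun _ => hB _)

lemma Mo_abs_le (k : ℕ) (t y : ℝ) : |Mo k h t y| ≤ B * cM k := by
  unfold Mo cM
  rw [← integral_const_mul]
  refine (norm_integral_le_integral_norm _).trans (integral_mono (Mo_integrable h hc B hB k t y).norm
    ((gam_abs_pow_integrable k).const_mul B) fun z => ?_)
  simp only [norm_mul, norm_pow]
  rw [mul_comm]
  exact mul_le_mul_of_nonneg_right (hB _) (by positivity)

lemma Mo_continuous (k : ℕ) : Continuous fun p : ℝ × ℝ => Mo k h p.1 p.2 := by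
  unfold Mo
  exact cont_gam k (fun (p : ℝ × ℝ) z => h (cos p.1 * p.2 + sin p.1 * z)) (by fun_prop) B
    (fun _ _ => hB _)

lemma Mo_eq (k : ℕ) (t y : ℝ) (ht : 0 < sin t) :
    Mo k h t y = ∫ x, h x * ker k (cos t * y) (sin t) x := by
  unfold Mo
  rw [gam_integral]
  set Φ : ℝ → ℝ := fun z => z ^ k * h (cos t * y + sin t * z) * gaussPDF z with hΦ
  have h1 : ∫ x, Φ ((x - cos t * y) / sin t) = sin t * ∫ z, Φ z := by
    rw [integral_sub_right_eq_self (fun x => Φ (x / sin t)) (cos t * y),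
      Measure.integral_comp_div, abs_of_pos ht, smul_eq_mul]
  have h2 : ∫ z, Φ z = ∫ x, (sin t)⁻¹ * Φ ((x - cos t * y) / sin t) := by
    rw [integral_const_mul, h1]; field_simp
  rw [h2]
  congr 1
  ext x
  simp only [hΦ, ker]
  rw [show cos t * y + sin t * ((x - cos t * y) / sin t) = x by field_simp; ring]
  ring

lemma Mo_dy (k : ℕ) (t y : ℝ) (ht : 0 < sin t) :
    HasDerivAt (fun y => Mo k h t y)
      (cos t / sin t * (Mo (k+1) h t y - k * Mo (k-1) h t y)) y := by
  simp only [Mo_eq h hc B hB _ _ _ ht]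
  have := N_hasDerivAt h hc B hB k (fun y => cos t * y) (fun _ => sin t) (fun _ => cos t)
    (fun _ => 0) y 1 (|y| + 1) (sin t) one_pos ht ?_
  · refine this.congr_deriv ?_
    ring
  · intro τ hτ
    have hτ' : |τ| ≤ |y| + 1 := by
      have : |τ - y| < 1 := by simpa [Real.dist_eq] using hτ
      have := abs_sub_abs_le_abs_sub τ y
      linarith
    refine ⟨by simpa using (hasDerivAt_id τ).const_mul (cos t), hasDerivAt_const _ _, ?_, ?_, ?_,
      le_rfl, sin_le_one t⟩
    · rw [abs_mul]
      have := abs_cos_le_one t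
      nlinarith [abs_nonneg τ, abs_nonneg (cos t)]
    · have := abs_cos_le_one t
      have := abs_nonneg y
      linarith
    · simp; positivity

lemma Mo_dt (k : ℕ) (t y : ℝ) (ht : t ∈ Ioo 0 (π / 2)) :
    HasDerivAt (fun t => Mo k h t y)
      (-y * (Mo (k+1) h t y - k * Mo (k-1) h t y)
        + cos t / sin t * (Mo (k+2) h t y - (k+1) * Mo k h t y)) t := by
  have hpi := Real.pi_pos
  set δ := min (t / 2) ((π / 2 - t)) with hδ
  have hδ0 : 0 < δ := lt_min (by linarith [ht.1]) (by linarith [ht.2])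
  have hball : ∀ τ ∈ Metric.ball t δ, t / 2 < τ ∧ τ < π / 2 := by
    intro τ hτ
    have : |τ - t| < δ := by simpa [Real.dist_eq] using hτ
    rw [abs_lt] at this
    have h1 := min_le_left (t/2) (π/2 - t)
    have h2 := min_le_right (t/2) (π/2 - t)
    constructor <;> linarith
  have hs0 : 0 < sin (t / 2) := sin_pos_of_pos_of_lt_pi (by linarith [ht.1]) (by linarith [ht.2])
  have hst : 0 < sin t := sin_pos_of_pos_of_lt_pi ht.1 (by linarith [ht.2])
  have := N_hasDerivAt h hc B hB k (fun t => cos t * y) (fun t => sin t) (fun t => -sin t * y)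
    (fun t => cos t) t δ (|y| + 1) (sin (t/2)) hδ0 hs0 ?_
  · have h2 : (fun t => Mo k h t y) =ᶠ[nhds t]
        fun τ => ∫ x, h x * ker k (cos τ * y) (sin τ) x := by
      filter_upwards [Metric.ball_mem_nhds t hδ0] with τ hτ
      exact Mo_eq h hc B hB _ _ _ (sin_pos_of_pos_of_lt_pi (by linarith [ht.1, (hball τ hτ).1])
        (by linarith [(hball τ hτ).2]))
    refine (this.congr_of_eventuallyEq h2).congr_deriv ?_
    simp only [Mo_eq h hc B hB _ _ _ hst]
    field_simp
  · intro τ hτ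
    obtain ⟨h1, h2⟩ := hball τ hτ
    have hc1 := abs_cos_le_one τ
    have hs1 := abs_sin_le_one τ
    have hy := abs_nonneg y
    refine ⟨(hasDerivAt_cos τ).mul_const y, hasDerivAt_sin τ, ?_, ?_, by linarith,
      sin_le_sin_of_le_of_le_pi_div_two (by linarith [ht.1]) h2.le h1.le, sin_le_one τ⟩
    · rw [abs_mul]; nlinarith [abs_nonneg (cos τ)]
    · rw [abs_mul, abs_neg]; nlinarith [abs_nonneg (sin τ)]

end

/-! ### Bounded continuous functions -/

/-- bounded continuous -/
def BC {α : Type*} [TopologicalSpace α] (f : α → ℝ) : Prop := Continuous f ∧ ∃ C, ∀ x, |f x| ≤ C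

namespace BC
variable {α : Type*} [TopologicalSpace α] {f g : α → ℝ}

lemma const (c : ℝ) : BC (fun _ : α => c) := ⟨continuous_const, |c|, fun _ => le_rfl⟩

lemma add (hf : BC f) (hg : BC g) : BC (fun x => f x + g x) := by
  obtain ⟨cf, C, hC⟩ := hf
  obtain ⟨cg, D, hD⟩ := hg
  exact ⟨cf.add cg, C + D, fun x => (abs_add_le _ _).trans (add_le_add (hC x) (hD x))⟩

lemma mul (hf : BC f) (hg : BC g) : BC (fun x => f x * g x) := by
  obtain ⟨cf, C, hC⟩ := hf
  obtain ⟨cg, D, hD⟩ := hg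
  refine ⟨cf.mul cg, C * D, fun x => ?_⟩
  rw [abs_mul]
  exact mul_le_mul (hC x) (hD x) (abs_nonneg _) ((abs_nonneg _).trans (hC x))

lemma neg (hf : BC f) : BC (fun x => - f x) := by
  simpa using (BC.const (-1)).mul hf

lemma sub (hf : BC f) (hg : BC g) : BC (fun x => f x - g x) := by
  simpa [sub_eq_add_neg] using hf.add hg.neg

lemma pow (hf : BC f) (n : ℕ) : BC (fun x => f x ^ n) := by
  induction n with
  | zero => simpa using BC.const (α := α) 1
  | succ n ih => simpa [pow_succ] using ih.mul hf

lemma inv (hf : BC f) (a : ℝ) (ha : 0 < a) (h : ∀ x, a ≤ f x) : BC (fun x => (f x)⁻¹) := by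
  refine ⟨hf.1.inv₀ fun x => (ha.trans_le (h x)).ne', a⁻¹, fun x => ?_⟩
  have := ha.trans_le (h x)
  rw [abs_of_pos (inv_pos.2 this)]
  exact inv_anti₀ ha (h x)

lemma div (hg : BC g) (hf : BC f) (a : ℝ) (ha : 0 < a) (h : ∀ x, a ≤ f x) :
    BC (fun x => g x / f x) := by
  simpa [div_eq_mul_inv] using hg.mul (hf.inv a ha h)

lemma log (hf : BC f) (a : ℝ) (ha : 0 < a) (h : ∀ x, a ≤ f x) : BC (fun x => Real.log (f x)) := by
  obtain ⟨cf, C, hC⟩ := hf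
  refine ⟨cf.log fun x => (ha.trans_le (h x)).ne', |Real.log a| + |Real.log C|, fun x => ?_⟩
  have h1 := Real.log_le_log ha (h x)
  have h2 := Real.log_le_log (ha.trans_le (h x)) ((le_abs_self _).trans (hC x))
  rw [abs_le]
  have := neg_abs_le (Real.log a)
  have := le_abs_self (Real.log C)
  have := abs_nonneg (Real.log a)
  have := abs_nonneg (Real.log C)
  constructor <;> linarith

lemma comp {β : Type*} [TopologicalSpace β] (hf : BC f) (φ : β → α) (hφ : Continuous φ) :
    BC (fun x => f (φ x)) := ⟨hf.1.comp hφ, hf.2.imp fun _ h x => h _⟩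

lemma integrable {f : ℝ → ℝ} (hf : BC f) : Integrable f gam := by
  obtain ⟨cf, C, hC⟩ := hf
  exact bdd_integrable f cf C hC

lemma pow_integrable {f : ℝ → ℝ} (hf : BC f) (k : ℕ) : Integrable (fun z => z ^ k * f z) gam := by
  obtain ⟨cf, C, hC⟩ := hf
  exact pow_bdd_integrable k f cf C hC

lemma int {X : Type*} [TopologicalSpace X] [FirstCountableTopology X] {Φ : X → ℝ → ℝ}
    (h : BC fun p : X × ℝ => Φ p.1 p.2) : BC fun x => ∫ z, Φ x z ∂gam := by
  obtain ⟨cf, C, hC⟩ := h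
  exact ⟨cont_gam0 Φ cf C fun x z => hC (x, z), C, fun x => abs_int_le _ _ fun z => hC (x, z)⟩

lemma int_pow {X : Type*} [TopologicalSpace X] [FirstCountableTopology X] {Φ : X → ℝ → ℝ} (k : ℕ)
    (h : BC fun p : X × ℝ => Φ p.1 p.2) : BC fun x => ∫ z, z ^ k * Φ x z ∂gam := by
  obtain ⟨cf, C, hC⟩ := h
  refine ⟨cont_gam k Φ cf C fun x z => hC (x, z), C * cM k, fun x => ?_⟩
  unfold cM
  rw [← integral_const_mul]
  have hx : Continuous (Φ x) := cf.comp (by fun_prop : Continuous fun z : ℝ => (x, z))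
  refine (norm_integral_le_integral_norm _).trans (integral_mono
    (pow_bdd_integrable k _ hx C fun z => hC (x, z)).norm
    ((gam_abs_pow_integrable k).const_mul C) fun z => ?_)
  simp only [norm_mul, norm_pow]
  rw [mul_comm]
  exact mul_le_mul_of_nonneg_right (hC (x, z)) (by positivity)

end BC

/-- General evolution lemma. -/
lemma flow_deriv (Ψ p q pd : ℝ → ℝ → ℝ)
    (hΨ : BC fun x : ℝ × ℝ => Ψ x.1 x.2) (hp : BC fun x : ℝ × ℝ => p x.1 x.2)
    (hq : BC fun x : ℝ × ℝ => q x.1 x.2) (hpd : BC fun x : ℝ × ℝ => pd x.1 x.2)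
    (hdt : ∀ t ∈ Ioo 0 (π / 2), ∀ y,
      HasDerivAt (fun t => Ψ t y) (-y * p t y + cos t / sin t * q t y) t)
    (hdy : ∀ t ∈ Ioo 0 (π / 2), ∀ y, HasDerivAt (fun y => p t y) (cos t / sin t * pd t y) y)
    (t : ℝ) (ht : t ∈ Ioo 0 (π / 2)) :
    HasDerivAt (fun t => ∫ y, Ψ t y ∂gam) (cos t / sin t * ∫ y, (q t y - pd t y) ∂gam) t := by
  have hpi := Real.pi_pos
  have sec : ∀ t : ℝ, Continuous fun y : ℝ => (t, y) := fun t => by fun_prop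
  have bΨ := fun t => hΨ.comp _ (sec t)
  have bp := fun t => hp.comp _ (sec t)
  have bq := fun t => hq.comp _ (sec t)
  have bpd := fun t => hpd.comp _ (sec t)
  simp only at bΨ bp bq bpd
  obtain ⟨-, P, hP⟩ := hp
  obtain ⟨-, Q, hQ⟩ := hq
  obtain ⟨-, PD, hPD⟩ := hpd
  set s0 := sin (t / 2)
  have hs0 : 0 < s0 := sin_pos_of_pos_of_lt_pi (by linarith [ht.1]) (by linarith [ht.2])
  have hU : Ioo (t/2) (π/2) ∈ nhds t := Ioo_mem_nhds (by linarith [ht.1]) ht.2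
  have ip : Integrable (fun y => y * p t y) gam := by simpa using (bp t).pow_integrable 1
  have iq : Integrable (fun y => q t y) gam := (bq t).integrable
  have ipd : Integrable (fun y => pd t y) gam := (bpd t).integrable
  have key := hasDerivAt_integral_of_dominated_loc_of_deriv_le (μ := gam)
    (F := Ψ) (F' := fun t y => -y * p t y + cos t / sin t * q t y) (x₀ := t)
    (bound := fun y => |y| ^ 1 * P + 1 / s0 * Q) hU
    (Filter.Eventually.of_forall fun τ => (bΨ τ).1.aestronglyMeasurable)
    (bΨ t).integrable ?_ ?_ ?_ ?_
  · refine key.2.congr_deriv ?_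
    have e1 : ∫ y, y * p t y ∂gam = ∫ y, cos t / sin t * pd t y ∂gam := by
      refine gam_ibp _ _ (hdy t ht) (continuous_const.mul (bpd t).1) (max P (|cos t / sin t| * PD))
        (fun y => (hP (t, y)).trans (le_max_left _ _)) fun y => ?_
      rw [abs_mul]
      exact (mul_le_mul_of_nonneg_left (hPD (t, y)) (abs_nonneg _)).trans (le_max_right _ _)
    have e2 : ∫ y, (-y * p t y + cos t / sin t * q t y) ∂gam
        = -(∫ y, y * p t y ∂gam) + cos t / sin t * ∫ y, q t y ∂gam := by
      have ipn : Integrable (fun y => -(y * p t y)) gam := ip.neg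
      rw [← integral_const_mul, ← integral_neg, ← integral_add ipn (iq.const_mul _)]
      congr 1; ext y; ring
    rw [e2, e1, integral_const_mul, integral_sub iq ipd]
    ring
  · exact Continuous.aestronglyMeasurable
      ((continuous_neg.mul (bp t).1).add (continuous_const.mul (bq t).1))
  · refine ae_of_all _ fun y τ hτ => ?_
    have hc : s0 ≤ sin τ :=
      sin_le_sin_of_le_of_le_pi_div_two (by linarith [ht.1]) hτ.2.le hτ.1.le
    have h1 : |cos τ / sin τ| ≤ 1 / s0 := by
      rw [abs_div, abs_of_pos (hs0.trans_le hc)]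
      have := abs_cos_le_one τ
      gcongr
    refine (abs_add_le _ _).trans ?_
    rw [abs_mul, abs_mul, abs_neg, pow_one]
    exact add_le_add (mul_le_mul_of_nonneg_left (hP (τ, y)) (abs_nonneg _))
      (mul_le_mul h1 (hQ (τ, y)) (abs_nonneg _) (by positivity))
  · exact ((gam_abs_pow_integrable 1).mul_const P).add (integrable_const _)
  · refine ae_of_all _ fun y τ hτ => ?_
    exact hdt τ ⟨by linarith [hτ.1, ht.1], hτ.2⟩ y

/-- entropy along the flow -/
def Ent (h : ℝ → ℝ) (t : ℝ) : ℝ := ∫ y, Mo 0 h t y * log (Mo 0 h t y) ∂gam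

/-- Fisher-type functional along the flow -/
def Rf (h : ℝ → ℝ) (t : ℝ) : ℝ := ∫ y, Mo 1 h t y ^ 2 / Mo 0 h t y ∂gam

/-- normalized conditional variance -/
def Ga (h : ℝ → ℝ) (t y : ℝ) : ℝ := Mo 2 h t y / Mo 0 h t y - (Mo 1 h t y / Mo 0 h t y) ^ 2

section
variable (h : ℝ → ℝ) (hc : Continuous h) (a b : ℝ) (ha : 0 < a) (hab : ∀ x, a ≤ h x ∧ h x ≤ b)
include hc ha hab

lemma abs_h_le (x : ℝ) : |h x| ≤ b := by
  rw [abs_of_pos (ha.trans_le (hab x).1)]; exact (hab x).2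

lemma h_BC : BC h := ⟨hc, b, abs_h_le h hc a b ha hab⟩

lemma Mo_BC (k : ℕ) : BC fun p : ℝ × ℝ => Mo k h p.1 p.2 :=
  ⟨Mo_continuous h hc b (abs_h_le h hc a b ha hab) k, b * cM k, fun p =>
    Mo_abs_le h hc b (abs_h_le h hc a b ha hab) k p.1 p.2⟩

lemma Mo_BC' (k : ℕ) (t : ℝ) : BC fun y : ℝ => Mo k h t y :=
  (Mo_BC h hc a b ha hab k).comp (fun y : ℝ => (t, y)) (by fun_prop)

lemma Mo0_ge (t y : ℝ) : a ≤ Mo 0 h t y := by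
  unfold Mo
  have := integral_mono (μ := gam) (integrable_const a)
    (Mo_integrable h hc b (abs_h_le h hc a b ha hab) 0 t y) (fun z => by simpa using (hab _).1)
  simpa using this

lemma Mo0_pos (t y : ℝ) : 0 < Mo 0 h t y := ha.trans_le (Mo0_ge h hc a b ha hab t y)

lemma Ent_deriv (t : ℝ) (ht : t ∈ Ioo 0 (π / 2)) :
    HasDerivAt (Ent h) (-(cos t / sin t) * Rf h t) t := by
  have hB := abs_h_le h hc a b ha hab
  have h0 := fun p : ℝ × ℝ => Mo0_ge h hc a b ha hab p.1 p.2
  have hp := Mo0_pos h hc a b ha hab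
  have M0 := Mo_BC h hc a b ha hab 0
  have M1 := Mo_BC h hc a b ha hab 1
  have M2 := Mo_BC h hc a b ha hab 2
  have lg := M0.log a ha h0
  have key := flow_deriv (fun t y => Mo 0 h t y * log (Mo 0 h t y))
    (fun t y => (log (Mo 0 h t y) + 1) * Mo 1 h t y)
    (fun t y => (log (Mo 0 h t y) + 1) * (Mo 2 h t y - Mo 0 h t y))
    (fun t y => Mo 1 h t y ^ 2 / Mo 0 h t y + (log (Mo 0 h t y) + 1) * (Mo 2 h t y - Mo 0 h t y))
    (M0.mul lg) ((lg.add (BC.const 1)).mul M1) ((lg.add (BC.const 1)).mul (M2.sub M0))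
    (((M1.pow 2).div M0 a ha h0).add ((lg.add (BC.const 1)).mul (M2.sub M0))) ?_ ?_ t ht
  · refine key.congr_deriv ?_
    unfold Rf
    rw [neg_mul, ← mul_neg, ← integral_neg]
    congr 2; ext y; ring
  · intro t ht y
    have d0 := Mo_dt h hc b hB 0 t y ht
    refine (d0.mul (d0.log (hp t y).ne')).congr_deriv ?_
    have := (hp t y).ne'
    field_simp
    simp
    ring
  · intro t ht y
    have hs : 0 < sin t := sin_pos_of_pos_of_lt_pi ht.1 (by linarith [ht.2, pi_pos])
    have d0 := Mo_dy h hc b hB 0 t y hs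
    have d1 := Mo_dy h hc b hB 1 t y hs
    refine (((d0.log (hp t y).ne').add_const 1).mul d1).congr_deriv ?_
    have := (hp t y).ne'
    simp
    field_simp

lemma Rf_deriv (hz : ∀ t, ∫ y, Mo 2 h t y ∂gam = ∫ y, Mo 0 h t y ∂gam)
    (t : ℝ) (ht : t ∈ Ioo 0 (π / 2)) :
    HasDerivAt (Rf h) (2 * (cos t / sin t) *
      ∫ y, Mo 0 h t y * (Ga h t y - Ga h t y ^ 2) ∂gam) t := by
  have hB := abs_h_le h hc a b ha hab
  have h0 := fun p : ℝ × ℝ => Mo0_ge h hc a b ha hab p.1 p.2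
  have h0' := Mo0_ge h hc a b ha hab t
  have hp := Mo0_pos h hc a b ha hab
  have M0 := Mo_BC h hc a b ha hab 0
  have M1 := Mo_BC h hc a b ha hab 1
  have M2 := Mo_BC h hc a b ha hab 2
  have M3 := Mo_BC h hc a b ha hab 3
  have I0 := M0.inv a ha h0
  have N0 := Mo_BC' h hc a b ha hab 0 t
  have N1 := Mo_BC' h hc a b ha hab 1 t
  have N2 := Mo_BC' h hc a b ha hab 2 t
  have NG : BC fun y => Ga h t y :=
    (N2.div N0 a ha h0').sub ((N1.div N0 a ha h0').pow 2)
  have two := BC.const (α := ℝ × ℝ) 2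
  have three := BC.const (α := ℝ × ℝ) 3
  have key := flow_deriv (fun t y => Mo 1 h t y ^ 2 / Mo 0 h t y)
    (fun t y => 2 * (Mo 1 h t y * (Mo 0 h t y)⁻¹) * (Mo 2 h t y - Mo 0 h t y)
      - Mo 1 h t y ^ 3 * (Mo 0 h t y)⁻¹ ^ 2)
    (fun t y => 2 * (Mo 1 h t y * (Mo 0 h t y)⁻¹) * (Mo 3 h t y - 2 * Mo 1 h t y)
      - Mo 1 h t y ^ 2 * (Mo 0 h t y)⁻¹ ^ 2 * (Mo 2 h t y - Mo 0 h t y))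
    (fun t y => 2 * ((Mo 2 h t y - Mo 0 h t y) * (Mo 0 h t y)⁻¹ - Mo 1 h t y ^ 2 * (Mo 0 h t y)⁻¹ ^ 2)
        * (Mo 2 h t y - Mo 0 h t y)
      + 2 * (Mo 1 h t y * (Mo 0 h t y)⁻¹) * (Mo 3 h t y - 3 * Mo 1 h t y)
      - 3 * (Mo 1 h t y ^ 2 * (Mo 0 h t y)⁻¹ ^ 2) * (Mo 2 h t y - Mo 0 h t y)
      + 2 * (Mo 1 h t y ^ 4 * (Mo 0 h t y)⁻¹ ^ 3))
    ((M1.pow 2).div M0 a ha h0)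
    (((two.mul (M1.mul I0)).mul (M2.sub M0)).sub ((M1.pow 3).mul (I0.pow 2)))
    (((two.mul (M1.mul I0)).mul (M3.sub (two.mul M1))).sub
      (((M1.pow 2).mul (I0.pow 2)).mul (M2.sub M0)))
    (((((two.mul (((M2.sub M0).mul I0).sub ((M1.pow 2).mul (I0.pow 2)))).mul (M2.sub M0)).add
      ((two.mul (M1.mul I0)).mul (M3.sub (three.mul M1)))).sub
      ((three.mul ((M1.pow 2).mul (I0.pow 2))).mul (M2.sub M0))).add
      (two.mul ((M1.pow 4).mul (I0.pow 3))))
    ?_ ?_ t ht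
  · refine key.congr_deriv ?_
    rw [mul_comm 2 (cos t / sin t), mul_assoc]
    congr 1
    have e1 : 2 * ∫ y, Mo 0 h t y * (Ga h t y - Ga h t y ^ 2) ∂gam
        = ∫ y, (2 * (Mo 0 h t y * (Ga h t y - Ga h t y ^ 2))
          + 2 * (Mo 2 h t y - Mo 0 h t y)) ∂gam := by
      rw [integral_add ((N0.mul (NG.sub (NG.pow 2))).integrable.const_mul 2)
        ((N2.sub N0).integrable.const_mul 2), integral_const_mul, integral_const_mul,
        integral_sub N2.integrable N0.integrable, hz t]
      ring
    rw [e1]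
    congr 1; ext y
    have := (hp t y).ne'
    unfold Ga
    field_simp
    ring
  · intro t ht y
    have d0 := Mo_dt h hc b hB 0 t y ht
    have d1 := Mo_dt h hc b hB 1 t y ht
    refine ((d1.pow 2).div d0 (hp t y).ne').congr_deriv ?_
    have := (hp t y).ne'
    field_simp
    simp
    ring
  · intro t ht y
    have hs : 0 < sin t := sin_pos_of_pos_of_lt_pi ht.1 (by linarith [ht.2, pi_pos])
    have d0 := Mo_dy h hc b hB 0 t y hs
    have d1 := Mo_dy h hc b hB 1 t y hs
    have d2 := Mo_dy h hc b hB 2 t y hs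
    have di := d0.inv (hp t y).ne'
    refine ((((d1.mul di).const_mul 2).mul (d2.sub d0)).sub ((d1.pow 3).mul (di.pow 2))).congr_deriv ?_
    have := (hp t y).ne'
    simp
    field_simp
    ring

end

lemma quad_integrable (f : ℝ × ℝ → ℝ) (hf : Continuous f) (C : ℝ)
    (hC : ∀ p : ℝ × ℝ, |f p| ≤ C * (1 + p.1 ^ 2 + p.2 ^ 2)) : Integrable f (gam.prod gam) := by
  refine gam_prod_integrable f hf |C| fun y z => ?_
  refine (hC _).trans ((mul_le_mul_of_nonneg_right (le_abs_self C) (by positivity)).trans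
    (mul_le_mul_of_nonneg_left ?_ (abs_nonneg _)))
  simp only
  nlinarith [mul_nonneg (sq_nonneg y) (sq_nonneg z)]

lemma int3 {X : Type*} [MeasurableSpace X] {μ : Measure X} {f g k : X → ℝ} (hf : Integrable f μ)
    (hg : Integrable g μ) (hk : Integrable k μ) (a b c : ℝ) :
    Integrable (fun z => a * f z + b * g z + c * k z) μ ∧
    ∫ z, (a * f z + b * g z + c * k z) ∂μ = a * (∫ z, f z ∂μ) + b * (∫ z, g z ∂μ) + c * ∫ z, k z ∂μ := by
  have h1 : Integrable (fun z => a * f z + b * g z) μ := (hf.const_mul a).add (hg.const_mul b)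
  refine ⟨h1.add (hk.const_mul c), ?_⟩
  rw [integral_add h1 (hk.const_mul c), integral_add (hf.const_mul a) (hg.const_mul b),
    integral_const_mul, integral_const_mul, integral_const_mul]

lemma gam_quad (a b c : ℝ) : Integrable (fun z : ℝ => a * 1 + b * z + c * z ^ 2) gam ∧
    ∫ z, (a * 1 + b * z + c * z ^ 2) ∂gam = a + c := by
  have i1 : Integrable (fun z : ℝ => z) gam := by simpa using gam_pow_integrable 1
  have := int3 (μ := gam) (integrable_const (1:ℝ)) i1 (gam_pow_integrable 2) a b c
  refine ⟨this.1, ?_⟩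
  rw [this.2, gam_m1, gam_m2]; simp

/-- rotation invariance, iterated form -/
lemma rot_iter (t : ℝ) (f : ℝ × ℝ → ℝ) (hf : Continuous f) (C : ℝ)
    (hC : ∀ p : ℝ × ℝ, |f p| ≤ C * (1 + p.1 ^ 2 + p.2 ^ 2)) :
    ∫ y, ∫ z, f (cos t * y + sin t * z, -sin t * y + cos t * z) ∂gam ∂gam
      = ∫ y, ∫ z, f (y, z) ∂gam ∂gam := by
  have h1 := gam_rot t f hf
  rw [integral_prod _ (quad_integrable f hf C hC), integral_prod _ (quad_integrable _ (by fun_prop) C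
    (fun p => ?_))] at h1
  · exact h1
  · refine (hC _).trans (le_of_eq ?_)
    simp only
    linear_combination (C * (p.1^2 + p.2^2)) * (sin_sq_add_cos_sq t)

/-- admissible densities relative to the Gaussian -/
structure Adm (h : ℝ → ℝ) (K : ℝ) : Prop where
  one_le : 1 ≤ K
  cont : Continuous h
  bd : ∀ x, 1 / K ≤ h x ∧ h x ≤ K
  m0 : ∫ x, h x ∂gam = 1
  m1 : ∫ x, x * h x ∂gam = 0
  m2 : ∫ x, x ^ 2 * h x ∂gam = 1

namespace Adm
variable {h : ℝ → ℝ} {K : ℝ} (H : Adm h K)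
include H

lemma kpos : 0 < K := by linarith [H.one_le]
lemma tpos : 0 < 1 / K := by have := H.kpos; positivity
lemma abs_le (x : ℝ) : |h x| ≤ K := abs_h_le h H.cont _ K H.tpos H.bd x
lemma hBC : BC h := ⟨H.cont, K, H.abs_le⟩
lemma M_BC (k : ℕ) : BC fun p : ℝ × ℝ => Mo k h p.1 p.2 := Mo_BC h H.cont _ K H.tpos H.bd k
lemma M_BC' (k : ℕ) (t : ℝ) : BC fun y : ℝ => Mo k h t y := Mo_BC' h H.cont _ K H.tpos H.bd k t
lemma M0_ge (t y : ℝ) : 1 / K ≤ Mo 0 h t y := Mo0_ge h H.cont _ K H.tpos H.bd t y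
lemma M0_pos (t y : ℝ) : 0 < Mo 0 h t y := H.tpos.trans_le (H.M0_ge t y)
lemma M_int (k : ℕ) (t y : ℝ) : Integrable (fun z => z ^ k * h (cos t * y + sin t * z)) gam :=
  Mo_integrable h H.cont K H.abs_le k t y
lemma M0_le (t y : ℝ) : Mo 0 h t y ≤ K := by
  unfold Mo
  have := integral_mono (μ := gam) (H.M_int 0 t y) (integrable_const K) (fun z => by simpa using (H.bd _).2)
  simpa using this

lemma Mo_rot (k : ℕ) (hk : k ≤ 2) (t : ℝ) :
    ∫ y, Mo k h t y ∂gam = ∫ y, ∫ z, (sin t * y + cos t * z) ^ k * h y ∂gam ∂gam := by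
  have hcont := H.cont
  have := rot_iter t (fun p => (sin t * p.1 + cos t * p.2) ^ k * h p.1) (by fun_prop) (2 * K)
    (fun p => ?_)
  · simp only at this
    rw [← this]
    unfold Mo
    congr 1; ext y; congr 1; ext z
    congr 2
    linear_combination (-z) * sin_sq_add_cos_sq t
  · have hb := H.abs_le p.1
    have hK := H.kpos
    rw [abs_mul, mul_comm, abs_pow]
    have h1 : |sin t * p.1 + cos t * p.2| ^ 2 ≤ p.1^2 + p.2^2 := by
      rw [sq_abs]
      nlinarith [sq_nonneg (cos t * p.1 - sin t * p.2), sin_sq_add_cos_sq t]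
    have h2 : |sin t * p.1 + cos t * p.2| ^ k ≤ 1 + |sin t * p.1 + cos t * p.2| ^ 2 := by
      generalize |sin t * p.1 + cos t * p.2| = w
      interval_cases k
      · nlinarith [sq_nonneg w]
      · nlinarith [sq_nonneg (w-1), sq_nonneg w]
      · linarith
    calc |h p.1| * |sin t * p.1 + cos t * p.2| ^ k ≤ K * (1 + p.1^2 + p.2^2) := by
          apply mul_le_mul hb (by linarith) (by positivity) hK.le
      _ ≤ _ := by nlinarith [sq_nonneg p.1, sq_nonneg p.2]

lemma int_M0 (t : ℝ) : ∫ y, Mo 0 h t y ∂gam = 1 := by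
  rw [H.Mo_rot 0 (by norm_num)]
  simpa using H.m0

lemma int_M1 (t : ℝ) : ∫ y, Mo 1 h t y ∂gam = 0 := by
  rw [H.Mo_rot 1 (by norm_num)]
  have : ∀ y, ∫ z, (sin t * y + cos t * z) ^ 1 * h y ∂gam = sin t * (y * h y) := by
    intro y
    rw [integral_mul_const]
    have e : ∀ z, (sin t * y + cos t * z) ^ 1 = (sin t * y) * 1 + cos t * z + 0 * z ^ 2 := fun z => by ring
    simp only [e]
    rw [(gam_quad _ _ _).2]; ring
  simp only [this]
  rw [integral_const_mul, H.m1, mul_zero]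

lemma int_M2 (t : ℝ) : ∫ y, Mo 2 h t y ∂gam = 1 := by
  rw [H.Mo_rot 2 (by norm_num)]
  have : ∀ y, ∫ z, (sin t * y + cos t * z) ^ 2 * h y ∂gam
      = sin t ^ 2 * (y ^ 2 * h y) + cos t ^ 2 * h y := by
    intro y
    rw [integral_mul_const]
    have e : ∀ z, (sin t * y + cos t * z) ^ 2
      = (sin t * y) ^ 2 * 1 + (2 * sin t * y * cos t) * z + cos t ^ 2 * z ^ 2 := fun z => by ring
    simp only [e]
    rw [(gam_quad _ _ _).2]; ring
  simp only [this]
  rw [integral_add ((H.hBC.pow_integrable 2).const_mul _) (H.hBC.integrable.const_mul _),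
    integral_const_mul, integral_const_mul, H.m0, H.m2]
  nlinarith [sin_sq_add_cos_sq t]

lemma Ga_BC (t : ℝ) : BC fun y => Ga h t y :=
  ((H.M_BC' 2 t).div (H.M_BC' 0 t) _ H.tpos (H.M0_ge t)).sub
    (((H.M_BC' 1 t).div (H.M_BC' 0 t) _ H.tpos (H.M0_ge t)).pow 2)

lemma eGa (t y : ℝ) : Mo 0 h t y * Ga h t y = Mo 2 h t y - Mo 1 h t y ^ 2 / Mo 0 h t y := by
  have := (H.M0_pos t y).ne'
  unfold Ga; field_simp

lemma eGa_ge (t y : ℝ) : 1 / K ≤ Mo 0 h t y * Ga h t y := by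
  set m := Mo 1 h t y / Mo 0 h t y with hm
  have hp := (H.M0_pos t y).ne'
  have e : ∀ z, (z - m) ^ 2 * h (cos t * y + sin t * z) = 1 * (z ^ 2 * h (cos t * y + sin t * z))
      + (- (2 * m)) * (z ^ 1 * h (cos t * y + sin t * z)) + m ^ 2 * (z ^ 0 * h (cos t * y + sin t * z)) :=
      fun z => by ring
  have q1 := int3 (H.M_int 2 t y) (H.M_int 1 t y) (H.M_int 0 t y) 1 (-(2 * m)) (m ^ 2)
  have e1 : Mo 0 h t y * Ga h t y = ∫ z, (z - m) ^ 2 * h (cos t * y + sin t * z) ∂gam := by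
    simp only [e]
    rw [q1.2]
    change _ = 1 * Mo 2 h t y + -(2 * m) * Mo 1 h t y + m ^ 2 * Mo 0 h t y
    rw [hm]; unfold Ga; field_simp; ring
  have q2 := gam_quad (m ^ 2) (- (2 * m)) 1
  have e' : ∀ z : ℝ, (z - m) ^ 2 = m ^ 2 * 1 + (- (2 * m)) * z + 1 * z ^ 2 := fun z => by ring
  have e2 : ∫ z, (z - m) ^ 2 * (1 / K) ∂gam = (m ^ 2 + 1) * (1 / K) := by
    rw [integral_mul_const]
    simp only [e']
    rw [q2.2]
  have iq : Integrable (fun z : ℝ => (z - m) ^ 2 * h (cos t * y + sin t * z)) gam := by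
    simp only [e]
    exact q1.1
  have iq2 : Integrable (fun z : ℝ => (z - m) ^ 2 * (1 / K)) gam := by
    simp only [e']
    exact q2.1.mul_const _
  have := integral_mono iq2 iq fun z => mul_le_mul_of_nonneg_left (H.bd (cos t * y + sin t * z)).1 (sq_nonneg _)
  rw [e2] at this
  rw [e1]
  nlinarith [H.tpos, sq_nonneg m]

lemma Ga_pos (t y : ℝ) : 0 < Ga h t y :=
  pos_of_mul_pos_right (H.tpos.trans_le (H.eGa_ge t y)) (H.M0_pos t y).le

lemma Rf_BC : BC (Rf h) := by
  refine BC.int (Φ := fun t y => Mo 1 h t y ^ 2 / Mo 0 h t y) ?_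
  exact ((H.M_BC 1).pow 2).div (H.M_BC 0) _ H.tpos fun p => H.M0_ge _ _

lemma Ent_BC : BC (Ent h) := by
  refine BC.int (Φ := fun t y => Mo 0 h t y * log (Mo 0 h t y)) ?_
  exact (H.M_BC 0).mul ((H.M_BC 0).log _ H.tpos fun p => H.M0_ge _ _)

lemma int_eGa (t : ℝ) : ∫ y, Mo 0 h t y * Ga h t y ∂gam = 1 - Rf h t := by
  simp only [H.eGa]
  rw [integral_sub (H.M_BC' 2 t).integrable
    (((H.M_BC' 1 t).pow 2).div (H.M_BC' 0 t) _ H.tpos fun p => H.M0_ge _ _).integrable, H.int_M2]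
  rfl

lemma Rf_nonneg (t : ℝ) : 0 ≤ Rf h t :=
  integral_nonneg fun y => div_nonneg (sq_nonneg _) (H.M0_pos t y).le

lemma Rf_le (t : ℝ) : 1 / K ≤ 1 - Rf h t := by
  rw [← H.int_eGa]
  have := integral_mono (μ := gam) (integrable_const (1 / K)) ((H.M_BC' 0 t).mul (H.Ga_BC t)).integrable
    (fun y => H.eGa_ge t y)
  simpa using this

lemma Rf_zero : Rf h 0 = 0 := by
  unfold Rf
  have : ∀ y, Mo 1 h 0 y = 0 := fun y => by
    unfold Mo; simp [integral_mul_const]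
  simp [this]

lemma Rf_pi : Rf h (π / 2) = 0 := by
  unfold Rf
  have : ∀ y, Mo 1 h (π / 2) y = 0 := fun y => by
    unfold Mo; simp [H.m1]
  simp [this]

lemma Ent_zero : Ent h 0 = ∫ y, h y * log (h y) ∂gam := by
  unfold Ent Mo; simp

lemma Ent_pi : Ent h (π / 2) = 0 := by
  unfold Ent Mo; simp [H.m0]

/-- upper bound on Ga -/
lemma Ga_le (G : ℝ) (hG : (K ^ 2 - 1) * ∫ z, max (z ^ 2 - G) 0 ∂gam ≤ G - 1) (t y : ℝ) : Ga h t y ≤ G := by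
  have hp := H.M0_pos t y
  have hK := H.kpos
  have im : Integrable (fun z : ℝ => max (z ^ 2 - G) 0) gam :=
    ((gam_pow_integrable 2).sub (integrable_const G)).pos_part
  have key : 0 ≤ G * Mo 0 h t y - Mo 2 h t y := by
    have e1 : G * Mo 0 h t y - Mo 2 h t y = ∫ z, (G - z ^ 2) * h (cos t * y + sin t * z) ∂gam := by
      unfold Mo
      rw [← integral_const_mul, ← integral_sub ((H.M_int 0 t y).const_mul _) (H.M_int 2 t y)]
      congr 1; ext z; ring
    have i1 : Integrable (fun z => (G - z ^ 2) * h (cos t * y + sin t * z)) gam := by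
      have := ((H.M_int 0 t y).const_mul G).sub (H.M_int 2 t y)
      refine this.congr (ae_of_all _ fun z => ?_)
      simp only [Pi.sub_apply]; ring
    have i2 : Integrable (fun z : ℝ => (1 / K) * (G - z ^ 2)) gam :=
      ((integrable_const G).sub (gam_pow_integrable 2)).const_mul _
    have := integral_mono (i2.sub (im.const_mul (K - 1 / K))) i1 (fun z => ?_)
    · rw [e1]
      refine le_trans ?_ this
      simp only [Pi.sub_apply]
      rw [integral_sub i2 (im.const_mul _), integral_const_mul, integral_const_mul,
        integral_sub (integrable_const G) (gam_pow_integrable 2), gam_m2]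
      have e : (1 / K) * (G - 1 - (K ^ 2 - 1) * ∫ z, max (z ^ 2 - G) 0 ∂gam) = 1 / K * ((∫ (_ : ℝ), G ∂gam) - 1)
        - (K - 1 / K) * ∫ z, max (z ^ 2 - G) 0 ∂gam := by
        simp; field_simp
      rw [← e]
      exact mul_nonneg H.tpos.le (by linarith)
    · simp only [Pi.sub_apply]
      obtain ⟨hl, hu⟩ := H.bd (cos t * y + sin t * z)
      rcases le_total (z ^ 2) G with hz | hz
      · rw [max_eq_right (by linarith)]; nlinarith
      · rw [max_eq_left (by linarith)]; nlinarith
  have : Mo 0 h t y * Ga h t y ≤ Mo 0 h t y * G := by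
    rw [H.eGa]
    have : 0 ≤ Mo 1 h t y ^ 2 / Mo 0 h t y := by positivity
    linarith
  exact le_of_mul_le_mul_left this hp

end Adm

/-- half of the square root of two -/
def rw2 : ℝ := √2 / 2

lemma rw2_sq : rw2 * rw2 = 1 / 2 := by
  unfold rw2
  have := Real.mul_self_sqrt (show (0:ℝ) ≤ 2 by norm_num)
  linarith

lemma rot4 (f : ℝ × ℝ → ℝ) (hf : Continuous f) (C : ℝ)
    (hC : ∀ p : ℝ × ℝ, |f p| ≤ C * (1 + p.1 ^ 2 + p.2 ^ 2)) :
    ∫ y, ∫ z, f (rw2 * y - rw2 * z, rw2 * y + rw2 * z) ∂gam ∂gam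
      = ∫ y, ∫ z, f (y, z) ∂gam ∂gam := by
  rw [← rot_iter (-(π / 4)) f hf C hC]
  simp only [cos_neg, sin_neg, cos_pi_div_four, sin_pi_div_four, neg_neg]
  unfold rw2
  congr 1; ext y; congr 1; ext z
  congr 2; ring

lemma BC.quad {f : ℝ × ℝ → ℝ} (hf : BC f) :
    ∃ C, 0 ≤ C ∧ ∀ p : ℝ × ℝ, |f p| ≤ C * (1 + p.1 ^ 2 + p.2 ^ 2) := by
  obtain ⟨-, C, hC⟩ := hf
  have h0 : 0 ≤ C := (abs_nonneg _).trans (hC 0)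
  refine ⟨C, h0, fun p => (hC p).trans ?_⟩
  nlinarith [mul_nonneg h0 (sq_nonneg p.1), mul_nonneg h0 (sq_nonneg p.2)]

lemma BC.prod_integrable {f : ℝ × ℝ → ℝ} (hf : BC f) : Integrable f (gam.prod gam) := by
  obtain ⟨C, -, hC⟩ := hf.quad
  exact quad_integrable f hf.1 C hC

lemma BC.swap {f : ℝ → ℝ → ℝ} (hf : BC fun p : ℝ × ℝ => f p.1 p.2) :
    ∫ y, ∫ z, f y z ∂gam ∂gam = ∫ z, ∫ y, f y z ∂gam ∂gam :=
  integral_integral_swap hf.prod_integrable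

lemma prod_rot (f1 f2 : ℝ → ℝ) (h1 : BC f1) (h2 : BC f2) (Q : ℝ × ℝ → ℝ) (hQ : Continuous Q) (C : ℝ)
    (hC : ∀ p : ℝ × ℝ, |Q p| ≤ C * (1 + p.1 ^ 2 + p.2 ^ 2)) :
    ∫ z, ∫ ζ, Q (z, ζ) * (f1 (rw2 * (z + ζ)) * f2 (rw2 * (z - ζ))) ∂gam ∂gam
      = ∫ b, ∫ a, Q (rw2 * (a + b), rw2 * (a - b)) * (f1 a * f2 b) ∂gam ∂gam := by
  have hb : BC fun p : ℝ × ℝ => f1 p.2 * f2 p.1 :=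
    (h1.comp _ continuous_snd).mul (h2.comp _ continuous_fst)
  obtain ⟨cb, B, hB⟩ := hb
  have hB0 : 0 ≤ B := (abs_nonneg _).trans (hB 0)
  have hw := rw2_sq
  have := rot4 (fun p => Q (rw2 * (p.2 + p.1), rw2 * (p.2 - p.1)) * (f1 p.2 * f2 p.1))
    ((hQ.comp (by fun_prop)).mul cb) (|C| * B) (fun p => ?_)
  · rw [← this]
    congr 1; ext z; congr 1; ext ζ
    have e1 : rw2 * (rw2 * z + rw2 * ζ + (rw2 * z - rw2 * ζ)) = z := by linear_combination 2 * z * hw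
    have e2 : rw2 * (rw2 * z + rw2 * ζ - (rw2 * z - rw2 * ζ)) = ζ := by linear_combination 2 * ζ * hw
    simp only [e1, e2]
    rw [mul_add, mul_sub]
  · simp only [abs_mul]
    have q1 := hC (rw2 * (p.2 + p.1), rw2 * (p.2 - p.1))
    have q2 := hB p
    rw [abs_mul] at q2
    simp only at q1
    have e : (rw2 * (p.2 + p.1)) ^ 2 + (rw2 * (p.2 - p.1)) ^ 2 = p.1 ^ 2 + p.2 ^ 2 := by
      linear_combination (2 * p.1 ^ 2 + 2 * p.2 ^ 2) * hw
    rw [add_assoc, e] at q1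
    calc _ ≤ (|C| * (1 + (p.1 ^ 2 + p.2 ^ 2))) * B := by
          refine mul_le_mul (q1.trans (mul_le_mul_of_nonneg_right (le_abs_self C) (by positivity))) q2
            (by positivity) (by positivity)
      _ = _ := by ring

lemma quad_prod (f1 f2 : ℝ → ℝ) (h1 : BC f1) (h2 : BC f2) (c00 c10 c01 c20 c11 c02 : ℝ) :
    ∫ b, ∫ a, (c00 + c10 * a + c01 * b + c20 * a ^ 2 + c11 * a * b + c02 * b ^ 2) * (f1 a * f2 b) ∂gam ∂gam
    = c00 * ((∫ z, z ^ 0 * f1 z ∂gam) * ∫ z, z ^ 0 * f2 z ∂gam)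
      + c10 * ((∫ z, z ^ 1 * f1 z ∂gam) * ∫ z, z ^ 0 * f2 z ∂gam)
      + c01 * ((∫ z, z ^ 0 * f1 z ∂gam) * ∫ z, z ^ 1 * f2 z ∂gam)
      + c20 * ((∫ z, z ^ 2 * f1 z ∂gam) * ∫ z, z ^ 0 * f2 z ∂gam)
      + c11 * ((∫ z, z ^ 1 * f1 z ∂gam) * ∫ z, z ^ 1 * f2 z ∂gam)
      + c02 * ((∫ z, z ^ 0 * f1 z ∂gam) * ∫ z, z ^ 2 * f2 z ∂gam) := by
  have e : ∀ b a, (c00 + c10 * a + c01 * b + c20 * a ^ 2 + c11 * a * b + c02 * b ^ 2) * (f1 a * f2 b)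
    = (f2 b * (c00 + c01 * b + c02 * b ^ 2)) * (a ^ 0 * f1 a)
     + (f2 b * (c10 + c11 * b)) * (a ^ 1 * f1 a) + (f2 b * c20) * (a ^ 2 * f1 a) := fun b a => by ring
  simp only [e]
  simp only [(int3 (h1.pow_integrable 0) (h1.pow_integrable 1) (h1.pow_integrable 2) _ _ _).2]
  set E0 := ∫ z, z ^ 0 * f1 z ∂gam
  set E1 := ∫ z, z ^ 1 * f1 z ∂gam
  set E2 := ∫ z, z ^ 2 * f1 z ∂gam
  have e' : ∀ b, f2 b * (c00 + c01 * b + c02 * b ^ 2) * E0 + f2 b * (c10 + c11 * b) * E1 + f2 b * c20 * E2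
    = (c00 * E0 + c10 * E1 + c20 * E2) * (b ^ 0 * f2 b) + (c01 * E0 + c11 * E1) * (b ^ 1 * f2 b)
      + c02 * E0 * (b ^ 2 * f2 b) := fun b => by ring
  simp only [e']
  rw [(int3 (h2.pow_integrable 0) (h2.pow_integrable 1) (h2.pow_integrable 2) _ _ _).2]
  ring

/-- density of the rotated pair -/
def Fh (h : ℝ → ℝ) (u v : ℝ) : ℝ := h (rw2 * (u + v)) * h (rw2 * (u - v))

namespace Adm
variable {h : ℝ → ℝ} {K : ℝ} (H : Adm h K)
include H

lemma F_BC : BC fun p : ℝ × ℝ => Fh h p.1 p.2 := by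
  unfold Fh
  exact (H.hBC.comp (fun p : ℝ × ℝ => rw2 * (p.1 + p.2)) (by fun_prop)).mul
    (H.hBC.comp (fun p : ℝ × ℝ => rw2 * (p.1 - p.2)) (by fun_prop))

lemma F_bd (u v : ℝ) : (1 / K) * (1 / K) ≤ Fh h u v ∧ Fh h u v ≤ K * K := by
  unfold Fh
  have h1 := H.bd (rw2 * (u + v))
  have h2 := H.bd (rw2 * (u - v))
  have := H.tpos
  exact ⟨mul_le_mul h1.1 h2.1 this.le (this.le.trans h1.1),
    mul_le_mul h1.2 h2.2 (this.le.trans h2.1) H.kpos.le⟩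

lemma F_cont (u : ℝ) : Continuous (Fh h u) := H.F_BC.1.comp (by fun_prop : Continuous fun v : ℝ => (u, v))

lemma tt : 0 < (1 / K) * (1 / K) := mul_pos H.tpos H.tpos

lemma FMo_BC (k : ℕ) : BC fun p : ℝ × ℝ × ℝ => Mo k (Fh h p.1) p.2.1 p.2.2 := by
  unfold Mo
  refine BC.int_pow (Φ := fun (p : ℝ × ℝ × ℝ) z => Fh h p.1 (cos p.2.1 * p.2.2 + sin p.2.1 * z)) k ?_
  exact H.F_BC.comp (fun p : (ℝ × ℝ × ℝ) × ℝ => (p.1.1, cos p.1.2.1 * p.1.2.2 + sin p.1.2.1 * p.2))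
    (by fun_prop)

lemma FMo0_ge (u t y : ℝ) : (1 / K) * (1 / K) ≤ Mo 0 (Fh h u) t y :=
  Mo0_ge _ (H.F_cont u) _ _ H.tt (H.F_bd u) t y

lemma FQ_BC : BC fun p : ℝ × ℝ × ℝ => Mo 1 (Fh h p.1) p.2.1 p.2.2 ^ 2 / Mo 0 (Fh h p.1) p.2.1 p.2.2 :=
  ((H.FMo_BC 1).pow 2).div (H.FMo_BC 0) _ H.tt fun p => H.FMo0_ge _ _ _

end Adm

/-- the pointwise lower bound -/
def Lw (h : ℝ → ℝ) (q t p p' : ℝ) : ℝ :=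
  Mo 0 h t p * Mo 0 h t p' * ((Mo 1 h t p / Mo 0 h t p - Mo 1 h t p' / Mo 0 h t p') ^ 2 / 2
    + (Ga h t p - Ga h t p') ^ 2 / (2 * q)
    - (Ga h t p - Ga h t p') ^ 2 * (Ga h t p + Ga h t p') / (8 * q ^ 2))

namespace Adm
variable {h : ℝ → ℝ} {K : ℝ} (H : Adm h K)
include H

lemma Lw_eval (q : ℝ) (hq : 0 < q) (t p p' : ℝ) : ∃ A β : ℝ,
    ∫ z, ∫ ζ, (2 * (A + β * z) * ζ - (A + β * z) ^ 2) *
      (h (cos t * p + sin t * (rw2 * (z + ζ))) * h (cos t * p' + sin t * (rw2 * (z - ζ)))) ∂gam ∂gam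
      = Lw h q t p p' := by
  set e := Mo 0 h t p with he
  set e' := Mo 0 h t p' with he'
  set m := Mo 1 h t p / e with hm
  set m' := Mo 1 h t p' / e' with hm'
  have hep : e ≠ 0 := (H.M0_pos t p).ne'
  have hep' : e' ≠ 0 := (H.M0_pos t p').ne'
  set β := (Ga h t p - Ga h t p') / (2 * q) with hβ
  set A := rw2 * (m - m') - β * (rw2 * (m + m')) with hA
  have b1 : BC fun a => h (cos t * p + sin t * a) := H.hBC.comp _ (by fun_prop)
  have b2 : BC fun a => h (cos t * p' + sin t * a) := H.hBC.comp _ (by fun_prop)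
  refine ⟨A, β, ?_⟩
  rw [prod_rot _ _ b1 b2 (fun x => 2 * (A + β * x.1) * x.2 - (A + β * x.1) ^ 2) (by fun_prop)
    (4 * A ^ 2 + 4 * β ^ 2 + 1) ?_]
  · have ex : ∀ b a : ℝ, 2 * (A + β * (rw2 * (a + b))) * (rw2 * (a - b)) - (A + β * (rw2 * (a + b))) ^ 2
      = (-A^2) + (2 * A * rw2 - 2 * A * β * rw2) * a + (-2 * A * rw2 - 2 * A * β * rw2) * b
        + (β - β ^ 2 / 2) * a ^ 2 + (-β^2) * a * b + (-β - β ^ 2 / 2) * b ^ 2 := by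
      intro b a
      linear_combination (2 * β * (a ^ 2 - b ^ 2) - β ^ 2 * (a + b) ^ 2) * rw2_sq
    simp only [ex]
    rw [quad_prod _ _ b1 b2]
    change -A ^ 2 * (Mo 0 h t p * Mo 0 h t p') + (2 * A * rw2 - 2 * A * β * rw2) * (Mo 1 h t p * Mo 0 h t p')
      + (-2 * A * rw2 - 2 * A * β * rw2) * (Mo 0 h t p * Mo 1 h t p')
      + (β - β ^ 2 / 2) * (Mo 2 h t p * Mo 0 h t p') + (-β ^ 2) * (Mo 1 h t p * Mo 1 h t p')
      + (-β - β ^ 2 / 2) * (Mo 0 h t p * Mo 2 h t p') = _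
    have k1 : Mo 1 h t p = e * m := by rw [hm]; field_simp
    have k1' : Mo 1 h t p' = e' * m' := by rw [hm']; field_simp
    have k2 : Mo 2 h t p = e * (Ga h t p + m ^ 2) := by
      unfold Ga; rw [← he, ← hm]; field_simp; ring
    have k2' : Mo 2 h t p' = e' * (Ga h t p' + m' ^ 2) := by
      unfold Ga; rw [← he', ← hm']; field_simp; ring
    have L : Lw h q t p p' = e * e' * ((m - m') ^ 2 / 2 + β * (Ga h t p - Ga h t p')
        - β ^ 2 * (Ga h t p + Ga h t p') / 2) := by
      unfold Lw
      rw [← hm, ← hm', ← he, ← he', hβ]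
      field_simp
      ring
    rw [k1, k1', k2, k2', L, ← he, ← he', hA]
    clear_value β m m' e e'
    generalize Ga h t p = g1
    generalize Ga h t p' = g2
    have := rw2_sq
    have hs : rw2 ^ 2 = 1 / 2 := by rw [sq]; exact this
    ring_nf
    rw [hs]
    ring
  · intro x
    generalize x.1 = z
    generalize x.2 = w
    have t1 : |2 * (A + β * z) * w - (A + β * z) ^ 2| ≤ (A + β * z) ^ 2 + w ^ 2 + (A + β * z) ^ 2 := by
      rw [_root_.abs_le]
      constructor <;> nlinarith [sq_nonneg (A + β * z - w), sq_nonneg (A + β * z + w), sq_nonneg (A + β * z)]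
    have t2 : (A + β * z) ^ 2 ≤ 2 * A ^ 2 + 2 * β ^ 2 * z ^ 2 := by nlinarith [sq_nonneg (A - β * z)]
    have t3 : 0 ≤ A ^ 2 * (z ^ 2 + w ^ 2) := by positivity
    have t4 : 0 ≤ β ^ 2 * (1 + w ^ 2) := by positivity
    nlinarith [sq_nonneg z]

lemma Lw_BC (q t : ℝ) : BC fun x : ℝ × ℝ => Lw h q t x.1 x.2 := by
  have a0 := (H.M_BC' 0 t)
  have a1 := ((H.M_BC' 1 t).div (H.M_BC' 0 t) _ H.tpos (H.M0_ge t))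
  have a2 := H.Ga_BC t
  have c1 : Continuous (fun x : ℝ × ℝ => x.1) := continuous_fst
  have c2 : Continuous (fun x : ℝ × ℝ => x.2) := continuous_snd
  unfold Lw
  simp only [div_eq_mul_inv _ (2:ℝ), div_eq_mul_inv _ (2*q), div_eq_mul_inv _ (8*q^2)]
  exact ((a0.comp _ c1).mul (a0.comp _ c2)).mul
    ((((((a1.comp _ c1).sub (a1.comp _ c2)).pow 2).mul (BC.const _)).add
      ((((a2.comp _ c1).sub (a2.comp _ c2)).pow 2).mul (BC.const _))).sub
      (((((a2.comp _ c1).sub (a2.comp _ c2)).pow 2).mul ((a2.comp _ c1).add (a2.comp _ c2))).mul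
        (BC.const _)))

/-- conditional lower bound -/
lemma inner_ge (q : ℝ) (hq : 0 < q) (t y u : ℝ) :
    Lw h q t (rw2 * (u + y)) (rw2 * (u - y)) ≤
    ∫ z, Mo 1 (Fh h (cos t * u + sin t * z)) t y ^ 2 / Mo 0 (Fh h (cos t * u + sin t * z)) t y ∂gam := by
  obtain ⟨A, β, hAβ⟩ := H.Lw_eval q hq t (rw2 * (u + y)) (rw2 * (u - y))
  have cc : Continuous fun z : ℝ => ((cos t * u + sin t * z, t, y) : ℝ × ℝ × ℝ) := by fun_prop
  have bX := (H.FMo_BC 1).comp _ cc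
  have bY := (H.FMo_BC 0).comp _ cc
  have bQ := H.FQ_BC.comp _ cc
  simp only at bX bY bQ
  rw [← hAβ]
  have inner : ∀ z, ∫ ζ, (2 * (A + β * z) * ζ - (A + β * z) ^ 2) *
      (h (cos t * (rw2 * (u + y)) + sin t * (rw2 * (z + ζ))) *
        h (cos t * (rw2 * (u - y)) + sin t * (rw2 * (z - ζ)))) ∂gam
      = 2 * (A + β * z) * Mo 1 (Fh h (cos t * u + sin t * z)) t y
        - (A + β * z) ^ 2 * Mo 0 (Fh h (cos t * u + sin t * z)) t y := by
    intro z
    have i1 := Mo_integrable _ (H.F_cont (cos t * u + sin t * z)) (K * K)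
      (abs_h_le _ (H.F_cont _) _ _ H.tt (H.F_bd _)) 1 t y
    have i0 := Mo_integrable _ (H.F_cont (cos t * u + sin t * z)) (K * K)
      (abs_h_le _ (H.F_cont _) _ _ H.tt (H.F_bd _)) 0 t y
    have := (int3 i1 i0 i0 (2 * (A + β * z)) (- (A + β * z) ^ 2) 0).2
    refine Eq.trans ?_ (this.trans ?_)
    swap
    · unfold Mo; ring
    congr 1; ext ζ
    unfold Fh
    have e1 : rw2 * (cos t * u + sin t * z + (cos t * y + sin t * ζ))
      = cos t * (rw2 * (u + y)) + sin t * (rw2 * (z + ζ)) := by ring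
    have e2 : rw2 * (cos t * u + sin t * z - (cos t * y + sin t * ζ))
      = cos t * (rw2 * (u - y)) + sin t * (rw2 * (z - ζ)) := by ring
    rw [e1, e2]; ring
  simp only [inner]
  refine integral_mono ?_ bQ.integrable fun z => ?_
  · have q1 := (int3 (bX.pow_integrable 0) (bX.pow_integrable 1) (bX.pow_integrable 1) (2 * A) (2 * β) 0).1
    have q2 := (int3 (bY.pow_integrable 0) (bY.pow_integrable 1) (bY.pow_integrable 2)
      (A ^ 2) (2 * A * β) (β ^ 2)).1
    refine (q1.sub q2).congr (ae_of_all _ fun z => ?_)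
    simp only [Pi.sub_apply]; ring
  · have hY : 0 < Mo 0 (Fh h (cos t * u + sin t * z)) t y := H.tt.trans_le (H.FMo0_ge _ _ _)
    simp only
    rw [le_div_iff₀ hY]
    nlinarith [sq_nonneg (Mo 1 (Fh h (cos t * u + sin t * z)) t y
      - (A + β * z) * Mo 0 (Fh h (cos t * u + sin t * z)) t y)]

lemma W_ge0 (q : ℝ) (hq : 0 < q) (t : ℝ) :
    ∫ p', ∫ p, Lw h q t p p' ∂gam ∂gam ≤ ∫ u, Rf (Fh h u) t ∂gam := by
  have bQ2 : BC fun x : ℝ × ℝ => Mo 1 (Fh h x.1) t x.2 ^ 2 / Mo 0 (Fh h x.1) t x.2 :=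
    H.FQ_BC.comp (fun x : ℝ × ℝ => ((x.1, t, x.2) : ℝ × ℝ × ℝ)) (by fun_prop)
  have e1 : ∫ u, Rf (Fh h u) t ∂gam
      = ∫ y, ∫ u, ∫ z, Mo 1 (Fh h (cos t * u + sin t * z)) t y ^ 2
        / Mo 0 (Fh h (cos t * u + sin t * z)) t y ∂gam ∂gam ∂gam := by
    unfold Rf
    rw [BC.swap bQ2]
    congr 1; ext y
    have b : BC fun x : ℝ × ℝ => Mo 1 (Fh h x.1) t y ^ 2 / Mo 0 (Fh h x.1) t y :=
      H.FQ_BC.comp (fun x : ℝ × ℝ => ((x.1, t, y) : ℝ × ℝ × ℝ)) (by fun_prop)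
    obtain ⟨C, -, hC⟩ := b.quad
    rw [rot_iter t _ b.1 C hC]
    simp
  have bL := H.Lw_BC q t
  have e2 : ∫ p', ∫ p, Lw h q t p p' ∂gam ∂gam
      = ∫ y, ∫ u, Lw h q t (rw2 * (u + y)) (rw2 * (u - y)) ∂gam ∂gam := by
    have b : BC fun x : ℝ × ℝ => Lw h q t x.2 x.1 := bL.comp (fun x : ℝ × ℝ => (x.2, x.1)) (by fun_prop)
    have b' : BC fun x : ℝ × ℝ => Lw h q t (rw2 * x.1 + rw2 * x.2) (rw2 * x.1 - rw2 * x.2) :=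
      bL.comp (fun x : ℝ × ℝ => (rw2 * x.1 + rw2 * x.2, rw2 * x.1 - rw2 * x.2)) (by fun_prop)
    obtain ⟨C, -, hC⟩ := b.quad
    rw [← rot4 _ b.1 C hC]
    simp only
    rw [BC.swap b']
    simp only [mul_add, mul_sub]
  rw [e1, e2]
  have b3 : BC fun x : (ℝ × ℝ) × ℝ => Mo 1 (Fh h (cos t * x.1.2 + sin t * x.2)) t x.1.1 ^ 2
        / Mo 0 (Fh h (cos t * x.1.2 + sin t * x.2)) t x.1.1 :=
    H.FQ_BC.comp (fun x : (ℝ × ℝ) × ℝ => ((cos t * x.1.2 + sin t * x.2, t, x.1.1) : ℝ × ℝ × ℝ))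
      (by fun_prop)
  have b4 := BC.int (Φ := fun (x : ℝ × ℝ) z => Mo 1 (Fh h (cos t * x.2 + sin t * z)) t x.1 ^ 2
        / Mo 0 (Fh h (cos t * x.2 + sin t * z)) t x.1) b3
  have b5 := BC.int (Φ := fun (y u : ℝ) => ∫ z, Mo 1 (Fh h (cos t * u + sin t * z)) t y ^ 2
        / Mo 0 (Fh h (cos t * u + sin t * z)) t y ∂gam) b4
  have c4 : BC fun x : ℝ × ℝ => Lw h q t (rw2 * (x.2 + x.1)) (rw2 * (x.2 - x.1)) :=
    bL.comp (fun x : ℝ × ℝ => (rw2 * (x.2 + x.1), rw2 * (x.2 - x.1))) (by fun_prop)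
  have c5 := BC.int (Φ := fun (y u : ℝ) => Lw h q t (rw2 * (u + y)) (rw2 * (u - y))) c4
  refine integral_mono c5.integrable b5.integrable fun y => ?_
  refine integral_mono (c4.comp (fun u : ℝ => (y, u)) (by fun_prop)).integrable
    (b4.comp (fun u : ℝ => (y, u)) (by fun_prop)).integrable fun u => ?_
  exact H.inner_ge q hq t y u

end Adm

lemma int6 {X : Type*} [MeasurableSpace X] {μ : Measure X} {f1 f2 f3 f4 f5 f6 : X → ℝ}
    (h1 : Integrable f1 μ) (h2 : Integrable f2 μ) (h3 : Integrable f3 μ) (h4 : Integrable f4 μ)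
    (h5 : Integrable f5 μ) (h6 : Integrable f6 μ) (c1 c2 c3 c4 c5 c6 : ℝ) :
    ∫ z, (c1 * f1 z + c2 * f2 z + c3 * f3 z + c4 * f4 z + c5 * f5 z + c6 * f6 z) ∂μ
      = c1 * (∫ z, f1 z ∂μ) + c2 * (∫ z, f2 z ∂μ) + c3 * (∫ z, f3 z ∂μ) + c4 * (∫ z, f4 z ∂μ)
        + c5 * (∫ z, f5 z ∂μ) + c6 * (∫ z, f6 z ∂μ) := by
  have a := int3 h1 h2 h3 c1 c2 c3
  have b := int3 h4 h5 h6 c4 c5 c6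
  have := integral_add a.1 b.1
  rw [a.2, b.2] at this
  calc _ = ∫ z, ((c1 * f1 z + c2 * f2 z + c3 * f3 z) + (c4 * f4 z + c5 * f5 z + c6 * f6 z)) ∂μ := by
        congr 1; ext z; ring
    _ = _ := by rw [this]; ring

/-- second moment of Ga -/
def SG (h : ℝ → ℝ) (t : ℝ) : ℝ := ∫ y, Mo 0 h t y * Ga h t y ^ 2 ∂gam

/-- variance of Ga -/
def VG (h : ℝ → ℝ) (t : ℝ) : ℝ := SG h t - (1 - Rf h t) ^ 2

/-- averaged entropy of the conditioned pair -/
def Cf (h : ℝ → ℝ) (t : ℝ) : ℝ := ∫ u, Ent (Fh h u) t ∂gam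

namespace Adm
variable {h : ℝ → ℝ} {K : ℝ} (H : Adm h K)
include H

lemma R_BC (t : ℝ) : BC fun y => Mo 1 h t y ^ 2 / Mo 0 h t y :=
  ((H.M_BC' 1 t).pow 2).div (H.M_BC' 0 t) _ H.tpos (H.M0_ge t)

lemma Lw_int (q : ℝ) (hq : 0 < q) (t : ℝ) :
    ∫ p', ∫ p, Lw h q t p p' ∂gam ∂gam = Rf h t + VG h t / q
      - ((∫ y, Mo 0 h t y * Ga h t y ^ 3 ∂gam) - (1 - Rf h t) * SG h t) / (4 * q ^ 2) := by
  have b0 := H.M_BC' 0 t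
  have b1 := H.M_BC' 1 t
  have bR := H.R_BC t
  have bG := H.Ga_BC t
  have i1 := bR.integrable
  have i2 := b1.integrable
  have i3 := b0.integrable
  have i4 := (b0.mul bG).integrable
  have i5 := (b0.mul (bG.pow 2)).integrable
  have i6 := (b0.mul (bG.pow 3)).integrable
  have k0 := H.int_M0 t
  have k1 := H.int_M1 t
  have kR : ∫ y, Mo 1 h t y ^ 2 / Mo 0 h t y ∂gam = Rf h t := rfl
  have kG := H.int_eGa t
  have kS : ∫ y, Mo 0 h t y * Ga h t y ^ 2 ∂gam = SG h t := rfl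
  have ex : ∀ p' p, Lw h q t p p' =
      (Mo 0 h t p' / 2) * (Mo 1 h t p ^ 2 / Mo 0 h t p) + (- Mo 1 h t p') * Mo 1 h t p
      + (Mo 1 h t p' ^ 2 / Mo 0 h t p' / 2 + Mo 0 h t p' * Ga h t p' ^ 2 / (2 * q)
          - Mo 0 h t p' * Ga h t p' ^ 3 / (8 * q ^ 2)) * Mo 0 h t p
      + (- (Mo 0 h t p' * Ga h t p') / q + Mo 0 h t p' * Ga h t p' ^ 2 / (8 * q ^ 2))
        * (Mo 0 h t p * Ga h t p)
      + (Mo 0 h t p' / (2 * q) + Mo 0 h t p' * Ga h t p' / (8 * q ^ 2)) * (Mo 0 h t p * Ga h t p ^ 2)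
      + (- Mo 0 h t p' / (8 * q ^ 2)) * (Mo 0 h t p * Ga h t p ^ 3) := by
    intro p' p
    have := (H.M0_pos t p).ne'
    have := (H.M0_pos t p').ne'
    unfold Lw
    field_simp
    ring
  simp only [ex]
  simp only [int6 i1 i2 i3 i4 i5 i6, k0, k1, kR, kG, kS]
  set T3 := ∫ y, Mo 0 h t y * Ga h t y ^ 3 ∂gam with hT
  set r := Rf h t
  set S := SG h t with hS
  have ex2 : ∀ z, Mo 0 h t z / 2 * r + -Mo 1 h t z * 0 +
          (Mo 1 h t z ^ 2 / Mo 0 h t z / 2 + Mo 0 h t z * Ga h t z ^ 2 / (2 * q) -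
              Mo 0 h t z * Ga h t z ^ 3 / (8 * q ^ 2)) * 1 +
          (-(Mo 0 h t z * Ga h t z) / q + Mo 0 h t z * Ga h t z ^ 2 / (8 * q ^ 2)) * (1 - r) +
          (Mo 0 h t z / (2 * q) + Mo 0 h t z * Ga h t z / (8 * q ^ 2)) * S +
          -Mo 0 h t z / (8 * q ^ 2) * T3
     = (1 / 2) * (Mo 1 h t z ^ 2 / Mo 0 h t z) + 0 * Mo 1 h t z
       + (r / 2 + S / (2 * q) - T3 / (8 * q ^ 2)) * Mo 0 h t z
       + (- (1 - r) / q + S / (8 * q ^ 2)) * (Mo 0 h t z * Ga h t z)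
       + (1 / (2 * q) + (1 - r) / (8 * q ^ 2)) * (Mo 0 h t z * Ga h t z ^ 2)
       + (- 1 / (8 * q ^ 2)) * (Mo 0 h t z * Ga h t z ^ 3) := by
    intro z
    generalize Mo 1 h t z ^ 2 / Mo 0 h t z = x
    field_simp
    ring
  simp only [ex2]
  rw [int6 i1 i2 i3 i4 i5 i6, k0, k1, kR, kG, kS, ← hT]
  unfold VG
  rw [← hS]
  field_simp
  ring

lemma VG_nonneg (t : ℝ) : 0 ≤ VG h t := by
  have b0 := H.M_BC' 0 t
  have bG := H.Ga_BC t
  have i1 := b0.integrable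
  have i2 := (b0.mul bG).integrable
  have i3 := (b0.mul (bG.pow 2)).integrable
  set μ := 1 - Rf h t with hμ
  have e : VG h t = ∫ y, (μ ^ 2 * Mo 0 h t y + (-2 * μ) * (Mo 0 h t y * Ga h t y)
      + 1 * (Mo 0 h t y * Ga h t y ^ 2)) ∂gam := by
    rw [(int3 i1 i2 i3 _ _ _).2, H.int_M0, H.int_eGa]
    unfold VG SG; ring
  rw [e]
  refine integral_nonneg fun y => ?_
  have := mul_nonneg (H.M0_pos t y).le (sq_nonneg (Ga h t y - μ))
  simp only [Pi.zero_apply]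
  linarith

lemma SG_le (G : ℝ) (t : ℝ) (hG : ∀ y, Ga h t y ≤ G) : SG h t ≤ G * (1 - Rf h t) := by
  have b0 := H.M_BC' 0 t
  have bG := H.Ga_BC t
  rw [← H.int_eGa, ← integral_const_mul]
  refine integral_mono (b0.mul (bG.pow 2)).integrable ((b0.mul bG).integrable.const_mul G) fun y => ?_
  have := mul_nonneg (mul_nonneg (H.M0_pos t y).le (H.Ga_pos t y).le) (sub_nonneg.2 (hG y))
  simp only
  linarith

lemma W_ge (G : ℝ) (t : ℝ) (hG0 : 0 < G) (hG : ∀ y, Ga h t y ≤ G) :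
    Rf h t + VG h t / (G + 1 - Rf h t) ≤ ∫ u, Rf (Fh h u) t ∂gam := by
  set μ := 1 - Rf h t with hμ
  have hμ0 : 0 < μ := H.tpos.trans_le (H.Rf_le t)
  set q := (G + μ) / 2 with hq
  have hq0 : 0 < q := by rw [hq]; linarith
  refine le_trans ?_ (H.W_ge0 q hq0 t)
  rw [H.Lw_int q hq0]
  have b0 := H.M_BC' 0 t
  have bG := H.Ga_BC t
  have i1 := b0.integrable
  have i2 := (b0.mul bG).integrable
  have i3 := (b0.mul (bG.pow 2)).integrable
  have i4 := (b0.mul (bG.pow 3)).integrable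
  have key : ((∫ y, Mo 0 h t y * Ga h t y ^ 3 ∂gam) - (1 - Rf h t) * SG h t) ≤ 2 * q * VG h t := by
    have e1 := int6 i1 i2 i3 i4 i1 i1 (2 * q * μ ^ 2 - μ ^ 3) (-2 * μ * (2 * q) + μ ^ 2)
      (2 * q + μ) (-1) 0 0
    have e2 : 0 ≤ ∫ z, ((2 * q * μ ^ 2 - μ ^ 3) * Mo 0 h t z + (-2 * μ * (2 * q) + μ ^ 2) * (Mo 0 h t z * Ga h t z) +
            (2 * q + μ) * (Mo 0 h t z * Ga h t z ^ 2) + -1 * (Mo 0 h t z * Ga h t z ^ 3) + 0 * Mo 0 h t z + 0 * Mo 0 h t z) ∂gam := by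
      refine integral_nonneg fun y => ?_
      have := mul_nonneg (mul_nonneg (H.M0_pos t y).le (sq_nonneg (Ga h t y - μ))) (sub_nonneg.2 (hG y))
      have hG2 : 2 * q = G + μ := by rw [hq]; ring
      simp only [Pi.zero_apply]
      rw [hG2]
      linarith
    rw [e1, H.int_M0, H.int_eGa] at e2
    unfold VG
    change _ ≤ 2 * q * (SG h t - μ ^ 2)
    rw [← hμ] at e2
    have : ∫ z, Mo 0 h t z * Ga h t z ^ 2 ∂gam = SG h t := rfl
    rw [this] at e2
    rw [← hμ]
    linarith
  have hG2 : G + 1 - Rf h t = 2 * q := by rw [hq]; ring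
  rw [hG2]
  have h1 : ((∫ y, Mo 0 h t y * Ga h t y ^ 3 ∂gam) - (1 - Rf h t) * SG h t) / (4 * q ^ 2)
    ≤ 2 * q * VG h t / (4 * q ^ 2) := div_le_div_of_nonneg_right key (by positivity)
  have h2 : 2 * q * VG h t / (4 * q ^ 2) = VG h t / q - VG h t / (2 * q) := by field_simp; ring
  linarith

lemma Rf_hasDeriv (t : ℝ) (ht : t ∈ Ioo 0 (π / 2)) :
    HasDerivAt (Rf h) (2 * (cos t / sin t) * (Rf h t - Rf h t ^ 2 - VG h t)) t := by
  refine (Rf_deriv h H.cont _ K H.tpos H.bd (fun t => by rw [H.int_M2, H.int_M0]) t ht).congr_deriv ?_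
  congr 1
  have b0 := H.M_BC' 0 t
  have bG := H.Ga_BC t
  simp only [mul_sub]
  rw [integral_sub (b0.mul bG).integrable (b0.mul (bG.pow 2)).integrable, H.int_eGa]
  unfold VG SG
  ring

lemma Ent_hasDeriv (t : ℝ) (ht : t ∈ Ioo 0 (π / 2)) :
    HasDerivAt (Ent h) (-(cos t / sin t) * Rf h t) t :=
  Ent_deriv h H.cont _ K H.tpos H.bd t ht

lemma FEnt_BC : BC fun x : ℝ × ℝ => Ent (Fh h x.2) x.1 := by
  have b : BC fun x : ℝ × ℝ × ℝ => Mo 0 (Fh h x.1) x.2.1 x.2.2 * log (Mo 0 (Fh h x.1) x.2.1 x.2.2) :=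
    (H.FMo_BC 0).mul ((H.FMo_BC 0).log _ H.tt fun x => H.FMo0_ge _ _ _)
  exact BC.int (Φ := fun (x : ℝ × ℝ) y => Mo 0 (Fh h x.2) x.1 y * log (Mo 0 (Fh h x.2) x.1 y))
    (b.comp (fun x : (ℝ × ℝ) × ℝ => ((x.1.2, x.1.1, x.2) : ℝ × ℝ × ℝ)) (by fun_prop))

lemma FRf_BC : BC fun x : ℝ × ℝ => Rf (Fh h x.2) x.1 :=
  BC.int (Φ := fun (x : ℝ × ℝ) y => Mo 1 (Fh h x.2) x.1 y ^ 2 / Mo 0 (Fh h x.2) x.1 y)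
    (H.FQ_BC.comp (fun x : (ℝ × ℝ) × ℝ => ((x.1.2, x.1.1, x.2) : ℝ × ℝ × ℝ)) (by fun_prop))

lemma Cf_BC : BC (Cf h) := BC.int (Φ := fun t u => Ent (Fh h u) t) H.FEnt_BC

lemma Cf_hasDeriv (t : ℝ) (ht : t ∈ Ioo 0 (π / 2)) :
    HasDerivAt (Cf h) (-(cos t / sin t) * ∫ u, Rf (Fh h u) t ∂gam) t := by
  have hpi := Real.pi_pos
  set s0 := sin (t / 2)
  have hs0 : 0 < s0 := sin_pos_of_pos_of_lt_pi (by linarith [ht.1]) (by linarith [ht.2])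
  have hU : Ioo (t/2) (π/2) ∈ nhds t := Ioo_mem_nhds (by linarith [ht.1]) ht.2
  have sec : ∀ t : ℝ, Continuous fun y : ℝ => (t, y) := fun t => by fun_prop
  have bE := fun t => H.FEnt_BC.comp _ (sec t)
  have bR := fun t => H.FRf_BC.comp _ (sec t)
  simp only at bE bR
  obtain ⟨-, Q, hQ⟩ := H.FRf_BC
  have key := hasDerivAt_integral_of_dominated_loc_of_deriv_le (μ := gam)
    (F := fun t u => Ent (Fh h u) t) (F' := fun t u => -(cos t / sin t) * Rf (Fh h u) t) (x₀ := t)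
    (bound := fun y => 1 / s0 * Q) hU
    (Filter.Eventually.of_forall fun τ => (bE τ).1.aestronglyMeasurable)
    (bE t).integrable ?_ ?_ ?_ ?_
  · refine key.2.congr_deriv ?_
    rw [integral_const_mul]
  · exact Continuous.aestronglyMeasurable (continuous_const.mul (bR t).1)
  · refine ae_of_all _ fun y τ hτ => ?_
    have hc : s0 ≤ sin τ :=
      sin_le_sin_of_le_of_le_pi_div_two (by linarith [ht.1]) hτ.2.le hτ.1.le
    have h1 : |cos τ / sin τ| ≤ 1 / s0 := by
      rw [abs_div, abs_of_pos (hs0.trans_le hc)]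
      have := abs_cos_le_one τ
      gcongr
    rw [norm_mul, norm_neg]
    exact mul_le_mul h1 (hQ (τ, y)) (abs_nonneg _) (by positivity)
  · exact integrable_const _
  · refine ae_of_all _ fun y τ hτ => ?_
    exact Ent_deriv _ (H.F_cont y) _ _ H.tt (H.F_bd y) τ ⟨by linarith [hτ.1, ht.1], hτ.2⟩

lemma Cf_zero : Cf h 0 = 2 * Ent h 0 := by
  have b : BC fun x : ℝ × ℝ => (h x.2 * h x.1) * log (h x.2 * h x.1) := by
    have b1 : BC fun x : ℝ × ℝ => h x.2 * h x.1 :=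
      (H.hBC.comp _ continuous_snd).mul (H.hBC.comp _ continuous_fst)
    refine b1.mul (b1.log _ H.tt fun x => ?_)
    exact mul_le_mul (H.bd _).1 (H.bd _).1 H.tpos.le (H.tpos.le.trans (H.bd _).1)
  obtain ⟨C, -, hC⟩ := b.quad
  have e := rot4 _ b.1 C hC
  have e1 : Cf h 0 = ∫ u, ∫ v, Fh h u v * log (Fh h u v) ∂gam ∂gam := by
    unfold Cf Ent Mo; simp
  have e2 : ∀ u v, Fh h u v = h (rw2 * u + rw2 * v) * h (rw2 * u - rw2 * v) := fun u v => by
    unfold Fh; rw [mul_add, mul_sub]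
  rw [e1]
  simp only [e2]
  simp only at e
  rw [e, H.Ent_zero]
  have hpos : ∀ x, h x ≠ 0 := fun x => (H.tpos.trans_le (H.bd x).1).ne'
  have bl : BC fun x => h x * log (h x) := H.hBC.mul (H.hBC.log _ H.tpos fun x => (H.bd x).1)
  have e3 : ∀ y z, h z * h y * log (h z * h y)
      = h y * (h z * log (h z)) + (h y * log (h y)) * h z + 0 * h z := fun y z => by
    rw [log_mul (hpos z) (hpos y)]; ring
  simp only [e3, (int3 bl.integrable H.hBC.integrable H.hBC.integrable _ _ _).2, H.m0]
  set D := ∫ z, h z * log (h z) ∂gam with hD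
  have e4 : ∀ y, h y * D + h y * log (h y) * 1 + 0 * 1 = D * h y + 1 * (h y * log (h y)) + 0 * h y :=
    fun y => by ring
  simp only [e4]
  rw [(int3 H.hBC.integrable bl.integrable H.hBC.integrable _ _ _).2, H.m0, ← hD]
  ring

lemma Cf_pi : Cf h (π / 2) = ∫ u, (∫ v, Fh h u v ∂gam) * log (∫ v, Fh h u v ∂gam) ∂gam := by
  unfold Cf Ent Mo; simp

end Adm

lemma entropy_gauss (σ k : ℝ → ℝ) (hk : BC k) (a : ℝ) (ha : 0 < a) (hak : ∀ x, a ≤ k x)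
    (h0 : ∫ x, k x ∂gam = 1) (h2 : ∫ x, x ^ 2 * k x ∂gam = 1) (hσ : ∀ x, σ x = k x * gaussPDF x) :
    entropy σ = -(∫ x, k x * log (k x) ∂gam) + (log (√(2 * π)) + 1 / 2) := by
  unfold entropy
  have e : ∀ x, σ x * log (σ x)
      = (1 * (k x * log (k x)) + (-log (√(2 * π))) * k x + (-1/2) * (x ^ 2 * k x)) * gaussPDF x := by
    intro x
    have hp := (ha.trans_le (hak x)).ne'
    rw [hσ, log_mul hp (gaussPDF_pos x).ne']
    have : log (gaussPDF x) = -log (√(2 * π)) - x ^ 2 / 2 := by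
      unfold gaussPDF
      rw [log_mul (by positivity) (exp_pos _).ne', log_inv, log_exp]; ring
    rw [this]; ring
  simp only [e]
  have i1 := (hk.mul (hk.log a ha hak)).integrable
  rw [← gam_integral, (int3 i1 hk.integrable (hk.pow_integrable 2) _ _ _).2, h0, h2]
  ring

namespace Adm
variable {h : ℝ → ℝ} {K : ℝ} (H : Adm h K)
include H

lemma selfConv_eq (ρ : ℝ → ℝ) (hρ : ∀ x, ρ x = h x * gaussPDF x) (x : ℝ) :
    selfConv ρ x = (∫ v, Fh h x v ∂gam) * gaussPDF x := by
  have hw := rw2_sq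
  have hw2 : √2 = 2 * rw2 := by unfold rw2; ring
  have hwp : 0 < rw2 := by unfold rw2; positivity
  unfold selfConv rescaledConvPair convDens
  have e1 : ∫ y, ρ (√2 * x - y) * ρ y = rw2 * ∫ v, ρ (rw2 * (x + v)) * ρ (rw2 * (x - v)) := by
    have s1 := integral_sub_left_eq_self (fun y => ρ (√2 * x - y) * ρ y) volume (rw2 * x)
    have s2 := Measure.integral_comp_mul_left
      (fun y => ρ (√2 * x - (rw2 * x - y)) * ρ (rw2 * x - y)) rw2
    rw [s1, abs_of_pos (inv_pos.2 hwp), smul_eq_mul] at s2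
    rw [← mul_inv_cancel_left₀ hwp.ne' (∫ y, ρ (√2 * x - y) * ρ y), ← s2]
    congr 2; ext v
    rw [hw2]; congr 2 <;> ring
  rw [e1, gam_integral, ← mul_assoc, ← integral_mul_const]
  have : √2 * rw2 = 1 := by rw [hw2]; linarith
  rw [this, one_mul]
  congr 1; ext v
  rw [hρ, hρ]
  unfold Fh
  have : gaussPDF (rw2 * (x + v)) * gaussPDF (rw2 * (x - v)) = gaussPDF v * gaussPDF x := by
    unfold gaussPDF
    rw [mul_mul_mul_comm, mul_mul_mul_comm _ (exp (-v ^ 2 / 2)), ← exp_add, ← exp_add]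
    congr 2
    linear_combination (-(x ^ 2) - v ^ 2) * hw
  linear_combination (h (rw2 * (x + v)) * h (rw2 * (x - v))) * this

lemma h2_m0 : ∫ u, (∫ v, Fh h u v ∂gam) ∂gam = 1 := by
  have := prod_rot h h H.hBC H.hBC (fun _ => 1) continuous_const 1 (fun p => by
    simp; nlinarith [sq_nonneg p.1, sq_nonneg p.2])
  simp only [one_mul] at this
  unfold Fh
  rw [this]
  simp [integral_mul_const, H.m0]

lemma h2_m2 : ∫ u, u ^ 2 * (∫ v, Fh h u v ∂gam) ∂gam = 1 := by
  have := prod_rot h h H.hBC H.hBC (fun p => p.1 ^ 2) (by fun_prop) 1 (fun p => by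
    simp; nlinarith [sq_nonneg p.1, sq_nonneg p.2])
  simp only [← integral_const_mul]
  unfold Fh
  rw [this]
  have ex : ∀ b a : ℝ, (rw2 * (a + b)) ^ 2 = 0 + 0 * a + 0 * b + (1 / 2) * a ^ 2 + 1 * a * b + (1 / 2) * b ^ 2 :=
    fun b a => by linear_combination (a + b) ^ 2 * rw2_sq
  simp only [ex]
  rw [quad_prod h h H.hBC H.hBC]
  simp [H.m0, H.m1, H.m2]
  norm_num

lemma production (ρ : ℝ → ℝ) (hρ : ∀ x, ρ x = h x * gaussPDF x) :
    entropy (selfConv ρ) - entropy ρ = Ent h 0 - Cf h (π / 2) := by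
  have b2 : BC fun u => ∫ v, Fh h u v ∂gam := BC.int (Φ := fun u v => Fh h u v) H.F_BC
  have l2 : ∀ u, (1 / K) * (1 / K) ≤ ∫ v, Fh h u v ∂gam := by
    intro u
    have := integral_mono (μ := gam) (integrable_const ((1 / K) * (1 / K)))
      (H.F_BC.comp (fun v : ℝ => (u, v)) (by fun_prop)).integrable (fun v => (H.F_bd u v).1)
    simpa using this
  rw [entropy_gauss _ _ b2 _ H.tt l2 H.h2_m0 H.h2_m2 (H.selfConv_eq ρ hρ),
    entropy_gauss ρ h H.hBC _ H.tpos (fun x => (H.bd x).1) H.m0 H.m2 hρ, H.Cf_pi, H.Ent_zero]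
  ring

lemma relEntropy_eq (ρ : ℝ → ℝ) (hρ : ∀ x, ρ x = h x * gaussPDF x) : relEntropy ρ = Ent h 0 := by
  rw [H.Ent_zero, gam_integral]
  unfold relEntropy
  congr 1; ext x
  have := (gaussPDF_pos x).ne'
  rw [hρ, mul_div_assoc, div_self this, mul_one]; ring

/-- the chord bound on the relative entropy -/
lemma Ent_le : Ent h 0 ≤ log K * ((K - 1) / (K + 1)) := by
  rw [H.Ent_zero]
  have hK := H.one_le
  have hKp := H.kpos
  have bl : BC fun x => h x * log (h x) := H.hBC.mul (H.hBC.log _ H.tpos fun x => (H.bd x).1)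
  rcases eq_or_lt_of_le hK with h1 | h1
  · have : ∀ x, h x = 1 := fun x => by
      have := H.bd x
      rw [← h1] at this
      linarith [this.1, this.2]
    simp [this, ← h1]
  have hd : 0 < K - 1 / K := by
    have : 1 / K < 1 := by rw [div_lt_one hKp]; exact h1
    linarith
  have hd' : K ^ 2 - 1 ≠ 0 := by nlinarith
  have key : ∀ x, h x * log (h x) ≤ log K / (K - 1 / K) * ((K + 1 / K) * h x - 2) := by
    intro x
    have hb := H.bd x
    set s := (h x - 1 / K) / (K - 1 / K) with hs
    have hs0 : 0 ≤ s := div_nonneg (by linarith [hb.1]) hd.le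
    have hs1 : s ≤ 1 := by rw [hs, div_le_one hd]; linarith [hb.2]
    have cv := convexOn_mul_log.2 (show (1 / K) ∈ Ici 0 from H.tpos.le) (show K ∈ Ici 0 from hKp.le)
      (show 0 ≤ 1 - s by linarith) hs0 (by ring)
    have hx : h x = (1 - s) * (1 / K) + s * K := by
      rw [hs]; field_simp; ring
    simp only [smul_eq_mul] at cv
    rw [← hx] at cv
    refine cv.trans (le_of_eq ?_)
    rw [hs, one_div, log_inv]
    field_simp
    ring
  have := integral_mono bl.integrable (((H.hBC.integrable.const_mul (K + 1 / K)).sub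
    (integrable_const 2)).const_mul (log K / (K - 1 / K))) key
  refine this.trans (le_of_eq ?_)
  rw [integral_const_mul]
  simp only [Pi.sub_apply]
  rw [integral_sub (H.hBC.integrable.const_mul _) (integrable_const 2), integral_const_mul, H.m0]
  have hd2 : K - 1 ≠ 0 := by linarith
  have : K - 1 / K = (K - 1) * (K + 1) / K := by field_simp; ring
  rw [this]
  simp
  field_simp
  ring

end Adm

lemma adm_of (ρ : ℝ → ℝ) (K : ℝ) (hK : 1 ≤ K) (hc : Continuous ρ)
    (hmass : ∫ x, ρ x = 1) (hmean : ∫ x, x * ρ x = 0) (hvar : ∫ x, x ^ 2 * ρ x = 1)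
    (hsand : ∀ x, gaussPDF x / K ≤ ρ x ∧ ρ x ≤ K * gaussPDF x) :
    Adm (fun x => ρ x / gaussPDF x) K ∧ ∀ x, ρ x = ρ x / gaussPDF x * gaussPDF x := by
  have h : ∀ x, ρ x / gaussPDF x * gaussPDF x = ρ x := fun x => div_mul_cancel₀ _ (gaussPDF_pos x).ne'
  have hKp : 0 < K := by linarith
  refine ⟨⟨hK, hc.div gaussPDF_continuous fun x => (gaussPDF_pos x).ne', fun x => ?_, ?_, ?_, ?_⟩,
    fun x => (h x).symm⟩
  · have := hsand x
    have hp := gaussPDF_pos x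
    constructor
    · rw [le_div_iff₀ hp]; calc _ = gaussPDF x / K := by ring
        _ ≤ _ := this.1
    · rw [div_le_iff₀ hp]; exact this.2
  · rw [gam_integral]; simp only [h]; exact hmass
  · rw [gam_integral]; simp only [mul_assoc, h]; exact hmean
  · rw [gam_integral]; simp only [mul_assoc, h]; exact hvar

lemma anti_of (N : ℝ → ℝ) (a b : ℝ) (hab : a ≤ b) (hN : Continuous N)
    (hd : ∀ t ∈ Ioo a b, ∃ d, HasDerivAt N d t ∧ d ≤ 0) : N b ≤ N a := by
  have : AntitoneOn N (Icc a b) := by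
    refine antitoneOn_of_deriv_nonpos (convex_Icc a b) hN.continuousOn ?_ ?_
    · rw [interior_Icc]
      intro t ht
      obtain ⟨d, h1, -⟩ := hd t ht
      exact h1.differentiableAt.differentiableWithinAt
    · rw [interior_Icc]
      intro t ht
      obtain ⟨d, h1, h2⟩ := hd t ht
      rw [h1.deriv]; exact h2
  exact this (left_mem_Icc.2 hab) (right_mem_Icc.2 hab) hab

/-- Lyapunov argument -/
lemma lyap (r A E V κ : ℝ → ℝ) (T G δ : ℝ) (hT : 0 < T) (hG : 1 ≤ G) (hδ : 0 ≤ δ) (hδG : δ * (G - 1) ≤ 1)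
    (cr : Continuous r) (cA : Continuous A) (cE : Continuous E)
    (r0 : r 0 = 0) (rT : r T = 0) (AT : A T = 0)
    (hr0 : ∀ t, 0 ≤ r t) (hr1 : ∀ t, r t < 1)
    (hκ : ∀ t ∈ Ioo 0 T, 0 ≤ κ t)
    (hV0 : ∀ t, 0 ≤ V t) (hV1 : ∀ t, V t ≤ (1 - r t) * (G - 1 + r t))
    (dr : ∀ t ∈ Ioo 0 T, HasDerivAt r (2 * κ t * (r t - r t ^ 2 - V t)) t)
    (dA : ∀ t ∈ Ioo 0 T, HasDerivAt A (-κ t * r t) t)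
    (dE : ∀ t ∈ Ioo 0 T, ∃ d, HasDerivAt E d t ∧ d ≤ -(κ t * (V t / (G + 1 - r t)))) :
    ∃ s, 2 * A 0 ≥ -log (1 - r s) + δ * (-log (1 - r s) - r s) ∧
      2 * (E 0 - E T) ≥ 2 * A 0 * ((1 - r s) / (G + 1 - r s))
        + ((log (G + 1) - log (G + 1 - r s)) + (1 - r s) / (G + 1 - r s) * log (1 - r s)
        + δ * ((G + 1) * (log (G + 1) - log (G + 1 - r s)) - r s
          + (1 - r s) / (G + 1 - r s) * (log (1 - r s) + r s))) := by
  obtain ⟨s, hs, hmax⟩ := isCompact_Icc.exists_isMaxOn (nonempty_Icc.2 hT.le) cr.continuousOn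
  have hle : ∀ t ∈ Ioo 0 T, r t ≤ r s := fun t ht => hmax (Ioo_subset_Icc_self ht)
  have p1 : ∀ t, 0 < 1 - r t := fun t => by linarith [hr1 t]
  have p2 : ∀ t, 0 < G + 1 - r t := fun t => by linarith [hr1 t]
  have sub1 : ∀ t ∈ Ioo 0 s, t ∈ Ioo 0 T := fun t ht => ⟨ht.1, ht.2.trans_le hs.2⟩
  have sub2 : ∀ t ∈ Ioo s T, t ∈ Ioo 0 T := fun t ht => ⟨hs.1.trans_lt ht.1, ht.2⟩
  have cl1 : Continuous fun t => log (1 - r t) := (continuous_const.sub cr).log fun t => (p1 t).ne'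
  have cl2 : Continuous fun t => log (G + 1 - r t) := (continuous_const.sub cr).log fun t => (p2 t).ne'
  have dl1 : ∀ t ∈ Ioo 0 T, HasDerivAt (fun t => log (1 - r t))
      (-(2 * κ t * (r t - r t ^ 2 - V t)) / (1 - r t)) t := fun t ht =>
    ((dr t ht).const_sub 1).log (p1 t).ne'
  have dl2 : ∀ t ∈ Ioo 0 T, HasDerivAt (fun t => log (G + 1 - r t))
      (-(2 * κ t * (r t - r t ^ 2 - V t)) / (G + 1 - r t)) t := fun t ht =>
    ((dr t ht).const_sub (G + 1)).log (p2 t).ne'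
  set φ := (1 - r s) / (G + 1 - r s) with hφ
  -- χ ≥ 0
  have hχ : ∀ t ∈ Ioo 0 T, φ ≤ (1 - r t) / (G + 1 - r t) := fun t ht => by
    rw [hφ, div_le_div_iff₀ (p2 s) (p2 t)]
    have := hle t ht
    nlinarith
  -- the two entropy lower bounds
  have a1 : 2 * A s - log (1 - r s) ≤ 2 * A 0 - log (1 - r 0) := by
    refine anti_of (fun t => 2 * A t - log (1 - r t)) 0 s hs.1 ((cA.const_mul 2).sub cl1) fun t ht => ?_
    have ht := sub1 t ht
    refine ⟨_, ((dA t ht).const_mul 2).sub (dl1 t ht), ?_⟩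
    have e : 2 * (-κ t * r t) - -(2 * κ t * (r t - r t ^ 2 - V t)) / (1 - r t)
      = - (2 * κ t * V t / (1 - r t)) := by
      have := (p1 t).ne'; field_simp; ring
    rw [e, neg_nonpos]
    exact div_nonneg (mul_nonneg (by linarith [hκ t ht]) (hV0 t)) (p1 t).le
  have a2 : 2 * A T - δ * (-log (1 - r T) - r T) ≤ 2 * A s - δ * (-log (1 - r s) - r s) := by
    refine anti_of (fun t => 2 * A t - δ * (-log (1 - r t) - r t)) s T hs.2
      ((cA.const_mul 2).sub ((cl1.neg.sub cr).const_mul δ)) fun t ht => ?_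
    have ht := sub2 t ht
    refine ⟨_, ((dA t ht).const_mul 2).sub ((((dl1 t ht).neg).sub (dr t ht)).const_mul δ), ?_⟩
    have e : 2 * (-κ t * r t) - δ * (- (-(2 * κ t * (r t - r t ^ 2 - V t)) / (1 - r t))
        - 2 * κ t * (r t - r t ^ 2 - V t))
      = - (2 * κ t * r t) * (1 - δ * (V t / (1 - r t) - r t)) := by
      have := (p1 t).ne'; field_simp; ring
    rw [e]
    have hv : V t / (1 - r t) - r t ≤ G - 1 := by
      have : V t / (1 - r t) ≤ G - 1 + r t := by
        rw [div_le_iff₀ (p1 t)]; linarith [hV1 t]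
      linarith
    have h1 := mul_le_mul_of_nonneg_left hv hδ
    have h2 := mul_nonneg (hκ t ht) (hr0 t)
    nlinarith
  -- production
  have b1 := anti_of (fun t => 2 * E t - 2 * φ * A t + φ * log (1 - r t)) 0 s hs.1
    (((cE.const_mul 2).sub (cA.const_mul _)).add (cl1.const_mul φ)) fun t ht => by
    have ht := sub1 t ht
    obtain ⟨d, hd, hd'⟩ := dE t ht
    refine ⟨_, (((hd.const_mul 2).sub ((dA t ht).const_mul (2 * φ))).add ((dl1 t ht).const_mul φ)), ?_⟩
    have e : -(2 * (κ t * (V t / (G + 1 - r t)))) - 2 * φ * (-κ t * r t)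
        + φ * (-(2 * κ t * (r t - r t ^ 2 - V t)) / (1 - r t))
      = - (2 * κ t * V t / (1 - r t)) * ((1 - r t) / (G + 1 - r t) - φ) := by
      have := (p1 t).ne'; have := (p2 t).ne'; clear_value φ; field_simp; ring
    have h1 : 0 ≤ 2 * κ t * V t / (1 - r t) :=
      div_nonneg (mul_nonneg (by linarith [hκ t ht]) (hV0 t)) (p1 t).le
    have h2 := hχ t ht
    nlinarith
  have b2 := anti_of (fun t => 2 * E t + log (G + 1 - r t) - 2 * φ * A t
      - δ * (-(G + 1) * log (G + 1 - r t) - r t + φ * (log (1 - r t) + r t))) s T hs.2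
    ((((cE.const_mul 2).add cl2).sub (cA.const_mul _)).sub
      ((((cl2.const_mul (-(G + 1))).sub cr).add ((cl1.add cr).const_mul φ)).const_mul δ)) fun t ht => by
    have ht := sub2 t ht
    obtain ⟨d, hd, hd'⟩ := dE t ht
    refine ⟨_, ((((hd.const_mul 2).add (dl2 t ht)).sub ((dA t ht).const_mul (2 * φ))).sub
      (((((dl2 t ht).const_mul (-(G + 1))).sub (dr t ht)).add
        (((dl1 t ht).add (dr t ht)).const_mul φ)).const_mul δ)), ?_⟩
    have e : -(2 * (κ t * (V t / (G + 1 - r t)))) + -(2 * κ t * (r t - r t ^ 2 - V t)) / (G + 1 - r t)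
        - 2 * φ * (-κ t * r t)
        - δ * (-(G + 1) * (-(2 * κ t * (r t - r t ^ 2 - V t)) / (G + 1 - r t))
          - (2 * κ t * (r t - r t ^ 2 - V t))
          + φ * (-(2 * κ t * (r t - r t ^ 2 - V t)) / (1 - r t) + 2 * κ t * (r t - r t ^ 2 - V t)))
      = - (2 * κ t * r t) * ((1 - r t) / (G + 1 - r t) - φ) * (1 - δ * (V t / (1 - r t) - r t)) := by
      have := (p1 t).ne'; have := (p2 t).ne'; clear_value φ; field_simp; ring
    have hv : V t / (1 - r t) - r t ≤ G - 1 := by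
      have : V t / (1 - r t) ≤ G - 1 + r t := by
        rw [div_le_iff₀ (p1 t)]; linarith [hV1 t]
      linarith
    have h1 := mul_le_mul_of_nonneg_left hv hδ
    have h2 := mul_nonneg (hκ t ht) (hr0 t)
    have h3 := hχ t ht
    have h4 := mul_nonneg (mul_nonneg h2 (sub_nonneg.2 h3)) (show 0 ≤ 1 - δ * (V t / (1 - r t) - r t) by linarith)
    nlinarith
  simp only [r0, rT, AT] at a1 a2 b1 b2
  simp only [sub_zero, log_one] at a1 a2 b1 b2
  refine ⟨s, ?_, ?_⟩
  · linarith
  · linarith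

namespace Adm
variable {h : ℝ → ℝ} {K : ℝ} (H : Adm h K)
include H

lemma main_lyap (G δ : ℝ) (hG : 1 ≤ G) (hδ : 0 ≤ δ) (hδG : δ * (G - 1) ≤ 1)
    (hGa : ∀ t y, Ga h t y ≤ G) :
    ∃ R, 0 ≤ R ∧ 1 / K ≤ 1 - R ∧ 2 * Ent h 0 ≥ -log (1 - R) + δ * (-log (1 - R) - R) ∧
      2 * (Ent h 0 - Cf h (π / 2)) ≥ 2 * Ent h 0 * ((1 - R) / (G + 1 - R))
        + ((log (G + 1) - log (G + 1 - R)) + (1 - R) / (G + 1 - R) * log (1 - R)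
        + δ * ((G + 1) * (log (G + 1) - log (G + 1 - R)) - R
          + (1 - R) / (G + 1 - R) * (log (1 - R) + R))) := by
  have hk : ∀ t ∈ Ioo 0 (π / 2), 0 ≤ cos t / sin t := fun t ht =>
    div_nonneg (cos_nonneg_of_mem_Icc ⟨by linarith [ht.1, pi_pos], ht.2.le⟩)
      (sin_pos_of_pos_of_lt_pi ht.1 (by linarith [ht.2, pi_pos])).le
  have hV : ∀ t, VG h t ≤ (1 - Rf h t) * (G - 1 + Rf h t) := fun t => by
    have := H.SG_le G t (hGa t)
    unfold VG
    nlinarith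
  have hE : ∀ t ∈ Ioo 0 (π / 2), ∃ d, HasDerivAt (fun t => Cf h t - Ent h t) d t ∧
      d ≤ -(cos t / sin t * (VG h t / (G + 1 - Rf h t))) := fun t ht => by
    refine ⟨_, (H.Cf_hasDeriv t ht).sub (H.Ent_hasDeriv t ht), ?_⟩
    have hw := H.W_ge G t (by linarith) (hGa t)
    nlinarith [mul_le_mul_of_nonneg_left hw (hk t ht)]
  obtain ⟨s, h1, h2⟩ := lyap (Rf h) (Ent h) (fun t => Cf h t - Ent h t) (VG h) (fun t => cos t / sin t)
    (π / 2) G δ (by positivity) hG hδ hδG H.Rf_BC.1 H.Ent_BC.1 (H.Cf_BC.1.sub H.Ent_BC.1)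
    H.Rf_zero H.Rf_pi H.Ent_pi H.Rf_nonneg (fun t => by linarith [H.Rf_le t, H.tpos])
    hk H.VG_nonneg hV H.Rf_hasDeriv H.Ent_hasDeriv hE
  refine ⟨Rf h s, H.Rf_nonneg s, H.Rf_le s, h1, ?_⟩
  refine le_trans h2 (le_of_eq ?_)
  rw [H.Cf_zero, H.Ent_pi]; ring

end Adm

/-- The lower barrier function, in the variable `w = 1 - R`. -/
def barB (G δ w : ℝ) : ℝ :=
  (log (G + 1) - log (G + w)) + w / (G + w) * log w
    + δ * ((G + 1) * (log (G + 1) - log (G + w)) - (1 - w) + w / (G + w) * (log w + (1 - w)))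

/-- The entropy barrier, in the variable `w = 1 - R`. -/
def barT (δ w : ℝ) : ℝ := -log w + δ * (-log w - (1 - w))

lemma barB_deriv (G δ w : ℝ) (hG : 0 < G) (hw : 0 < w) :
    HasDerivAt (barB G δ) (-(G / (G + w) ^ 2 * barT δ w)) w := by
  have h0 : HasDerivAt (fun w : ℝ => G + w) 1 w := (hasDerivAt_id w).const_add G
  have hne : G + w ≠ 0 := by positivity
  have hw' : w ≠ 0 := hw.ne'
  have h1 : HasDerivAt (fun w : ℝ => log (G + w)) (1 / (G + w)) w := h0.log hne
  have h2 : HasDerivAt (fun w : ℝ => w / (G + w)) ((1 * (G + w) - w * 1) / (G + w) ^ 2) w :=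
    (hasDerivAt_id w).div h0 hne
  have h3 := hasDerivAt_log hw'
  have h4 : HasDerivAt (fun w : ℝ => 1 - w) (-1) w := (hasDerivAt_id w).const_sub 1
  have h5 := h1.const_sub (log (G + 1))
  have h6 := (h5.add (h2.mul h3)).add
    ((((h5.const_mul (G + 1)).sub h4).add (h2.mul (h3.add h4))).const_mul δ)
  refine (h6.congr_deriv ?_)
  simp only [barT, Pi.add_apply]
  field_simp
  ring

lemma barT_anti (δ a b : ℝ) (hδ : 0 ≤ δ) (ha : 0 < a) (hab : a ≤ b) (hb : b ≤ 1) :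
    barT δ b ≤ barT δ a := by
  unfold barT
  have h1 : log a ≤ log b := log_le_log ha hab
  have h3 : log (a / b) ≤ a / b - 1 := log_le_sub_one_of_pos (div_pos ha (by linarith))
  rw [log_div ha.ne' (by linarith)] at h3
  have h4 : a / b - 1 ≤ a - b := by
    have hb0 : 0 < b := by linarith
    rw [div_sub_one hb0.ne', div_le_iff₀ hb0]
    nlinarith
  nlinarith

lemma barT_one (δ : ℝ) : barT δ 1 = 0 := by simp [barT]

lemma barT_nonneg (δ w : ℝ) (hδ : 0 ≤ δ) (hw : 0 < w) (hw1 : w ≤ 1) : 0 ≤ barT δ w := by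
  have := barT_anti δ w 1 hδ hw hw1 le_rfl
  rwa [barT_one] at this

lemma mono_aux (f f' : ℝ → ℝ) (a b : ℝ) (hab : a ≤ b)
    (hf : ∀ x ∈ Icc a b, HasDerivAt f (f' x) x) (h0 : ∀ x ∈ Icc a b, 0 ≤ f' x) : f a ≤ f b := by
  have : MonotoneOn f (Icc a b) := by
    refine monotoneOn_of_deriv_nonneg (convex_Icc a b)
      (fun x hx => (hf x hx).continuousAt.continuousWithinAt) ?_ ?_
    · intro x hx
      exact (hf x (interior_subset hx)).differentiableAt.differentiableWithinAt
    · intro x hx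
      rw [(hf x (interior_subset hx)).deriv]
      exact h0 x (interior_subset hx)
  exact this (left_mem_Icc.2 hab) (right_mem_Icc.2 hab) hab

lemma barB_nonneg (G δ w : ℝ) (hG : 0 < G) (hδ : 0 ≤ δ) (hw : 0 < w) (hw1 : w ≤ 1) :
    0 ≤ barB G δ w := by
  have := mono_aux (fun x => -barB G δ x) (fun x => G / (G + x) ^ 2 * barT δ x) w 1 hw1
    (fun x hx => by
      exact (barB_deriv G δ x hG (hw.trans_le hx.1)).neg.congr_deriv (neg_neg _))
    (fun x hx => mul_nonneg (by positivity) (barT_nonneg δ x hδ (hw.trans_le hx.1) hx.2))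
  have h1 : barB G δ 1 = 0 := by simp [barB]
  simp only [h1] at this
  linarith

lemma bar_core (c G δ I0 I' P W w : ℝ) (hG : 0 < G) (hδ : 0 ≤ δ) (hW : 0 < W)
    (hWw : W ≤ w) (hw1 : w ≤ 1) (h0 : barT δ w ≤ I0) (hI : I0 ≤ I') (hT : barT δ W ≤ I')
    (hk : 0 ≤ (W / (G + W) - c) * I' + barB G δ W)
    (hP : P ≥ I0 * (w / (G + w)) + barB G δ w) : P ≥ c * I0 := by
  have hw : 0 < w := hW.trans_le hWw
  have hI0 : 0 ≤ I0 := (barT_nonneg δ w hδ hw hw1).trans h0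
  have hB := barB_nonneg G δ w hG hδ hw hw1
  by_cases hc : c ≤ w / (G + w)
  · nlinarith
  push Not at hc
  have := mono_aux (fun x => (x / (G + x) - c) * I' + barB G δ x)
    (fun x => G / (G + x) ^ 2 * (I' - barT δ x)) W w hWw
    (fun x hx => by
      have hx0 : 0 < x := hW.trans_le hx.1
      have hne : G + x ≠ 0 := by positivity
      have h2 : HasDerivAt (fun w : ℝ => w / (G + w)) ((1 * (G + x) - x * 1) / (G + x) ^ 2) x :=
        (hasDerivAt_id x).div ((hasDerivAt_id x).const_add G) hne
      have h3 := ((h2.sub_const c).mul_const I').add (barB_deriv G δ x hG hx0)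
      refine h3.congr_deriv ?_
      field_simp
      ring)
    (fun x hx => mul_nonneg (by have := hW.trans_le hx.1; positivity)
      (by linarith [barT_anti δ W x hδ hW hx.1 (hx.2.trans hw1)]))
  nlinarith

namespace Adm
variable {h : ℝ → ℝ} {K : ℝ} (H : Adm h K)
include H

/-- Reduction of the entropy production bound to a numerical inequality. -/
lemma reduce (G δ I' W : ℝ) (hG : 1 ≤ G) (hδ : 0 ≤ δ) (hδG : δ * (G - 1) ≤ 1)
    (hM : (K ^ 2 - 1) * ∫ z, max (z ^ 2 - G) 0 ∂gam ≤ G - 1) (hW : 0 < W)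
    (hWK : W ≤ 1 / K ∨ (δ = 0 ∧ I' ≤ -log W))
    (hI : 2 * (log K * ((K - 1) / (K + 1))) ≤ I') (hT : barT δ W ≤ I')
    (hk : 0 ≤ (W / (G + W) - 1 / (2 * K)) * I' + barB G δ W) :
    Ent h 0 - Cf h (π / 2) ≥ 1 / (2 * K) * Ent h 0 := by
  obtain ⟨R, hR0, hR1, h1, h2⟩ := H.main_lyap G δ hG hδ hδG (H.Ga_le G hM)
  have hK := H.one_le
  have hw0 : 0 < 1 - R := lt_of_lt_of_le (by positivity) hR1
  have hE := H.Ent_le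
  have e1 : barT δ (1 - R) = -log (1 - R) + δ * (-log (1 - R) - R) := by
    simp [barT]
  have e2 : barB G δ (1 - R) = (log (G + 1) - log (G + 1 - R)) + (1 - R) / (G + 1 - R) * log (1 - R)
        + δ * ((G + 1) * (log (G + 1) - log (G + 1 - R)) - R
          + (1 - R) / (G + 1 - R) * (log (1 - R) + R)) := by
    simp [barB, add_sub_assoc]
  have hWw : W ≤ 1 - R := by
    rcases hWK with h | ⟨h, h'⟩
    · linarith
    · rw [← log_le_log_iff hW hw0]
      rw [h] at h1
      linarith
  have := bar_core (1 / (2 * K)) G δ (2 * Ent h 0) I' (2 * (Ent h 0 - Cf h (π / 2))) W (1 - R)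
    (by linarith) hδ hW hWw (by linarith) (by rw [e1]; linarith) (by linarith) hT hk
    (by rw [e2, ← add_sub_assoc]; linarith)
  linarith
end Adm

lemma log_lb (x : ℝ) (hx : 0 ≤ x) : 2 * x / (2 + x) ≤ log (1 + x) := by
  have := mono_aux (fun x => log (1 + x) - 2 * x / (2 + x))
    (fun x => 1 / (1 + x) - (2 * (2 + x) - 2 * x * 1) / (2 + x) ^ 2) 0 x hx
    (fun y hy => by
      have h1 : HasDerivAt (fun y : ℝ => 1 + y) 1 y := (hasDerivAt_id y).const_add 1
      have h2 : HasDerivAt (fun y : ℝ => 2 + y) 1 y := (hasDerivAt_id y).const_add 2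
      have h3 : HasDerivAt (fun y : ℝ => 2 * y) 2 y := by simpa using (hasDerivAt_id y).const_mul 2
      exact (h1.log (by linarith [hy.1])).sub (h3.div h2 (by linarith [hy.1])))
    (fun y hy => by
      have := hy.1
      rw [div_sub_div _ _ (by positivity) (by positivity)]
      apply div_nonneg _ (by positivity)
      nlinarith)
  simp at this
  linarith

/-- Gaussian tail estimate of Mills type. -/
lemma mills (l : ℝ) (hl : 1 ≤ l) :
    ∫ z, max (z ^ 2 - l ^ 2) 0 ∂gam ≤ 4 * l * gaussPDF l / (l ^ 2 + 1) := by
  have hg0 : ∀ z, 0 ≤ gaussPDF z := fun z => by unfold gaussPDF; positivity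
  rw [gam_integral]
  have e1 : ∫ z, max (z ^ 2 - l ^ 2) 0 * gaussPDF z
      = 2 * ∫ z in Ioi (0:ℝ), max (z ^ 2 - l ^ 2) 0 * gaussPDF z := by
    rw [← integral_comp_abs (f := fun z => max (z ^ 2 - l ^ 2) 0 * gaussPDF z)]
    simp [gaussPDF]
  have hl0 : (0:ℝ) ≤ l := by linarith
  have e2 : ∫ z in Ioi (0:ℝ), max (z ^ 2 - l ^ 2) 0 * gaussPDF z
      = ∫ z in Ioi l, (z ^ 2 - l ^ 2) * gaussPDF z := by
    rw [setIntegral_eq_of_subset_of_forall_diff_eq_zero measurableSet_Ioi (Ioi_subset_Ioi hl0)]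
    · refine setIntegral_congr_fun measurableSet_Ioi fun z hz => ?_
      have hz : l < z := hz
      rw [max_eq_left (by nlinarith)]
    · intro z hz
      have h1 : 0 < z := hz.1
      have h2 : z ≤ l := not_lt.1 hz.2
      rw [max_eq_right (by nlinarith), zero_mul]
  set a := l ^ 2 - 1 with ha
  have ha0 : 0 ≤ a := by nlinarith
  let Q : ℝ → ℝ := fun z => (z - a * (z / (z ^ 2 + 1))) * gaussPDF z
  let Q' : ℝ → ℝ := fun z => (1 - a * ((1 * (z ^ 2 + 1) - z * (2 * z)) / (z ^ 2 + 1) ^ 2)) * gaussPDF z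
    + (z - a * (z / (z ^ 2 + 1))) * (-z * gaussPDF z)
  have hQ : ∀ z, HasDerivAt Q (Q' z) z := fun z => by
    have h1 : HasDerivAt (fun z : ℝ => z ^ 2 + 1) (2 * z) z := by
      simpa using (hasDerivAt_pow 2 z).add_const 1
    have h2 := (hasDerivAt_id z).div h1 (by positivity)
    exact ((hasDerivAt_id z).sub (h2.const_mul a)).mul (gaussPDF_hasDerivAt z)
  have hle : ∀ z, (z ^ 2 - l ^ 2) * gaussPDF z ≤ -Q' z := fun z => by
    have : -Q' z - (z ^ 2 - l ^ 2) * gaussPDF z = (2 * a / (z ^ 2 + 1) ^ 2) * gaussPDF z := by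
      have : l ^ 2 = a + 1 := by rw [ha]; ring
      simp only [Q', this]
      field_simp
      ring
    have h2 : 0 ≤ (2 * a / (z ^ 2 + 1) ^ 2) * gaussPDF z := mul_nonneg (by positivity) (hg0 z)
    linarith
  have hQ0 : Filter.Tendsto Q Filter.atTop (nhds 0) := by
    have t1 := (tendsto_pow_mul_exp_neg_atTop_nhds_zero 1).const_mul
      ((1 + a) * ((√(2 * π))⁻¹ * exp (1 / 2)))
    rw [mul_zero] at t1
    refine squeeze_zero_norm' ?_ t1
    filter_upwards [Filter.eventually_ge_atTop 0] with z hz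
    simp only [Q, norm_mul, norm_eq_abs, abs_of_nonneg (hg0 z)]
    have h1 : gaussPDF z ≤ (√(2 * π))⁻¹ * exp (1 / 2) * exp (-z) := by
      unfold gaussPDF
      rw [mul_assoc, ← exp_add]
      gcongr
      nlinarith [sq_nonneg (z - 1)]
    have h2 : |z - a * (z / (z ^ 2 + 1))| ≤ (1 + a) * z := by
      have h3 : z / (z ^ 2 + 1) ≤ z := div_le_self hz (by nlinarith)
      have h4 : 0 ≤ z / (z ^ 2 + 1) := by positivity
      rw [abs_le]
      constructor <;> nlinarith
    calc _ ≤ ((1 + a) * z) * ((√(2 * π))⁻¹ * exp (1 / 2) * exp (-z)) := by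
          gcongr
          exact hg0 z
      _ = _ := by ring
  have hneg : ∀ z ∈ Ioi l, Q' z ≤ 0 := fun z hz => by
    have hz : l < z := hz
    have := hle z
    have h2 : 0 ≤ (z ^ 2 - l ^ 2) * gaussPDF z := mul_nonneg (by nlinarith) (hg0 z)
    linarith
  have hQi := integrableOn_Ioi_deriv_of_nonpos' (fun z _ => hQ z) hneg hQ0
  have hval := integral_Ioi_of_hasDerivAt_of_nonpos' (fun z _ => hQ z) hneg hQ0
  have hfin : ∫ z in Ioi l, (z ^ 2 - l ^ 2) * gaussPDF z ≤ ∫ z in Ioi l, -Q' z := by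
    refine integral_mono_of_nonneg ?_ hQi.neg (ae_of_all _ hle)
    refine (ae_restrict_iff' measurableSet_Ioi).2 (ae_of_all _ fun z hz => ?_)
    have hz : l < z := hz
    exact mul_nonneg (by nlinarith) (hg0 z)
  rw [integral_neg, hval] at hfin
  rw [e1, e2]
  have hQl : Q l = 2 * l * gaussPDF l / (l ^ 2 + 1) := by
    simp only [Q, ha]
    field_simp
    ring
  have : 4 * l * gaussPDF l / (l ^ 2 + 1) = 2 * Q l := by rw [hQl]; ring
  rw [this]
  linarith

/-- Taylor polynomial of the exponential, used for numerical lower bounds. -/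
def expT (x : ℝ) : ℝ := ∑ i ∈ Finset.range 24, x ^ i / (Nat.factorial i : ℝ)

lemma expT_le (x : ℝ) (hx : 0 ≤ x) : expT x ≤ exp x := sum_le_exp_of_nonneg hx 24

lemma gaussPDF_ub (l e : ℝ) (he : 0 < e) (h : e ≤ exp (l ^ 2 / 2)) :
    gaussPDF l ≤ 0.39895 / e := by
  unfold gaussPDF
  have h1 : (2.5066:ℝ) ≤ √(2 * π) := by
    apply le_sqrt_of_sq_le
    nlinarith [pi_gt_d6]
  have h2 : (√(2 * π))⁻¹ ≤ 0.39895 := by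
    rw [inv_le_comm₀ (by linarith) (by norm_num)]
    refine le_trans ?_ h1
    norm_num
  have h3 : exp (-l ^ 2 / 2) ≤ 1 / e := by
    rw [show -l ^ 2 / 2 = -(l ^ 2 / 2) by ring, exp_neg, one_div]
    exact inv_anti₀ he h
  calc _ ≤ 0.39895 * (1 / e) := by gcongr
    _ = _ := by ring

lemma millsK (K b l e : ℝ) (hK : 1 ≤ K) (hb : K ≤ b) (hl : 1 ≤ l) (he : 0 < e)
    (h : e ≤ exp (l ^ 2 / 2))
    (hc : (b ^ 2 - 1) * (4 * l * 0.39895) ≤ (l ^ 2 - 1) * (l ^ 2 + 1) * e) :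
    (K ^ 2 - 1) * ∫ z, max (z ^ 2 - l ^ 2) 0 ∂gam ≤ l ^ 2 - 1 := by
  have h1 := mills l hl
  have h2 := gaussPDF_ub l e he h
  have h3 : 4 * l * gaussPDF l / (l ^ 2 + 1) ≤ 4 * l * (0.39895 / e) / (l ^ 2 + 1) := by gcongr
  have hK2 : 0 ≤ K ^ 2 - 1 := by nlinarith
  have hKb : K ^ 2 - 1 ≤ b ^ 2 - 1 := by nlinarith
  calc _ ≤ (b ^ 2 - 1) * (4 * l * (0.39895 / e) / (l ^ 2 + 1)) := by
        apply mul_le_mul hKb (h1.trans h3) _ (by linarith)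
        exact integral_nonneg fun z => le_max_right _ _
    _ = ((b ^ 2 - 1) * (4 * l * 0.39895)) / ((l ^ 2 + 1) * e) := by field_simp
    _ ≤ _ := by
        rw [div_le_iff₀ (by positivity)]
        linarith

namespace Adm
variable {h : ℝ → ℝ} {K : ℝ} (H : Adm h K)
include H

lemma smallGen (G r V : ℝ) (hG : 1 ≤ G) (hr0 : 0 ≤ r)
    (hM : (K ^ 2 - 1) * ∫ z, max (z ^ 2 - G) 0 ∂gam ≤ G - 1)
    (hI : 2 * (log K * ((K - 1) / (K + 1))) ≤ r) (hV : exp (-r) ≤ V)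
    (hc : r * (2 * G + 1 + V) ≤ 4 * K * (1 - V)) :
    Ent h 0 - Cf h (π / 2) ≥ 1 / (2 * K) * Ent h 0 := by
  have hK := H.one_le
  refine H.reduce G 0 r (exp (-r)) hG le_rfl (by simp) hM (exp_pos _) (Or.inr ⟨rfl, by simp⟩)
    hI (by simp [barT]) ?_
  set W := exp (-r) with hW
  have hW0 : 0 < W := exp_pos _
  have hW1 : W ≤ 1 := exp_le_one_iff.2 (by linarith)
  have hlW : log W = -r := by rw [hW, log_exp]
  have hx := log_lb ((1 - W) / (G + W)) (by apply div_nonneg <;> linarith)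
  have e1 : 1 + (1 - W) / (G + W) = (G + 1) / (G + W) := by field_simp; ring
  rw [e1, log_div (by positivity) (by positivity)] at hx
  have e2 : 2 * ((1 - W) / (G + W)) / (2 + (1 - W) / (G + W)) = 2 * (1 - W) / (2 * G + 1 + W) := by
    have : 2 + (1 - W) / (G + W) = (2 * G + 1 + W) / (G + W) := by field_simp; ring
    rw [this]
    field_simp
  rw [e2] at hx
  have e3 : r / (2 * K) ≤ 2 * (1 - W) / (2 * G + 1 + W) := by
    rw [div_le_div_iff₀ (by positivity) (by positivity)]
    nlinarith
  have e4 : (W / (G + W) - 1 / (2 * K)) * r + barB G 0 W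
      = (log (G + 1) - log (G + W)) - r / (2 * K) := by
    simp only [barB, hlW]
    ring
  rw [e4]
  linarith

lemma small (a b l r V s : ℝ) (ha : a ≤ K) (hb : K ≤ b) (hl : 1 ≤ l) (hr0 : 0 ≤ r) (hs : 0 ≤ s)
    (hV0 : 0 ≤ V) (hV1 : V ≤ 1)
    (hm : (b ^ 2 - 1) * (4 * l * 0.39895) ≤ (l ^ 2 - 1) * (l ^ 2 + 1) * expT (l ^ 2 / 2))
    (h1 : b ≤ expT s) (h2 : 1 ≤ V * expT r) (h3 : 2 * s * (b - 1) ≤ r * (b + 1))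
    (h4 : r * (2 * l ^ 2 + 1 + V) ≤ 4 * a * (1 - V)) :
    Ent h 0 - Cf h (π / 2) ≥ 1 / (2 * K) * Ent h 0 := by
  have hK := H.one_le
  have hp : ∀ x, 0 ≤ x → 0 < expT x := fun x hx => by
    have : (1:ℝ) ≤ expT x := by
      unfold expT
      rw [Finset.sum_range_succ']
      have : 0 ≤ ∑ k ∈ Finset.range 23, x ^ (k + 1) / (Nat.factorial (k + 1) : ℝ) :=
        Finset.sum_nonneg fun i _ => by positivity
      simpa using this
    linarith
  refine H.smallGen (l ^ 2) r V (by nlinarith) hr0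
    (millsK K b l _ hK hb hl (hp _ (by positivity)) (expT_le _ (by positivity)) hm) ?_ ?_ ?_
  · have hlog : log K ≤ s := by
      rw [log_le_iff_le_exp (by linarith)]
      exact hb.trans (h1.trans (expT_le s hs))
    have hf : (K - 1) / (K + 1) ≤ (b - 1) / (b + 1) := by
      rw [div_le_div_iff₀ (by linarith) (by linarith)]
      nlinarith
    have h5 : 0 ≤ (K - 1) / (K + 1) := div_nonneg (by linarith) (by linarith)
    calc _ ≤ 2 * (s * ((b - 1) / (b + 1))) := by gcongr
      _ = 2 * s * (b - 1) / (b + 1) := by ring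
      _ ≤ r := by
        rw [div_le_iff₀ (by linarith)]
        exact h3
  · have := expT_le r hr0
    rw [exp_neg, inv_le_iff_one_le_mul₀ (exp_pos r)]
    nlinarith
  · nlinarith

lemma bigGen (G u : ℝ) (hG : 3.2 ≤ G) (hK : 4.2 ≤ K) (hu : log K ≤ u)
    (hM : (K ^ 2 - 1) * ∫ z, max (z ^ 2 - G) 0 ∂gam ≤ G - 1)
    (hc : u * ((1 + K + 2 * G * K)
        * (G * K * (K + 1) + (K - 1) * (G - 1) * (1 + G * K - 2 * K)))
      ≤ (K - 1) * (2 * G * K - K + 3) * (G * K * (K + 1))) :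
    Ent h 0 - Cf h (π / 2) ≥ 1 / (2 * K) * Ent h 0 := by
  have hL0 : 0 ≤ log K := log_nonneg (by linarith)
  have hG1 : 0 < G - 1 := by linarith
  refine H.reduce G (1 / (G - 1)) (2 * (log K * ((K - 1) / (K + 1)))) (1 / K) (by linarith)
    (by positivity) (by field_simp; rfl) hM (by positivity) (Or.inl le_rfl) le_rfl ?_ ?_
  · have hL4 : log K ≤ 0.38633 + K / 4 := by
      have h4 : log (4:ℝ) ≤ 1.38633 := by
        rw [show (4:ℝ) = 2 ^ 2 by norm_num, log_pow]
        push_cast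
        linarith [log_two_lt_d9]
      have := log_le_sub_one_of_pos (show 0 < K / 4 by linarith)
      rw [log_div (by linarith) (by norm_num)] at this
      linarith
    simp only [barT, one_div, log_inv, neg_neg]
    have e : 2 * (log K * ((K - 1) / (K + 1))) - (log K + (G - 1)⁻¹ * (log K - (1 - K⁻¹)))
        = (log K * ((K - 3) * (G - 1) - (K + 1)) * K + (K + 1) * (K - 1)) / ((K + 1) * (G - 1) * K) := by
      field_simp
      ring
    have : 0 ≤ (log K * ((K - 3) * (G - 1) - (K + 1)) * K + (K + 1) * (K - 1)) / ((K + 1) * (G - 1) * K) := by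
      apply div_nonneg _ (by positivity)
      have hcc : 1.2 * K - 7.6 ≤ (K - 3) * (G - 1) - (K + 1) := by nlinarith
      have h1 : log K * (1.2 * K - 7.6) ≤ log K * ((K - 3) * (G - 1) - (K + 1)) := by gcongr
      by_cases hs : 0 ≤ 1.2 * K - 7.6
      · have : 0 ≤ log K * ((K - 3) * (G - 1) - (K + 1)) := le_trans (by positivity) h1
        have : 0 ≤ (K + 1) * (K - 1) := mul_nonneg (by linarith) (by linarith)
        positivity
      · push Not at hs
        have h2 : (0.38633 + K / 4) * (1.2 * K - 7.6) ≤ log K * (1.2 * K - 7.6) := by nlinarith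
        have h3 : (0.38633 + K / 4) * (1.2 * K - 7.6) * K ≤ log K * ((K - 3) * (G - 1) - (K + 1)) * K :=
          mul_le_mul_of_nonneg_right (h2.trans h1) (by linarith)
        nlinarith
    linarith
  · have hx := log_lb ((K - 1) / (1 + G * K)) (by apply div_nonneg; linarith; positivity)
    have e1 : 1 + (K - 1) / (1 + G * K) = (G + 1) / (G + 1 / K) := by field_simp; ring
    rw [e1, log_div (by positivity) (by positivity)] at hx
    set X := log (G + 1) - log (G + 1 / K) with hX
    have e2 : 2 * ((K - 1) / (1 + G * K)) / (2 + (K - 1) / (1 + G * K))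
        = 2 * (K - 1) / (1 + K + 2 * G * K) := by
      have : 2 + (K - 1) / (1 + G * K) = (1 + K + 2 * G * K) / (1 + G * K) := by field_simp; ring
      rw [this]
      field_simp
    rw [e2] at hx
    have e3 : (1 / K / (G + 1 / K) - 1 / (2 * K)) * (2 * (log K * ((K - 1) / (K + 1))))
        + barB G (1 / (G - 1)) (1 / K)
        = G / ((G - 1) * (1 + G * K)) * (2 * (1 + G * K) * X - (K - 1)
          - log K * (1 + (K - 1) * (G - 1) * (1 + G * K - 2 * K) / (G * K * (K + 1)))) := by
      simp only [barB, one_div, log_inv]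
      rw [← one_div, ← hX]
      have : G + 1 / K = (1 + G * K) / K := by field_simp; ring
      rw [this]
      field_simp
      ring
    rw [e3]
    apply mul_nonneg (by positivity)
    have hGK : 0 ≤ 1 + G * K - 2 * K := by nlinarith
    have hK1 : 0 ≤ K - 1 := by linarith
    have e4 : 2 * (1 + G * K) * (2 * (K - 1) / (1 + K + 2 * G * K)) ≤ 2 * (1 + G * K) * X := by gcongr
    have e5 : log K * (1 + (K - 1) * (G - 1) * (1 + G * K - 2 * K) / (G * K * (K + 1)))
        ≤ u * (1 + (K - 1) * (G - 1) * (1 + G * K - 2 * K) / (G * K * (K + 1))) := by gcongr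
    have e6 : 2 * (1 + G * K) * (2 * (K - 1) / (1 + K + 2 * G * K)) - (K - 1)
          - u * (1 + (K - 1) * (G - 1) * (1 + G * K - 2 * K) / (G * K * (K + 1)))
        = ((K - 1) * (2 * G * K - K + 3) * (G * K * (K + 1)) - u * ((1 + K + 2 * G * K)
        * (G * K * (K + 1) + (K - 1) * (G - 1) * (1 + G * K - 2 * K))))
          / ((1 + K + 2 * G * K) * (G * K * (K + 1))) := by
      field_simp
      ring
    have e7 : 0 ≤ ((K - 1) * (2 * G * K - K + 3) * (G * K * (K + 1)) - u * ((1 + K + 2 * G * K)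
        * (G * K * (K + 1) + (K - 1) * (G - 1) * (1 + G * K - 2 * K))))
          / ((1 + K + 2 * G * K) * (G * K * (K + 1))) :=
      div_nonneg (by linarith) (by positivity)
    linarith
end Adm

namespace Adm
variable {h : ℝ → ℝ} {K : ℝ} (H : Adm h K)
include H

lemma big (a b l s : ℝ) (ha : a ≤ K) (hb : K ≤ b) (ha4 : 4.2 ≤ a) (hl : 1.8 ≤ l) (hs : 0 ≤ s)
    (hm : (b ^ 2 - 1) * (4 * l * 0.39895) ≤ (l ^ 2 - 1) * (l ^ 2 + 1) * expT (l ^ 2 / 2))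
    (h1 : a ≤ expT s)
    (hc : ∀ t : ℝ, 0 ≤ t → (s + t / a) * ((1 + (a + t) + 2 * l ^ 2 * (a + t))
        * (l ^ 2 * (a + t) * ((a + t) + 1)
          + ((a + t) - 1) * (l ^ 2 - 1) * (1 + l ^ 2 * (a + t) - 2 * (a + t))))
      ≤ ((a + t) - 1) * (2 * l ^ 2 * (a + t) - (a + t) + 3) * (l ^ 2 * (a + t) * ((a + t) + 1))) :
    Ent h 0 - Cf h (π / 2) ≥ 1 / (2 * K) * Ent h 0 := by
  have hK := H.one_le
  have hl1 : 3.2 ≤ l ^ 2 := by nlinarith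
  have hp : 0 < expT (l ^ 2 / 2) := by
    have h0 : 0 < (l ^ 2 - 1) * (l ^ 2 + 1) := by
      apply mul_pos <;> linarith
    have h2 : 0 < (b ^ 2 - 1) * (4 * l * 0.39895) := by
      apply mul_pos <;> nlinarith
    by_contra hcon
    push Not at hcon
    nlinarith
  refine H.bigGen (l ^ 2) (s + (K - a) / a) hl1 (by linarith) ?_
    (millsK K b l _ hK hb (by linarith) hp (expT_le _ (by positivity)) hm) ?_
  · have h2 : log a ≤ s := by
      rw [log_le_iff_le_exp (by linarith)]
      exact h1.trans (expT_le s hs)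
    have h3 := log_le_sub_one_of_pos (show 0 < K / a by apply div_pos <;> linarith)
    rw [log_div (by linarith) (by linarith)] at h3
    have : (K - a) / a = K / a - 1 := by
      have : a ≠ 0 := by linarith
      field_simp
    linarith
  · have := hc (K - a) (by linarith)
    rwa [show a + (K - a) = K by ring] at this

lemma mid (ha : 1.6 ≤ K) (hb : K ≤ 4.26) :
    Ent h 0 - Cf h (π / 2) ≥ 1 / (2 * K) * Ent h 0 := by
  rcases le_total K 1.89 with hb | ha
  · refine H.small 1.6 1.89 1.342 0.3921 0.6757 0.6366 (by assumption) (by assumption) ?_ ?_ ?_ ?_ ?_ ?_ ?_ ?_ ?_ ?_ <;>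
    norm_num [expT, Finset.sum_range_succ, Nat.factorial]
  rcases le_total K 2.22 with hb | ha
  · refine H.small 1.89 2.22 1.434 0.6044 0.5465 0.7976 (by assumption) (by assumption) ?_ ?_ ?_ ?_ ?_ ?_ ?_ ?_ ?_ ?_ <;>
    norm_num [expT, Finset.sum_range_succ, Nat.factorial]
  rcases le_total K 2.56 with hb | ha
  · refine H.small 2.22 2.56 1.515 0.824 0.4387 0.9401 (by assumption) (by assumption) ?_ ?_ ?_ ?_ ?_ ?_ ?_ ?_ ?_ ?_ <;>
    norm_num [expT, Finset.sum_range_succ, Nat.factorial]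
  rcases le_total K 2.89 with hb | ha
  · refine H.small 2.56 2.89 1.585 1.0313 0.3566 1.0613 (by assumption) (by assumption) ?_ ?_ ?_ ?_ ?_ ?_ ?_ ?_ ?_ ?_ <;>
    norm_num [expT, Finset.sum_range_succ, Nat.factorial]
  rcases le_total K 3.19 with hb | ha
  · refine H.small 2.89 3.19 1.642 1.2128 0.2974 1.1601 (by assumption) (by assumption) ?_ ?_ ?_ ?_ ?_ ?_ ?_ ?_ ?_ ?_ <;>
    norm_num [expT, Finset.sum_range_succ, Nat.factorial]
  rcases le_total K 3.45 with hb | ha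
  · refine H.small 3.19 3.45 1.687 1.3637 0.2558 1.2384 (by assumption) (by assumption) ?_ ?_ ?_ ?_ ?_ ?_ ?_ ?_ ?_ ?_ <;>
    norm_num [expT, Finset.sum_range_succ, Nat.factorial]
  rcases le_total K 3.67 with hb | ha
  · refine H.small 3.45 3.67 1.722 1.4868 0.2261 1.3002 (by assumption) (by assumption) ?_ ?_ ?_ ?_ ?_ ?_ ?_ ?_ ?_ ?_ <;>
    norm_num [expT, Finset.sum_range_succ, Nat.factorial]
  rcases le_total K 3.86 with hb | ha
  · refine H.small 3.67 3.86 1.751 1.5898 0.204 1.3507 (by assumption) (by assumption) ?_ ?_ ?_ ?_ ?_ ?_ ?_ ?_ ?_ ?_ <;>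
    norm_num [expT, Finset.sum_range_succ, Nat.factorial]
  rcases le_total K 4.02 with hb | ha
  · refine H.small 3.86 4.02 1.774 1.674 0.1875 1.3913 (by assumption) (by assumption) ?_ ?_ ?_ ?_ ?_ ?_ ?_ ?_ ?_ ?_ <;>
    norm_num [expT, Finset.sum_range_succ, Nat.factorial]
  rcases le_total K 4.15 with hb | ha
  · refine H.small 4.02 4.15 1.793 1.7411 0.1754 1.4232 (by assumption) (by assumption) ?_ ?_ ?_ ?_ ?_ ?_ ?_ ?_ ?_ ?_ <;>
    norm_num [expT, Finset.sum_range_succ, Nat.factorial]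
  refine H.small 4.15 4.26 1.808 1.7965 0.1659 1.4493 (by assumption) (by assumption) ?_ ?_ ?_ ?_ ?_ ?_ ?_ ?_ ?_ ?_ <;>
    norm_num [expT, Finset.sum_range_succ, Nat.factorial]

lemma upper (ha : 4.26 ≤ K) (hb : K ≤ 176.53) :
    Ent h 0 - Cf h (π / 2) ≥ 1 / (2 * K) * Ent h 0 := by
  rcases le_total K 5.09 with hb | ha
  · refine H.big 4.26 5.09 1.909 1.4493 (by assumption) (by assumption) ?_ ?_ ?_ ?_ ?_ ?_
    iterate 5 norm_num [expT, Finset.sum_range_succ, Nat.factorial]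
    exact fun t ht => by rw [← sub_nonneg]; ring_nf; positivity
  rcases le_total K 5.8 with hb | ha
  · refine H.big 5.09 5.8 1.983 1.6273 (by assumption) (by assumption) ?_ ?_ ?_ ?_ ?_ ?_
    iterate 5 norm_num [expT, Finset.sum_range_succ, Nat.factorial]
    exact fun t ht => by rw [← sub_nonneg]; ring_nf; positivity
  rcases le_total K 6.42 with hb | ha
  · refine H.big 5.8 6.42 2.041 1.7579 (by assumption) (by assumption) ?_ ?_ ?_ ?_ ?_ ?_
    iterate 5 norm_num [expT, Finset.sum_range_succ, Nat.factorial]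
    exact fun t ht => by rw [← sub_nonneg]; ring_nf; positivity
  rcases le_total K 6.98 with hb | ha
  · refine H.big 6.42 6.98 2.088 1.8595 (by assumption) (by assumption) ?_ ?_ ?_ ?_ ?_ ?_
    iterate 5 norm_num [expT, Finset.sum_range_succ, Nat.factorial]
    exact fun t ht => by rw [← sub_nonneg]; ring_nf; positivity
  rcases le_total K 7.5 with hb | ha
  · refine H.big 6.98 7.5 2.128 1.9431 (by assumption) (by assumption) ?_ ?_ ?_ ?_ ?_ ?_
    iterate 5 norm_num [expT, Finset.sum_range_succ, Nat.factorial]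
    exact fun t ht => by rw [← sub_nonneg]; ring_nf; positivity
  rcases le_total K 7.98 with hb | ha
  · refine H.big 7.5 7.98 2.163 2.015 (by assumption) (by assumption) ?_ ?_ ?_ ?_ ?_ ?_
    iterate 5 norm_num [expT, Finset.sum_range_succ, Nat.factorial]
    exact fun t ht => by rw [← sub_nonneg]; ring_nf; positivity
  rcases le_total K 8.45 with hb | ha
  · refine H.big 7.98 8.45 2.195 2.077 (by assumption) (by assumption) ?_ ?_ ?_ ?_ ?_ ?_
    iterate 5 norm_num [expT, Finset.sum_range_succ, Nat.factorial]
    exact fun t ht => by rw [← sub_nonneg]; ring_nf; positivity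
  rcases le_total K 8.92 with hb | ha
  · refine H.big 8.45 8.92 2.225 2.1342 (by assumption) (by assumption) ?_ ?_ ?_ ?_ ?_ ?_
    iterate 5 norm_num [expT, Finset.sum_range_succ, Nat.factorial]
    exact fun t ht => by rw [← sub_nonneg]; ring_nf; positivity
  rcases le_total K 9.4 with hb | ha
  · refine H.big 8.92 9.4 2.254 2.1883 (by assumption) (by assumption) ?_ ?_ ?_ ?_ ?_ ?_
    iterate 5 norm_num [expT, Finset.sum_range_succ, Nat.factorial]
    exact fun t ht => by rw [← sub_nonneg]; ring_nf; positivity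
  rcases le_total K 9.91 with hb | ha
  · refine H.big 9.4 9.91 2.283 2.2408 (by assumption) (by assumption) ?_ ?_ ?_ ?_ ?_ ?_
    iterate 5 norm_num [expT, Finset.sum_range_succ, Nat.factorial]
    exact fun t ht => by rw [← sub_nonneg]; ring_nf; positivity
  rcases le_total K 10.46 with hb | ha
  · refine H.big 9.91 10.46 2.313 2.2936 (by assumption) (by assumption) ?_ ?_ ?_ ?_ ?_ ?_
    iterate 5 norm_num [expT, Finset.sum_range_succ, Nat.factorial]
    exact fun t ht => by rw [← sub_nonneg]; ring_nf; positivity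
  rcases le_total K 11.07 with hb | ha
  · refine H.big 10.46 11.07 2.344 2.3476 (by assumption) (by assumption) ?_ ?_ ?_ ?_ ?_ ?_
    iterate 5 norm_num [expT, Finset.sum_range_succ, Nat.factorial]
    exact fun t ht => by rw [← sub_nonneg]; ring_nf; positivity
  rcases le_total K 11.78 with hb | ha
  · refine H.big 11.07 11.78 2.378 2.4043 (by assumption) (by assumption) ?_ ?_ ?_ ?_ ?_ ?_
    iterate 5 norm_num [expT, Finset.sum_range_succ, Nat.factorial]
    exact fun t ht => by rw [← sub_nonneg]; ring_nf; positivity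
  rcases le_total K 12.64 with hb | ha
  · refine H.big 11.78 12.64 2.416 2.4665 (by assumption) (by assumption) ?_ ?_ ?_ ?_ ?_ ?_
    iterate 5 norm_num [expT, Finset.sum_range_succ, Nat.factorial]
    exact fun t ht => by rw [← sub_nonneg]; ring_nf; positivity
  rcases le_total K 13.73 with hb | ha
  · refine H.big 12.64 13.73 2.461 2.5369 (by assumption) (by assumption) ?_ ?_ ?_ ?_ ?_ ?_
    iterate 5 norm_num [expT, Finset.sum_range_succ, Nat.factorial]
    exact fun t ht => by rw [← sub_nonneg]; ring_nf; positivity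
  rcases le_total K 15.18 with hb | ha
  · refine H.big 13.73 15.18 2.515 2.6196 (by assumption) (by assumption) ?_ ?_ ?_ ?_ ?_ ?_
    iterate 5 norm_num [expT, Finset.sum_range_succ, Nat.factorial]
    exact fun t ht => by rw [← sub_nonneg]; ring_nf; positivity
  rcases le_total K 17.28 with hb | ha
  · refine H.big 15.18 17.28 2.584 2.72 (by assumption) (by assumption) ?_ ?_ ?_ ?_ ?_ ?_
    iterate 5 norm_num [expT, Finset.sum_range_succ, Nat.factorial]
    exact fun t ht => by rw [← sub_nonneg]; ring_nf; positivity
  rcases le_total K 20.69 with hb | ha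
  · refine H.big 17.28 20.69 2.679 2.8496 (by assumption) (by assumption) ?_ ?_ ?_ ?_ ?_ ?_
    iterate 5 norm_num [expT, Finset.sum_range_succ, Nat.factorial]
    exact fun t ht => by rw [← sub_nonneg]; ring_nf; positivity
  rcases le_total K 27.22 with hb | ha
  · refine H.big 20.69 27.22 2.821 3.0297 (by assumption) (by assumption) ?_ ?_ ?_ ?_ ?_ ?_
    iterate 5 norm_num [expT, Finset.sum_range_succ, Nat.factorial]
    exact fun t ht => by rw [← sub_nonneg]; ring_nf; positivity
  rcases le_total K 44.14 with hb | ha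
  · refine H.big 27.22 44.14 3.064 3.304 (by assumption) (by assumption) ?_ ?_ ?_ ?_ ?_ ?_
    iterate 5 norm_num [expT, Finset.sum_range_succ, Nat.factorial]
    exact fun t ht => by rw [← sub_nonneg]; ring_nf; positivity
  rcases le_total K 88.27 with hb | ha
  · refine H.big 44.14 88.27 3.397 3.7874 (by assumption) (by assumption) ?_ ?_ ?_ ?_ ?_ ?_
    iterate 5 norm_num [expT, Finset.sum_range_succ, Nat.factorial]
    exact fun t ht => by rw [← sub_nonneg]; ring_nf; positivity
  refine H.big 88.27 176.53 3.711 4.4805 (by assumption) (by assumption) ?_ ?_ ?_ ?_ ?_ ?_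
  iterate 5 norm_num [expT, Finset.sum_range_succ, Nat.factorial]
  exact fun t ht => by rw [← sub_nonneg]; ring_nf; positivity
end Adm

lemma log_ub (x : ℝ) (hx : 1 ≤ x) : log x ≤ (x - x⁻¹) / 2 := by
  have := mono_aux (fun x => (x - x⁻¹) / 2 - log x) (fun x => (1 - -(x ^ 2)⁻¹) / 2 - x⁻¹) 1 x hx
    (fun y hy => by
      have hy0 : y ≠ 0 := by linarith [hy.1]
      exact (((hasDerivAt_id y).sub (hasDerivAt_inv hy0)).div_const 2).sub (hasDerivAt_log hy0))
    (fun y hy => by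
      have hy0 : 0 < y := by linarith [hy.1]
      have : (1 - -(y ^ 2)⁻¹) / 2 - y⁻¹ = (y - 1) ^ 2 / (2 * y ^ 2) := by
        field_simp
        ring
      rw [this]
      positivity)
  simp at this
  linarith

namespace Adm
variable {h : ℝ → ℝ} {K : ℝ} (H : Adm h K)
include H

lemma lower (hb : K ≤ 1.6) : Ent h 0 - Cf h (π / 2) ≥ 1 / (2 * K) * Ent h 0 := by
  have hK := H.one_le
  have hK0 : 0 < K := by linarith
  set G := 1 + 0.484 * (K ^ 2 - 1) with hGd
  have hG : 1 ≤ G := by nlinarith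
  have hM : (K ^ 2 - 1) * ∫ z, max (z ^ 2 - G) 0 ∂gam ≤ G - 1 := by
    have h1 : ∫ z, max (z ^ 2 - G) 0 ∂gam ≤ ∫ z, max (z ^ 2 - 1 ^ 2) 0 ∂gam := by
      refine integral_mono_of_nonneg (ae_of_all _ fun z => le_max_right _ _) ?_
        (ae_of_all _ fun z => max_le_max (by linarith) le_rfl)
      exact ((gam_pow_integrable 2).sub (integrable_const _)).pos_part
    have h2 := mills 1 le_rfl
    have h3 := gaussPDF_ub 1 1.6487 (by norm_num) ((show (1.6487:ℝ) ≤ expT (1 ^ 2 / 2) by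
      norm_num [expT, Finset.sum_range_succ, Nat.factorial]).trans (expT_le _ (by norm_num)))
    have h4 : ∫ z, max (z ^ 2 - G) 0 ∂gam ≤ 0.484 := by
      norm_num at h2 h3 h1 ⊢
      linarith
    nlinarith
  set r := (K - 1) ^ 2 / K with hr
  have hr0 : 0 ≤ r := by positivity
  have hV : exp (-r) ≤ 1 / (1 + r + r ^ 2 / 2) := by
    rw [exp_neg, one_div]
    exact inv_anti₀ (by positivity) (quadratic_le_exp_of_nonneg hr0)
  refine H.smallGen G r _ hG hr0 hM ?_ hV ?_
  · have h1 := log_ub K hK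
    have h2 : 0 ≤ (K - 1) / (K + 1) := div_nonneg (by linarith) (by linarith)
    calc _ ≤ 2 * ((K - K⁻¹) / 2 * ((K - 1) / (K + 1))) := by gcongr
      _ = r := by rw [hr]; field_simp; ring
  · have hT : 0 < 1 + r + r ^ 2 / 2 := by positivity
    have key : (2 * G + 1) * (1 + r + r ^ 2 / 2) + 1 ≤ 4 * K * (1 + r / 2) := by
      have hrK : r * K = (K - 1) ^ 2 := by rw [hr]; field_simp
      have hr1 : r ≤ (K - 1) ^ 2 := by rw [← hrK]; nlinarith
      have hr2 : r ≤ 0.375 * (K - 1) := by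
        rw [hr, div_le_iff₀ hK0]; nlinarith
      have h6 : r ^ 2 / 2 ≤ 0.12 * r := by nlinarith
      have h5 : (2 * G + 1) * (1 + r + r ^ 2 / 2) ≤ (2 * G + 1) * (1 + 1.12 * r) := by
        apply mul_le_mul_of_nonneg_left <;> linarith
      nlinarith
    have e : 4 * K * (1 - 1 / (1 + r + r ^ 2 / 2)) - r * (2 * G + 1 + 1 / (1 + r + r ^ 2 / 2))
        = r * (4 * K * (1 + r / 2) - ((2 * G + 1) * (1 + r + r ^ 2 / 2) + 1)) / (1 + r + r ^ 2 / 2) := by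
      field_simp
      ring
    have : 0 ≤ r * (4 * K * (1 + r / 2) - ((2 * G + 1) * (1 + r + r ^ 2 / 2) + 1)) / (1 + r + r ^ 2 / 2) :=
      div_nonneg (mul_nonneg hr0 (by linarith)) hT.le
    linarith

lemma tail (hb : 100 ≤ K) : Ent h 0 - Cf h (π / 2) ≥ 1 / (2 * K) * Ent h 0 := by
  have hK := H.one_le
  have hK0 : 0 < K := by linarith
  set L := log K with hL
  have hexpL : exp L = K := exp_log hK0
  have hL4 : 4.6 ≤ L := by
    rw [hL, le_log_iff_exp_le hK0]
    have h10 : exp 4.6 = exp 0.92 ^ 5 := by rw [← exp_nat_mul]; norm_num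
    have h1 : exp 0.92 ≤ 2.511 := by
      have := exp_bound' (x := 0.92) (by norm_num) (by norm_num) (n := 8) (by norm_num)
      refine this.trans ?_
      norm_num [Finset.sum_range_succ, Nat.factorial]
    rw [h10]
    calc exp 0.92 ^ 5 ≤ 2.511 ^ 5 := by gcongr
      _ ≤ 100 := by norm_num
      _ ≤ K := hb
  set s := √K with hs
  have hs2 : s ^ 2 = K := sq_sqrt hK0.le
  have hs10 : 10 ≤ s := by
    apply le_sqrt_of_sq_le
    linarith
  have hLs : L ≤ s / 5 + 2.6054 := by
    have h1 : L = 2 * log s := by rw [hL, ← hs2, log_pow]; push_cast; ring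
    have h2 := log_le_sub_one_of_pos (show 0 < s / 10 by positivity)
    rw [log_div (by positivity) (by norm_num)] at h2
    have h3 : log 10 ≤ 2.3027 := by
      rw [log_le_iff_le_exp (by norm_num)]
      refine le_trans ?_ (expT_le _ (by norm_num))
      norm_num [expT, Finset.sum_range_succ, Nat.factorial]
    linarith
  have hl2 : √(4 * L) ^ 2 = 4 * L := sq_sqrt (by linarith)
  have hl1 : 1 ≤ √(4 * L) := by
    apply le_sqrt_of_sq_le
    linarith
  have hM := millsK K K (√(4 * L)) (K ^ 2) hK le_rfl hl1 (by positivity)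
    (by rw [hl2, show 4 * L / 2 = (2:ℕ) * L by push_cast; ring, exp_nat_mul, hexpL])
    (by
      have h1 : (K ^ 2 - 1) * (4 * √(4 * L) * 0.39895) ≤ K ^ 2 * (4 * √(4 * L) * 0.39895) := by
        gcongr; linarith
      have h2 : 4 * √(4 * L) * 0.39895 ≤ (√(4 * L) ^ 2 - 1) * (√(4 * L) ^ 2 + 1) := by
        rw [hl2]
        have : √(4 * L) ≤ √(4 * L) ^ 2 := by nlinarith
        rw [hl2] at this
        nlinarith
      nlinarith [sq_nonneg K])
  rw [hl2] at hM
  refine H.bigGen (4 * L) L (by linarith) (by linarith) le_rfl hM ?_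
  set G := 4 * L with hG
  have hG18 : 18 ≤ G := by linarith
  have b1 : G * K * (K + 1) + (K - 1) * (G - 1) * (1 + G * K - 2 * K) ≤ G * (G * K * (K + 1)) := by
    nlinarith [mul_pos (show 0 < G by linarith) hK0, mul_pos hK0 hK0]
  have b2 : 17 / 18 * (1 + K + 2 * G * K) ≤ 2 * G * K - K + 3 := by
    nlinarith [mul_pos (show 0 < G by linarith) hK0]
  have b3 : L * G ≤ 17 / 18 * (K - 1) := by
    rw [hG, ← hs2]
    nlinarith
  have hP : 0 ≤ G * K * (K + 1) := by positivity
  have hA : 0 ≤ 1 + K + 2 * G * K := by positivity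
  calc _ ≤ L * ((1 + K + 2 * G * K) * (G * (G * K * (K + 1)))) := by gcongr
    _ = (L * G) * (1 + K + 2 * G * K) * (G * K * (K + 1)) := by ring
    _ ≤ (17 / 18 * (K - 1)) * (1 + K + 2 * G * K) * (G * K * (K + 1)) := by gcongr
    _ = (K - 1) * (17 / 18 * (1 + K + 2 * G * K)) * (G * K * (K + 1)) := by ring
    _ ≤ _ := by
      gcongr

lemma final : Ent h 0 - Cf h (π / 2) ≥ 1 / (2 * K) * Ent h 0 := by
  rcases le_total K 1.6 with h1 | h1
  · exact H.lower h1
  rcases le_total K 4.26 with h2 | h2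
  · exact H.mid h1 h2
  rcases le_total K 176.53 with h3 | h3
  · exact H.upper h2 h3
  exact H.tail (by linarith)
end Adm


/-- Optimal entropy production, sandwiched case: if `ρ` is a smooth
normalized density with finite entropy and relative Fisher information and
`1/K ≤ ρ/g ≤ K`, then `S(ρ⊛ρ) - S(ρ) ≥ (1/(2K)) D(ρ)`. -/
theorem entropy_production_sandwiched (ρ : ℝ → ℝ) (K : ℝ) (hK : 1 ≤ K)
    (hsmooth : ContDiff ℝ (⊤ : ℕ∞) ρ) (hpos : ∀ x, 0 ≤ ρ x)
    (hmass : ∫ x, ρ x = 1) (hmean : ∫ x, x * ρ x = 0) (hvar : ∫ x, x ^ 2 * ρ x = 1)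
    (hent : Integrable fun x => ρ x * Real.log (ρ x))
    (hJ : Integrable fun x =>
      (deriv (fun y => Real.sqrt (ρ y)) x + (x / 2) * Real.sqrt (ρ x)) ^ 2)
    (hsand : ∀ x, gaussPDF x / K ≤ ρ x ∧ ρ x ≤ K * gaussPDF x) :
    entropy (selfConv ρ) - entropy ρ ≥ (1 / (2 * K)) * relEntropy ρ := by
  obtain ⟨H, hρ⟩ := adm_of ρ K hK hsmooth.continuous hmass hmean hvar hsand
  rw [H.production ρ hρ, H.relEntropy_eq ρ hρ]
  exact H.final
end
end

section
/- Let ρ be a probability density on ℝ with mean zero, unit variance, finite Fisher information I(ρ) < ∞, and finite third absolute moment. For N = 2ⁿ let ρ_N denote the density of N^{−1/2}(X₁ + ⋯ + X_N) for i.i.d. X_j with density ρ. Then there exists a constant c (depending on ρ) such that for all n and all R > 0: ∫_{|x| < R} |ρ_N(x) − g(x)| dx ≤ c R 2^{−n/2} and ∫_{|x| < R} |ρ_N(x)/g(x) − 1| dx ≤ c R e^{R²/2} 2^{−n/2}. -/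
open MeasureTheory Real Set

noncomputable section

open scoped FourierTransform Convolution Topology
open Filter

lemma aux_iter (ρ : ℝ → ℝ) (hc : Continuous ρ) (B : ℝ) (hb : ∀ x, |ρ x| ≤ B)
    (hi : Integrable ρ) (k : ℕ) :
    Continuous (fun x => (iterConv ρ k x : ℂ)) ∧ Integrable (fun x => (iterConv ρ k x : ℂ)) ∧
    ∀ ξ, 𝓕 (fun x => (iterConv ρ k x : ℂ)) ξ = (𝓕 (fun x => (ρ x : ℂ)) ξ) ^ (k + 1) := by
  induction k with
  | zero => 
    refine ⟨by simp only [iterConv]; fun_prop, hi.ofReal, fun ξ => by simp [iterConv]⟩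
  | succ k ih =>
    obtain ⟨h1, h2, h3⟩ := ih
    have e : (fun x => (iterConv ρ (k + 1) x : ℂ)) =
        (fun x => (iterConv ρ k x : ℂ)) ⋆[ContinuousLinearMap.mul ℂ ℂ] (fun x => (ρ x : ℂ)) := by
      ext x
      have := convolution_mul_swap (𝕜 := ℂ) (μ := volume) (f := fun x => (iterConv ρ k x : ℂ))
        (g := fun x => (ρ x : ℂ)) (x := x)
      rw [this]
      simp only [iterConv, convDens]
      rw [← integral_complex_ofReal]
      simp
    rw [e]
    have hr : Integrable (fun x => (ρ x : ℂ)) := hi.ofReal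
    refine ⟨?_, ?_, fun ξ => ?_⟩
    · refine BddAbove.continuous_convolution_right_of_integrable _ ?_ h2 (by fun_prop)
      refine ⟨B, ?_⟩
      rintro _ ⟨x, rfl⟩
      simpa using hb x
    · exact h2.integrable_convolution _ hr
    · rw [Real.fourier_mul_convolution_eq h2 hr, h3]; ring

lemma aux_taylor (u : ℝ) :
    ‖Complex.exp (u * Complex.I) - (1 + u * Complex.I - u ^ 2 / 2)‖ ≤ 4 * |u| ^ 3 := by
  have hn : ‖(u * Complex.I : ℂ)‖ = |u| := by simp
  rcases le_total |u| 1 with h | h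
  · have := Complex.exp_bound (x := u * Complex.I) (by rw [hn]; exact h) (n := 3) (by norm_num)
    rw [hn] at this
    have e : ∑ m ∈ Finset.range 3, (u * Complex.I : ℂ) ^ m / (m.factorial : ℂ)
        = 1 + u * Complex.I - u ^ 2 / 2 := by
      simp [Finset.sum_range_succ, Nat.factorial, mul_pow]
      ring
    rw [e] at this
    refine this.trans ?_
    norm_num [Nat.factorial]
    nlinarith [pow_nonneg (abs_nonneg u) 3]
  · have h1 : ‖Complex.exp (u * Complex.I)‖ = 1 := Complex.norm_exp_ofReal_mul_I u
    have h2 : ‖(u ^ 2 / 2 : ℂ)‖ = |u| ^ 2 / 2 := by simp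
    calc _ ≤ ‖Complex.exp (u * Complex.I)‖ + (‖(1 : ℂ)‖ + ‖(u * Complex.I : ℂ)‖ + ‖(u ^ 2 / 2 : ℂ)‖) := by
          refine (norm_sub_le _ _).trans ?_
          gcongr
          refine (norm_sub_le _ _).trans ?_
          gcongr
          exact norm_add_le _ _
      _ ≤ _ := by
          rw [h1, hn, h2, norm_one]
          nlinarith [pow_le_pow_right₀ h (show 1 ≤ 3 by norm_num),
            pow_le_pow_right₀ h (show 2 ≤ 3 by norm_num), pow_le_pow_right₀ h (show 0 ≤ 3 by norm_num)]

lemma aux_pow {x y : ℂ} {r : ℝ} (hx : ‖x‖ ≤ r) (hy : ‖y‖ ≤ r) (n : ℕ) :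
    ‖x ^ (n + 1) - y ^ (n + 1)‖ ≤ (n + 1) * ‖x - y‖ * r ^ n := by
  have hr : 0 ≤ r := (norm_nonneg _).trans hx
  induction n with
  | zero => simp
  | succ n ih =>
    have e : x ^ (n + 1 + 1) - y ^ (n + 1 + 1) = x * (x ^ (n + 1) - y ^ (n + 1)) + (x - y) * y ^ (n + 1) := by
      ring
    rw [e]
    calc _ ≤ ‖x‖ * ‖x ^ (n + 1) - y ^ (n + 1)‖ + ‖x - y‖ * ‖y‖ ^ (n + 1) := by
          refine (norm_add_le _ _).trans ?_
          simp
      _ ≤ r * ((n + 1) * ‖x - y‖ * r ^ n) + ‖x - y‖ * r ^ (n + 1) := by gcongr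
      _ = _ := by push_cast; ring

lemma aux_ptwise (F : ℝ → ℂ) (a K : ℝ) (ha : 0 < a) (hK : 0 ≤ K)
    (hF : ∀ ξ, ‖F ξ - ((1 - a * ξ ^ 2 : ℝ) : ℂ)‖ ≤ K * |ξ| ^ 3)
    (hq : ∀ δ : ℝ, 0 < δ → ∃ q : ℝ, q < 1 ∧ ∀ ξ, δ ≤ |ξ| → ‖F ξ‖ ≤ q) :
    ∃ A q : ℝ, 0 ≤ A ∧ 0 ≤ q ∧ q < 1 ∧ ∀ (m : ℕ) (ξ : ℝ),
      ‖F ξ ^ (m + 2) - ((Real.exp (-a * ((m + 2 : ℕ) : ℝ) * ξ ^ 2) : ℝ) : ℂ)‖ ≤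
        A * (((m + 2 : ℕ) : ℝ) * |ξ| ^ 3 * Real.exp (-(a / 4) * ((m + 2 : ℕ) : ℝ) * ξ ^ 2))
          + q ^ m * ‖F ξ‖ ^ 2 := by
  obtain ⟨δ, hδ, h1, h2, h3⟩ : ∃ δ : ℝ, 0 < δ ∧ δ ≤ 1 ∧ a * δ ≤ 1 ∧ K * δ ≤ a / 2 := by
    refine ⟨min 1 (min (1 / a) (a / (2 * (K + 1)))), by positivity, min_le_left _ _, ?_, ?_⟩
    · calc _ ≤ a * (1 / a) := by gcongr; exact (min_le_right _ _).trans (min_le_left _ _)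
        _ = 1 := by field_simp
    · calc _ ≤ (K + 1) * (a / (2 * (K + 1))) := by
            gcongr
            · linarith
            · exact (min_le_right _ _).trans (min_le_right _ _)
        _ = _ := by field_simp
  obtain ⟨q, hq1, hq2⟩ := hq δ hδ
  have hq0 : 0 ≤ q := (norm_nonneg _).trans (hq2 δ (le_abs_self δ))
  refine ⟨K + a ^ 2 + 1 / δ ^ 3, q, by positivity, hq0, hq1, fun m ξ => ?_⟩
  set t := |ξ| with ht
  have ht0 : 0 ≤ t := abs_nonneg _
  have hsq : ξ ^ 2 = t ^ 2 := (sq_abs ξ).symm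
  rw [hsq]
  have hM : ((m + 2 : ℕ) : ℝ) = (m : ℝ) + 2 := by push_cast; ring
  rcases le_total t δ with h | h
  · have hFx := hF ξ
    rw [hsq] at hFx
    have hat : a * t ^ 2 ≤ 1 := by nlinarith
    have hr1 : ‖F ξ‖ ≤ Real.exp (-(a * t ^ 2 / 2)) := by
      have e1 : ‖((1 - a * t ^ 2 : ℝ) : ℂ)‖ = 1 - a * t ^ 2 := by
        rw [Complex.norm_real, Real.norm_eq_abs, abs_of_nonneg (by linarith)]
      have e2 : ‖F ξ‖ ≤ ‖F ξ - ((1 - a * t ^ 2 : ℝ) : ℂ)‖ + ‖((1 - a * t ^ 2 : ℝ) : ℂ)‖ := by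
        have := norm_add_le (F ξ - ((1 - a * t ^ 2 : ℝ) : ℂ)) ((1 - a * t ^ 2 : ℝ) : ℂ)
        rwa [sub_add_cancel] at this
      have e3 : K * t ^ 3 ≤ a / 2 * t ^ 2 := by
        have : K * t ≤ a / 2 := (mul_le_mul_of_nonneg_left h hK).trans h3
        calc K * t ^ 3 = (K * t) * t ^ 2 := by ring
          _ ≤ _ := by gcongr
      have := Real.add_one_le_exp (-(a * t ^ 2 / 2))
      linarith
    set y : ℝ := Real.exp (-(a * t ^ 2)) with hy
    have hr2 : ‖(y : ℂ)‖ ≤ Real.exp (-(a * t ^ 2 / 2)) := by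
      rw [Complex.norm_real, Real.norm_eq_abs, abs_of_nonneg (Real.exp_pos _).le]
      apply Real.exp_le_exp.2
      nlinarith [mul_nonneg ha.le (sq_nonneg t)]
    have hyp : ((Real.exp (-a * ((m + 2 : ℕ) : ℝ) * t ^ 2) : ℝ) : ℂ) = (y : ℂ) ^ (m + 2) := by
      rw [← Complex.ofReal_pow, hy, ← Real.exp_nat_mul]
      congr 2
      ring
    rw [hyp]
    have hd : ‖F ξ - y‖ ≤ (K + a ^ 2) * t ^ 3 := by
      have e1 : ‖(((1 - a * t ^ 2 : ℝ) : ℂ) - y)‖ ≤ a ^ 2 * t ^ 3 := by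
        rw [← Complex.ofReal_sub, Complex.norm_real, Real.norm_eq_abs, abs_sub_comm]
        have := Real.abs_exp_sub_one_sub_id_le (x := -(a * t ^ 2))
          (by rw [abs_neg, abs_of_nonneg (by positivity)]; exact hat)
        rw [show y - (1 - a * t ^ 2) = Real.exp (-(a * t ^ 2)) - 1 - -(a * t ^ 2) by rw [hy]; ring]
        refine this.trans ?_
        calc (-(a * t ^ 2)) ^ 2 = a ^ 2 * (t ^ 3 * t) := by ring
          _ ≤ a ^ 2 * (t ^ 3 * 1) := by gcongr; linarith
          _ = _ := by ring
      calc ‖F ξ - y‖ = ‖(F ξ - ((1 - a * t ^ 2 : ℝ) : ℂ)) + (((1 - a * t ^ 2 : ℝ) : ℂ) - y)‖ := by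
            congr 1; ring
        _ ≤ _ := norm_add_le _ _
        _ ≤ K * t ^ 3 + a ^ 2 * t ^ 3 := add_le_add hFx e1
        _ = _ := by ring
    have hp := aux_pow hr1 hr2 (m + 1)
    have hre : Real.exp (-(a * t ^ 2 / 2)) ^ (m + 1) ≤
        Real.exp (-(a / 4) * ((m + 2 : ℕ) : ℝ) * t ^ 2) := by
      rw [← Real.exp_nat_mul]
      apply Real.exp_le_exp.2
      push_cast
      have : 0 ≤ a * t ^ 2 * m := by positivity
      nlinarith
    have hfin : ‖F ξ ^ (m + 2) - (y : ℂ) ^ (m + 2)‖ ≤ (K + a ^ 2) * (((m + 2 : ℕ) : ℝ) * t ^ 3 *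
        Real.exp (-(a / 4) * ((m + 2 : ℕ) : ℝ) * t ^ 2)) := by
      refine hp.trans ?_
      calc _ ≤ (((m + 1 : ℕ) : ℝ) + 1) * ((K + a ^ 2) * t ^ 3) *
            Real.exp (-(a / 4) * ((m + 2 : ℕ) : ℝ) * t ^ 2) := by gcongr
        _ = _ := by push_cast; ring
    refine hfin.trans ?_
    have p1 : 0 ≤ q ^ m * ‖F ξ‖ ^ 2 := by positivity
    have p2 : 0 ≤ 1 / δ ^ 3 * (((m + 2 : ℕ) : ℝ) * t ^ 3 *
        Real.exp (-(a / 4) * ((m + 2 : ℕ) : ℝ) * t ^ 2)) := by positivity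
    linarith
  · refine (norm_sub_le _ _).trans ?_
    rw [add_comm]
    apply add_le_add
    · rw [Complex.norm_real, Real.norm_eq_abs, abs_of_nonneg (Real.exp_pos _).le]
      have e1 : Real.exp (-a * ((m + 2 : ℕ) : ℝ) * t ^ 2) ≤
          Real.exp (-(a / 4) * ((m + 2 : ℕ) : ℝ) * t ^ 2) := by
        apply Real.exp_le_exp.2
        have : 0 ≤ a * ((m + 2 : ℕ) : ℝ) * t ^ 2 := by positivity
        linarith
      have e2 : 1 ≤ (K + a ^ 2 + 1 / δ ^ 3) * (((m + 2 : ℕ) : ℝ) * t ^ 3) := by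
        have e3 : δ ^ 3 ≤ t ^ 3 := by gcongr
        have e4 : 1 ≤ 1 / δ ^ 3 * t ^ 3 := by
          rw [one_div, inv_mul_eq_div, le_div_iff₀ (by positivity)]; linarith
        have e5 : (1 : ℝ) ≤ ((m + 2 : ℕ) : ℝ) := by rw [hM]; linarith [Nat.cast_nonneg (α := ℝ) m]
        calc (1 : ℝ) ≤ 1 / δ ^ 3 * t ^ 3 := e4
          _ ≤ (K + a ^ 2 + 1 / δ ^ 3) * (1 * t ^ 3) := by
            rw [one_mul]; gcongr; nlinarith
          _ ≤ _ := by gcongr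
      calc _ ≤ 1 * Real.exp (-(a / 4) * ((m + 2 : ℕ) : ℝ) * t ^ 2) := by rw [one_mul]; exact e1
        _ ≤ _ := by
          rw [← mul_assoc]
          gcongr
    · rw [norm_pow, pow_add]
      gcongr
      exact hq2 ξ h

lemma aux_qbound (q : ℝ) (h0 : 0 ≤ q) (h1 : q < 1) :
    ∃ D : ℝ, ∀ m : ℕ, q ^ m ≤ D / ((m + 2 : ℕ) : ℝ) := by
  obtain ⟨D, hD⟩ := (tendsto_self_mul_const_pow_of_lt_one h0 h1).bddAbove_range
  refine ⟨D + 2, fun m => ?_⟩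
  have := hD ⟨m, rfl⟩
  have h2 := pow_le_one₀ h0 h1.le (n := m)
  rw [le_div_iff₀ (by positivity)]
  push_cast
  simp only at this
  linarith

lemma aux_gint (c : ℝ) (hc : 0 < c) :
    Integrable (fun x : ℝ => |x| ^ 3 * Real.exp (-c * x ^ 2)) := by
  have h := (integrable_rpow_mul_exp_neg_mul_sq hc (s := 3) (by norm_num)).norm
  refine h.congr (Eventually.of_forall fun x => ?_)
  have : x ^ (3 : ℝ) = x ^ 3 := by exact_mod_cast Real.rpow_natCast x 3
  simp [this]

lemma aux_gscale (c : ℝ) (hc : 0 < c) (N : ℕ) (hN : 0 < N) :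
    Integrable (fun x : ℝ => (N : ℝ) * |x| ^ 3 * Real.exp (-c * N * x ^ 2)) ∧
    ∫ x : ℝ, (N : ℝ) * |x| ^ 3 * Real.exp (-c * N * x ^ 2) =
      (∫ x : ℝ, |x| ^ 3 * Real.exp (-c * x ^ 2)) / N := by
  have hs : 0 < √(N : ℝ) := Real.sqrt_pos.2 (by exact_mod_cast hN)
  have hs2 : √(N : ℝ) ^ 2 = N := Real.sq_sqrt (by positivity)
  have e : (fun x : ℝ => (N : ℝ) * |x| ^ 3 * Real.exp (-c * N * x ^ 2)) =
      fun x => (√(N : ℝ))⁻¹ * (|√(N : ℝ) * x| ^ 3 * Real.exp (-c * (√(N : ℝ) * x) ^ 2)) := by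
    ext x
    rw [abs_mul, abs_of_pos hs, mul_pow, mul_pow, hs2]
    field_simp
    rw [hs2]
    ring_nf
  rw [e]
  constructor
  · exact ((aux_gint c hc).comp_mul_left' hs.ne').const_mul _
  · rw [integral_const_mul, Measure.integral_comp_mul_left
      (fun x => |x| ^ 3 * Real.exp (-c * x ^ 2)), abs_of_pos (by positivity), smul_eq_mul]
    rw [← mul_assoc, ← mul_inv, ← sq, hs2]
    ring

lemma aux_reg (ρ : ℝ → ℝ) (hpos : ∀ x, 0 ≤ ρ x) (hi : Integrable ρ) (hmass : ∫ x, ρ x = 1)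
    (hdiff : Differentiable ℝ fun x => Real.sqrt (ρ x))
    (hI : Integrable fun x => (deriv (fun y => Real.sqrt (ρ y)) x) ^ 2) :
    Differentiable ℝ ρ ∧ Integrable (deriv ρ) ∧ ∃ B : ℝ, ∀ x, |ρ x| ≤ B := by
  have hd : ∀ x, HasDerivAt ρ (2 * √(ρ x) * deriv (fun y => √(ρ y)) x) x := by
    intro x
    have h := ((hdiff x).hasDerivAt).pow 2
    have e : (fun y => √(ρ y)) ^ 2 = ρ := by
      ext y; simp [Real.sq_sqrt (hpos y)]
    rw [e] at h
    simpa using h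
  have hD : Differentiable ℝ ρ := fun x => (hd x).differentiableAt
  have hDi : Integrable (deriv ρ) := by
    refine (hi.add hI).mono' (measurable_deriv ρ).aestronglyMeasurable
      (Eventually.of_forall fun x => ?_)
    rw [(hd x).deriv, Real.norm_eq_abs, abs_mul, abs_mul, abs_two, abs_of_nonneg (Real.sqrt_nonneg _)]
    have := Real.sq_sqrt (hpos x)
    simp only [Pi.add_apply]
    rw [← sq_abs (deriv (fun y => √(ρ y)) x)]
    nlinarith [sq_nonneg (√(ρ x) - |deriv (fun y => √(ρ y)) x|)]
  refine ⟨hD, hDi, 1 + ∫ x, ‖deriv ρ x‖, fun b => ?_⟩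
  rw [abs_of_nonneg (hpos b)]
  set C := ∫ x, ‖deriv ρ x‖
  have key : ∀ a, ρ b ≤ ρ a + C := by
    intro a
    have h := intervalIntegral.integral_eq_sub_of_hasDerivAt (a := a) (b := b)
      (fun x _ => (hD x).hasDerivAt) hDi.intervalIntegrable
    have h2 := intervalIntegral.norm_integral_le_integral_norm_uIoc (f := deriv ρ) (a := a) (b := b)
      (μ := volume)
    have h3 : ∫ x in uIoc a b, ‖deriv ρ x‖ ≤ C :=
      setIntegral_le_integral hDi.norm (Eventually.of_forall fun x => norm_nonneg _)
    rw [h, Real.norm_eq_abs] at h2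
    linarith [le_abs_self (ρ b - ρ a)]
  have h1 : ∫ x in Ioc (0 : ℝ) 1, (ρ b - C) ≤ ∫ x in Ioc (0 : ℝ) 1, ρ x := by
    apply setIntegral_mono_on
    · simp
    · exact hi.integrableOn
    · exact measurableSet_Ioc
    · intro x _; linarith [key x]
  have h2 : ∫ x in Ioc (0 : ℝ) 1, ρ x ≤ 1 := by
    rw [← hmass]
    exact setIntegral_le_integral hi (Eventually.of_forall hpos)
  simp at h1
  linarith

lemma aux_Ftaylor (ρ : ℝ → ℝ) (hpos : ∀ x, 0 ≤ ρ x) (hi : Integrable ρ)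
    (hmass : ∫ x, ρ x = 1)
    (hmean : ∫ x, x * ρ x = 0) (hvar : ∫ x, x ^ 2 * ρ x = 1)
    (hmom3 : Integrable fun x => |x| ^ 3 * ρ x) :
    ∃ K : ℝ, 0 ≤ K ∧ ∀ ξ, ‖𝓕 (fun x => (ρ x : ℂ)) ξ - ((1 - (2 * π ^ 2) * ξ ^ 2 : ℝ) : ℂ)‖ ≤ K * |ξ| ^ 3 := by
  have hi2 : Integrable fun x => x ^ 2 * ρ x := by
    by_contra h
    rw [integral_undef h] at hvar
    norm_num at hvar
  have hi1 : Integrable fun x => x * ρ x := by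
    refine (hi.add hi2).mono' (by have := hi.1; fun_prop) (Eventually.of_forall fun x => ?_)
    rw [norm_mul, Real.norm_eq_abs, Real.norm_eq_abs, abs_of_nonneg (hpos x), Pi.add_apply,
      ← one_add_mul, ← sq_abs]
    exact mul_le_mul_of_nonneg_right (by nlinarith [sq_nonneg (|x| - 1)]) (hpos x)
  refine ⟨4 * (2 * π) ^ 3 * ∫ x, |x| ^ 3 * ρ x, ?_, fun ξ => ?_⟩
  · have : 0 ≤ ∫ x, |x| ^ 3 * ρ x := integral_nonneg fun x => mul_nonneg (by positivity) (hpos x)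
    positivity
  rw [Real.fourier_real_eq_integral_exp_smul]
  set c : ℝ := -2 * π * ξ with hc
  have e1 : ((1 - (2 * π ^ 2) * ξ ^ 2 : ℝ) : ℂ) =
      ∫ x : ℝ, ((ρ x : ℂ) + (c * Complex.I) * ((x * ρ x : ℝ) : ℂ)
        + (-c ^ 2 / 2) * ((x ^ 2 * ρ x : ℝ) : ℂ)) := by
    rw [integral_add, integral_add, integral_const_mul, integral_const_mul,
      integral_complex_ofReal, integral_complex_ofReal, integral_complex_ofReal, hmass, hmean, hvar]
    · rw [hc]; push_cast; ring
    · exact hi.ofReal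
    · exact hi1.ofReal.const_mul _
    · exact hi.ofReal.add (hi1.ofReal.const_mul _)
    · exact hi2.ofReal.const_mul _
  have hintA : Integrable fun x : ℝ => ((ρ x : ℂ) + (c * Complex.I) * ((x * ρ x : ℝ) : ℂ)
        + (-c ^ 2 / 2) * ((x ^ 2 * ρ x : ℝ) : ℂ)) :=
    (hi.ofReal.add (hi1.ofReal.const_mul _)).add (hi2.ofReal.const_mul _)
  have hintB : Integrable fun x : ℝ => Complex.exp (↑(-2 * π * x * ξ) * Complex.I) • (ρ x : ℂ) := by
    refine hi.mono' ?_ (Eventually.of_forall fun x => ?_)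
    · have hcz : Continuous fun x : ℝ => Complex.exp (↑(-2 * π * x * ξ) * Complex.I) := by fun_prop
      exact hcz.aestronglyMeasurable.smul hi.ofReal.1
    · rw [norm_smul, Complex.norm_exp_ofReal_mul_I, one_mul, Complex.norm_real, Real.norm_eq_abs,
        abs_of_nonneg (hpos x)]
  rw [e1, ← integral_sub hintB hintA, ← integral_const_mul, ← integral_mul_const]
  refine norm_integral_le_of_norm_le ((hmom3.const_mul _).mul_const _)
    (Eventually.of_forall fun x => ?_)
  have ht := aux_taylor (c * x)
  have e2 : Complex.exp (↑(-2 * π * x * ξ) * Complex.I) • (ρ x : ℂ) -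
      ((ρ x : ℂ) + (c * Complex.I) * ((x * ρ x : ℝ) : ℂ) + (-c ^ 2 / 2) * ((x ^ 2 * ρ x : ℝ) : ℂ))
      = (Complex.exp (((c * x : ℝ) : ℂ) * Complex.I) - (1 + ((c * x : ℝ) : ℂ) * Complex.I - ((c * x : ℝ) : ℂ) ^ 2 / 2)) * (ρ x : ℂ) := by
    rw [show -2 * π * x * ξ = c * x by rw [hc]; ring]
    push_cast
    rw [smul_eq_mul]
    ring
  rw [e2, norm_mul, Complex.norm_real, Real.norm_eq_abs, abs_of_nonneg (hpos x)]
  refine (mul_le_mul_of_nonneg_right ht (hpos x)).trans (le_of_eq ?_)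
  have hcabs : |c| = 2 * π * |ξ| := by
    rw [hc, abs_mul, abs_mul, abs_neg, abs_two, abs_of_pos Real.pi_pos]
  rw [abs_mul, hcabs]
  ring

lemma aux_Fle (ρ : ℝ → ℝ) (hpos : ∀ x, 0 ≤ ρ x) (hmass : ∫ x, ρ x = 1) (ξ : ℝ) :
    ‖𝓕 (fun x => (ρ x : ℂ)) ξ‖ ≤ 1 := by
  refine (VectorFourier.norm_fourierIntegral_le_integral_norm _ _ _ _ _).trans (le_of_eq ?_)
  rw [← hmass]
  congr 1
  ext x
  simp [abs_of_nonneg (hpos x)]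

lemma aux_Fdecay (ρ : ℝ → ℝ) (hi : Integrable ρ) (hD : Differentiable ℝ ρ)
    (hDi : Integrable (deriv ρ)) : ∃ C : ℝ, 0 ≤ C ∧ ∀ ξ, ‖𝓕 (fun x => (ρ x : ℂ)) ξ‖ * |ξ| ≤ C := by
  have hd : deriv (fun x => (ρ x : ℂ)) = fun x => ((deriv ρ x : ℝ) : ℂ) := by
    ext x
    exact ((hD x).hasDerivAt.ofReal_comp).deriv
  have h := Real.fourier_deriv (f := fun x => (ρ x : ℂ)) hi.ofReal
    (fun x => (hD x).hasDerivAt.ofReal_comp.differentiableAt) (by rw [hd]; exact hDi.ofReal)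
  refine ⟨∫ x, ‖deriv (fun x => (ρ x : ℂ)) x‖, integral_nonneg fun x => norm_nonneg _, fun ξ => ?_⟩
  have h2 : ‖𝓕 (deriv (fun x => (ρ x : ℂ))) ξ‖ ≤ _ :=
    VectorFourier.norm_fourierIntegral_le_integral_norm _ _ _ _ _
  refine le_trans ?_ h2
  rw [h]
  simp only [norm_smul, norm_mul, Complex.norm_real, Complex.norm_I, Real.norm_eq_abs,
    abs_of_pos Real.pi_pos, Complex.norm_ofNat, mul_one]
  have : 0 ≤ |ξ| * ‖𝓕 (fun x => (ρ x : ℂ)) ξ‖ := by positivity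
  nlinarith [Real.pi_gt_three]

lemma aux_Fcont (f : ℝ → ℂ) (hi : Integrable f) : Continuous (𝓕 f) :=
  VectorFourier.fourierIntegral_continuous Real.continuous_fourierChar continuous_inner hi

lemma aux_Flt (ρ : ℝ → ℝ) (hpos : ∀ x, 0 ≤ ρ x) (hi : Integrable ρ) (hc : Continuous ρ)
    (hmass : ∫ x, ρ x = 1) (ξ : ℝ) (hξ : ξ ≠ 0) :
    ‖𝓕 (fun x => (ρ x : ℂ)) ξ‖ < 1 := by
  refine lt_of_le_of_ne (aux_Fle ρ hpos hmass ξ) fun h1 => ?_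
  set w := 𝓕 (fun x => (ρ x : ℂ)) ξ with hw
  set z : ℝ → ℂ := fun x => Complex.exp (↑(-2 * π * x * ξ) * Complex.I) with hz
  have hzn : ∀ x, ‖z x‖ = 1 := fun x => Complex.norm_exp_ofReal_mul_I _
  have hzc : Continuous z := by rw [hz]; fun_prop
  have hwe : w = ∫ x, z x * (ρ x : ℂ) := by
    rw [hw, Real.fourier_real_eq_integral_exp_smul]; rfl
  have hzi : Integrable fun x => z x * (ρ x : ℂ) := by
    refine hi.mono' (by have := hi.ofReal (𝕜 := ℂ) |>.1; exact hzc.aestronglyMeasurable.mul this) (Eventually.of_forall fun x => ?_)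
    rw [norm_mul, hzn, one_mul, Complex.norm_real, Real.norm_eq_abs, abs_of_nonneg (hpos x)]
  have hcw : (starRingEnd ℂ) w * w = 1 := by
    rw [mul_comm, Complex.mul_conj, Complex.normSq_eq_norm_sq, h1]; simp
  have hintZ : ∫ x, ((starRingEnd ℂ) w * (z x * (ρ x : ℂ))).re = 1 := by
    have := integral_re (hzi.const_mul ((starRingEnd ℂ) w))
    simp only [RCLike.re_to_complex] at this
    rw [this, integral_const_mul, ← hwe, hcw]
    simp
  have hre : ∀ x, ((starRingEnd ℂ) w * (z x * (ρ x : ℂ))).re = ((starRingEnd ℂ) w * z x).re * ρ x := by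
    intro x
    rw [← mul_assoc, Complex.re_mul_ofReal]
  have hle : ∀ x, ((starRingEnd ℂ) w * z x).re ≤ 1 := by
    intro x
    refine (Complex.re_le_norm _).trans ?_
    rw [norm_mul, hzn, RCLike.norm_conj, h1]; norm_num
  set k : ℝ → ℝ := fun x => (1 - ((starRingEnd ℂ) w * z x).re) * ρ x with hk
  have hk0 : 0 ≤ k := fun x => mul_nonneg (sub_nonneg.2 (hle x)) (hpos x)
  have hki' : Integrable fun x => ((starRingEnd ℂ) w * z x).re * ρ x := by
    have := (hzi.const_mul ((starRingEnd ℂ) w)).re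
    refine this.congr (Eventually.of_forall fun x => ?_)
    simpa using hre x
  have hke : k = fun x => ρ x - ((starRingEnd ℂ) w * z x).re * ρ x := by
    ext x; rw [hk]; ring
  have hki : Integrable k := by rw [hke]; exact hi.sub hki'
  have hkint : ∫ x, k x = 0 := by
    rw [hke, integral_sub hi hki', hmass]
    simp_rw [hre] at hintZ
    rw [hintZ]; norm_num
  have hkc : Continuous k := by rw [hk]; fun_prop
  have hkz : k = 0 :=
    (Continuous.ae_eq_iff_eq volume hkc continuous_const).1 ((integral_eq_zero_iff_of_nonneg hk0 hki).1 hkint)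
  obtain ⟨x0, hx0⟩ : ∃ x, 0 < ρ x := by
    by_contra! hn
    have : ρ = fun _ => 0 := funext fun x => le_antisymm (hn x) (hpos x)
    rw [this] at hmass
    simp at hmass
  have hev : ∀ᶠ x in 𝓝 x0, z x = w := by
    filter_upwards [hc.continuousAt.eventually (lt_mem_nhds hx0)] with x hx
    have h2 : (1 - ((starRingEnd ℂ) w * z x).re) * ρ x = 0 := congrFun hkz x
    have h3 : ((starRingEnd ℂ) w * z x).re = 1 := by
      rcases mul_eq_zero.1 h2 with h | h
      · linarith
      · linarith
    have h4 : Complex.normSq (z x - w) = 0 := by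
      rw [Complex.normSq_sub, Complex.normSq_eq_norm_sq, Complex.normSq_eq_norm_sq, hzn, h1,
        mul_comm (z x), h3]
      norm_num
    exact sub_eq_zero.1 (Complex.normSq_eq_zero.1 h4)
  have hd1 : deriv z x0 = 0 := by
    have : z =ᶠ[𝓝 x0] fun _ => w := hev
    rw [this.deriv_eq]; simp
  have hd2 : HasDerivAt z (z x0 * (↑(-2 * π * ξ) * Complex.I)) x0 := by
    have h5 : HasDerivAt (fun x : ℝ => -2 * π * x * ξ) (-2 * π * ξ) x0 := by
      simpa using ((hasDerivAt_id x0).const_mul (-2 * π)).mul_const ξ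
    exact (h5.ofReal_comp.mul_const Complex.I).cexp
  rw [hd2.deriv] at hd1
  have : z x0 ≠ 0 := Complex.exp_ne_zero _
  simp [this, Real.pi_ne_zero, hξ] at hd1

lemma aux_q (F : ℝ → ℂ) (hF : Continuous F) (hlt : ∀ ξ, ξ ≠ 0 → ‖F ξ‖ < 1)
    (C : ℝ) (hC0 : 0 ≤ C) (hC : ∀ ξ, ‖F ξ‖ * |ξ| ≤ C) (δ : ℝ) (hδ : 0 < δ) :
    ∃ q : ℝ, q < 1 ∧ ∀ ξ, δ ≤ |ξ| → ‖F ξ‖ ≤ q := by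
  set T := 2 * C + δ with hT
  have hcomp : IsCompact ({ξ : ℝ | δ ≤ |ξ|} ∩ Metric.closedBall 0 T) :=
    (isCompact_closedBall 0 T).inter_left (isClosed_le continuous_const continuous_abs)
  have hne : ({ξ : ℝ | δ ≤ |ξ|} ∩ Metric.closedBall 0 T).Nonempty :=
    ⟨δ, le_abs_self δ, by simp [abs_of_pos hδ, hT]; linarith⟩
  obtain ⟨x0, hx0, hmax⟩ := hcomp.exists_isMaxOn hne hF.norm.continuousOn
  have hx0' : x0 ≠ 0 := by
    rintro rfl
    have := hx0.1
    simp at this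
    linarith
  refine ⟨max ‖F x0‖ (1 / 2), max_lt (hlt _ hx0') (by norm_num), fun ξ hξ => ?_⟩
  rcases le_total |ξ| T with h | h
  · exact le_max_of_le_left (hmax ⟨hξ, by simpa using h⟩)
  · apply le_max_of_le_right
    have h1 := hC ξ
    have h2 : 0 < |ξ| := by linarith
    by_contra! h3
    nlinarith

lemma aux_Fsq (F : ℝ → ℂ) (hF : Continuous F) (h1 : ∀ ξ, ‖F ξ‖ ≤ 1)
    (C : ℝ) (hC : ∀ ξ, ‖F ξ‖ * |ξ| ≤ C) : Integrable fun ξ => ‖F ξ‖ ^ 2 := by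
  refine (integrable_inv_one_add_sq.const_mul (1 + C ^ 2)).mono'
    (Continuous.aestronglyMeasurable (by fun_prop)) (Eventually.of_forall fun ξ => ?_)
  rw [Real.norm_eq_abs, abs_of_nonneg (by positivity), ← div_eq_mul_inv, le_div_iff₀ (by positivity),
    ← sq_abs ξ]
  have e1 : ‖F ξ‖ ^ 2 ≤ 1 := pow_le_one₀ (norm_nonneg _) (h1 ξ)
  have e2 : (‖F ξ‖ * |ξ|) ^ 2 ≤ C ^ 2 := pow_le_pow_left₀ (by positivity) (hC ξ) 2
  nlinarith

/-- inverse Fourier transform of the Gaussian. -/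
lemma aux_gauss (N : ℕ) (hN : 0 < N) (x : ℝ) :
    Integrable (fun ξ : ℝ => ((Real.exp (-(2 * π ^ 2) * N * ξ ^ 2) : ℝ) : ℂ)) ∧
    𝓕⁻ (fun ξ : ℝ => ((Real.exp (-(2 * π ^ 2) * N * ξ ^ 2) : ℝ) : ℂ)) (√N * x) =
      (((√N)⁻¹ * gaussPDF x : ℝ) : ℂ) := by
  have hN' : (0 : ℝ) < N := by exact_mod_cast hN
  constructor
  · have := integrable_exp_neg_mul_sq (b := 2 * π ^ 2 * N) (by positivity)
    simpa using this.ofReal (𝕜 := ℂ)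
  · have hb : 0 < (((2 * π * N : ℝ) : ℂ)).re := by
      rw [Complex.ofReal_re]; positivity
    have h := congrFun (fourier_gaussian_pi hb) (-(√N * x))
    have e : (fun x : ℝ ↦ Complex.exp (-π * ((2 * π * N : ℝ) : ℂ) * x ^ 2)) =
        (fun ξ : ℝ => ((Real.exp (-(2 * π ^ 2) * N * ξ ^ 2) : ℝ) : ℂ)) := by
      ext ξ
      push_cast
      congr 1
      ring
    rw [e] at h
    rw [Real.fourierInv_eq_fourier_neg, h]
    have hs2 : √(N : ℝ) ^ 2 = N := Real.sq_sqrt hN'.le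
    have e2 : (((2 * π * N : ℝ) : ℂ)) ^ (1 / 2 : ℂ) = ((√(2 * π) * √N : ℝ) : ℂ) := by
      rw [← Real.sqrt_mul (by positivity), Real.sqrt_eq_rpow, Complex.ofReal_cpow (by positivity)]
      norm_num
    have e3 : -(π : ℂ) / ((2 * π * N : ℝ) : ℂ) * ((-(√N * x) : ℝ) : ℂ) ^ 2 = ((-x ^ 2 / 2 : ℝ) : ℂ) := by
      have : -π / (2 * π * N) * (-(√N * x)) ^ 2 = -x ^ 2 / 2 := by
        rw [neg_sq, mul_pow, hs2]
        field_simp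
      rw [← this]
      push_cast
      ring
    rw [e2, e3, ← Complex.ofReal_exp, gaussPDF]
    push_cast
    rw [one_div, mul_inv]
    ring

lemma aux_invdiff (f h : ℝ → ℂ) (hf : Integrable f) (hh : Integrable h) (v : ℝ) :
    ‖𝓕⁻ f v - 𝓕⁻ h v‖ ≤ ∫ ξ, ‖f ξ - h ξ‖ := by
  have hf2 : Integrable (fun y => Real.fourierChar (y * v) • f y) := by
    have := (Real.fourierIntegral_convergent_iff (f := f) (-v)).2 hf
    simpa [mul_comm] using this
  have hh2 : Integrable (fun y => Real.fourierChar (y * v) • h y) := by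
    have := (Real.fourierIntegral_convergent_iff (f := h) (-v)).2 hh
    simpa [mul_comm] using this
  have e : ∀ g : ℝ → ℂ, 𝓕⁻ g v = ∫ y, Real.fourierChar (y * v) • g y := by
    intro g
    rw [Real.fourierInv_eq]
    congr 1
    ext y
    simp [mul_comm]
  rw [e, e, ← integral_sub hf2 hh2]
  refine (norm_integral_le_integral_norm _).trans (le_of_eq ?_)
  congr 1
  ext ξ
  rw [← smul_sub, Circle.norm_smul]

lemma aux_sup (ρ : ℝ → ℝ) (hpos : ∀ x, 0 ≤ ρ x) (hi : Integrable ρ) (hmass : ∫ x, ρ x = 1)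
    (hmean : ∫ x, x * ρ x = 0) (hvar : ∫ x, x ^ 2 * ρ x = 1)
    (hmom3 : Integrable fun x => |x| ^ 3 * ρ x) (hD : Differentiable ℝ ρ)
    (hDi : Integrable (deriv ρ)) (B : ℝ) (hB : ∀ x, |ρ x| ≤ B) :
    ∃ c : ℝ, 0 ≤ c ∧ ∀ (m : ℕ) (x : ℝ), |rescaledConv ρ (m + 2) x - gaussPDF x| ≤
      c * (√((m + 2 : ℕ) : ℝ))⁻¹ := by
  have hcont : Continuous ρ := hD.continuous
  set F : ℝ → ℂ := 𝓕 (fun x => (ρ x : ℂ)) with hFdef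
  have hFc : Continuous F := aux_Fcont _ hi.ofReal
  obtain ⟨C, hC0, hC⟩ := aux_Fdecay ρ hi hD hDi
  have hF1 : ∀ ξ, ‖F ξ‖ ≤ 1 := aux_Fle ρ hpos hmass
  have hFlt : ∀ ξ, ξ ≠ 0 → ‖F ξ‖ < 1 := aux_Flt ρ hpos hi hcont hmass
  have hFsq := aux_Fsq F hFc hF1 C hC
  obtain ⟨K, hK0, hK⟩ := aux_Ftaylor ρ hpos hi hmass hmean hvar hmom3
  obtain ⟨A, q, hA, hq0, hq1, hpt⟩ := aux_ptwise F (2 * π ^ 2) K (by positivity) hK0 hK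
    (fun δ hδ => aux_q F hFc hFlt C hC0 hC δ hδ)
  obtain ⟨E, hE⟩ := aux_qbound q hq0 hq1
  have hE0 : 0 ≤ E := by
    have h := hE 0
    rw [pow_zero, le_div_iff₀ (by positivity)] at h
    push_cast at h
    linarith
  set G := ∫ x : ℝ, |x| ^ 3 * Real.exp (-(2 * π ^ 2 / 4) * x ^ 2) with hG
  have hG0 : 0 ≤ G := integral_nonneg fun x => by positivity
  set H := ∫ ξ, ‖F ξ‖ ^ 2 with hH
  have hH0 : 0 ≤ H := integral_nonneg fun x => by positivity
  refine ⟨A * G + E * H, by positivity, fun m x => ?_⟩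
  obtain ⟨hc1, hc2, hc3⟩ := aux_iter ρ hcont B hB hi (m + 1)
  obtain ⟨hg1, hg2⟩ := aux_gauss (m + 2) (by omega) x
  obtain ⟨hs1, hs2⟩ := aux_gscale (2 * π ^ 2 / 4) (by positivity) (m + 2) (by omega)
  set N : ℕ := m + 2 with hN
  have hNpos : (0 : ℝ) < N := by rw [hN]; positivity
  have hspos : 0 < √(N : ℝ) := Real.sqrt_pos.2 hNpos
  have hF3 : 𝓕 (fun x => (iterConv ρ (m + 1) x : ℂ)) = fun ξ => F ξ ^ N := funext hc3
  have hFN : Integrable fun ξ => F ξ ^ N := by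
    refine hFsq.mono' (by exact (hFc.pow N).aestronglyMeasurable) (Eventually.of_forall fun ξ => ?_)
    rw [norm_pow, hN]
    exact pow_le_pow_of_le_one (norm_nonneg _) (hF1 ξ) (by omega)
  have hinv := hc1.fourierInv_fourier_eq hc2 (by rw [hF3]; exact hFN)
  rw [hF3] at hinv
  have hinvx := congrFun hinv (√N * x)
  have hdiffN : ‖((iterConv ρ (m + 1) (√N * x) - (√N)⁻¹ * gaussPDF x : ℝ) : ℂ)‖ ≤
      ∫ ξ, ‖F ξ ^ N - ((Real.exp (-(2 * π ^ 2) * N * ξ ^ 2) : ℝ) : ℂ)‖ := by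
    rw [Complex.ofReal_sub, ← hg2, ← hinvx]
    exact aux_invdiff _ _ hFN hg1 _
  have hle : ∫ ξ, ‖F ξ ^ N - ((Real.exp (-(2 * π ^ 2) * N * ξ ^ 2) : ℝ) : ℂ)‖ ≤
      (A * G + E * H) / N := by
    calc _ ≤ ∫ ξ : ℝ, (A * ((N : ℝ) * |ξ| ^ 3 * Real.exp (-(2 * π ^ 2 / 4) * N * ξ ^ 2))
          + q ^ m * ‖F ξ‖ ^ 2) := by
          refine integral_mono (hFN.sub hg1).norm ((hs1.const_mul A).add (hFsq.const_mul _)) ?_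
          intro ξ
          exact hpt m ξ
      _ = A * (G / N) + q ^ m * H := by
          rw [integral_add (hs1.const_mul A) (hFsq.const_mul _), integral_const_mul,
            integral_const_mul, hs2]
      _ ≤ A * (G / N) + E / N * H := by gcongr; exact hE m
      _ = _ := by ring
  rw [Complex.norm_real, Real.norm_eq_abs] at hdiffN
  have e : rescaledConv ρ N x - gaussPDF x =
      √N * (iterConv ρ (m + 1) (√N * x) - (√N)⁻¹ * gaussPDF x) := by
    rw [rescaledConv, show N - 1 = m + 1 by omega, mul_sub, ← mul_assoc (√(N : ℝ)) (√(N : ℝ))⁻¹,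
      mul_inv_cancel₀ hspos.ne', one_mul]
  rw [e, abs_mul, abs_of_pos hspos]
  calc _ ≤ √N * ((A * G + E * H) / N) := by gcongr; exact hdiffN.trans hle
    _ = _ := by
      have : (N : ℝ) = √N * √N := (Real.mul_self_sqrt hNpos.le).symm
      field_simp
      rw [Real.sq_sqrt hNpos.le]; ring

/-- local `L¹` closeness of `ρ_N` (`N = 2ⁿ`) to the Gaussian:
`∫_{|x|<R} |ρ_N - g| ≤ c R 2^{-n/2}` and `∫_{|x|<R} |ρ_N/g - 1| ≤ c R e^{R²/2} 2^{-n/2}`. -/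
theorem local_l1_clt_rate (ρ : ℝ → ℝ)
    (hmeas : Measurable ρ) (hpos : ∀ x, 0 ≤ ρ x) (hmass : ∫ x, ρ x = 1)
    (hmean : ∫ x, x * ρ x = 0) (hvar : ∫ x, x ^ 2 * ρ x = 1)
    (hdiff : Differentiable ℝ fun x => Real.sqrt (ρ x))
    (hI : Integrable fun x => (deriv (fun y => Real.sqrt (ρ y)) x) ^ 2)
    (hmom3 : Integrable fun x => |x| ^ 3 * ρ x) :
    ∃ c : ℝ, ∀ n : ℕ, ∀ R : ℝ, 0 < R →
      (∫ x in {x : ℝ | |x| < R}, |rescaledConv ρ (2 ^ n) x - gaussPDF x|)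
          ≤ c * R * (Real.sqrt (2 ^ n))⁻¹ ∧
      (∫ x in {x : ℝ | |x| < R}, |rescaledConv ρ (2 ^ n) x / gaussPDF x - 1|)
          ≤ c * R * Real.exp (R ^ 2 / 2) * (Real.sqrt (2 ^ n))⁻¹ := by
  have hi : Integrable ρ := by
    by_contra h
    rw [integral_undef h] at hmass
    norm_num at hmass
  obtain ⟨hD, hDi, B, hB⟩ := aux_reg ρ hpos hi hmass hdiff hI
  obtain ⟨c, hc0, hc⟩ := aux_sup ρ hpos hi hmass hmean hvar hmom3 hD hDi B hB
  have hB0 : 0 ≤ B := (abs_nonneg _).trans (hB 0)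
  have hg : ∀ x, 0 < gaussPDF x := fun x => by unfold gaussPDF; positivity
  have hg1 : ∀ x, gaussPDF x ≤ 1 := fun x => by
    unfold gaussPDF
    have h1 : Real.exp (-x ^ 2 / 2) ≤ 1 := Real.exp_le_one_iff.2 (by nlinarith [sq_nonneg x])
    have h2 : (√(2 * π))⁻¹ ≤ 1 := inv_le_one_of_one_le₀ (by
      rw [Real.one_le_sqrt]; nlinarith [Real.pi_gt_three])
    exact mul_le_one₀ h2 (Real.exp_pos _).le h1
  have hsup : ∀ (n : ℕ) (x : ℝ), |rescaledConv ρ (2 ^ n) x - gaussPDF x| ≤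
      (c + (B + 1)) * (√(2 ^ n))⁻¹ := by
    intro n x
    rcases Nat.eq_zero_or_pos n with rfl | hn
    · have e : rescaledConv ρ (2 ^ 0) x = ρ x := by simp [rescaledConv, iterConv]
      rw [e]
      simp only [pow_zero, Real.sqrt_one, inv_one, mul_one]
      calc _ ≤ |ρ x| + |gaussPDF x| := abs_sub _ _
        _ ≤ B + 1 := add_le_add (hB x) (by rw [abs_of_pos (hg x)]; exact hg1 x)
        _ ≤ _ := by linarith
    · obtain ⟨m, hm⟩ : ∃ m, 2 ^ n = m + 2 := by
        have : 2 ^ 1 ≤ 2 ^ n := Nat.pow_le_pow_right (by norm_num) hn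
        exact ⟨2 ^ n - 2, by omega⟩
      have h := hc m x
      rw [← hm] at h
      push_cast at h
      refine h.trans ?_
      gcongr
      linarith
  set c' := c + (B + 1) with hc'
  have hc'0 : 0 ≤ c' := by positivity
  have hvol : ∀ R : ℝ, 0 < R → volume.real {x : ℝ | |x| < R} = 2 * R := by
    intro R hR
    have : {x : ℝ | |x| < R} = Ioo (-R) R := by ext x; simp [abs_lt]
    rw [this, Real.volume_real_Ioo_of_le (by linarith)]
    ring
  have hfin : ∀ R : ℝ, volume {x : ℝ | |x| < R} < ⊤ := by
    intro R
    have : {x : ℝ | |x| < R} = Ioo (-R) R := by ext x; simp [abs_lt]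
    rw [this]; simp
  have hbound : ∀ (R M : ℝ) (f : ℝ → ℝ), 0 < R → (∀ x, |x| < R → |f x| ≤ M) →
      ∫ x in {x : ℝ | |x| < R}, |f x| ≤ M * (2 * R) := by
    intro R M f hR h
    have := norm_setIntegral_le_of_norm_le_const (μ := volume) (f := fun x => |f x|) (C := M)
      (hfin R) (fun x hx => by simpa using h x hx)
    rw [hvol R hR] at this
    exact (le_abs_self _).trans this
  refine ⟨2 * c' * √(2 * π), fun n R hR => ⟨?_, ?_⟩⟩
  · refine (hbound R _ _ hR fun x _ => hsup n x).trans ?_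
    have h1 : 1 ≤ √(2 * π) := by rw [Real.one_le_sqrt]; nlinarith [Real.pi_gt_three]
    have h2 : 0 ≤ 2 * c' * R * (√(2 ^ n))⁻¹ := by positivity
    nlinarith
  · refine (hbound R (√(2 * π) * Real.exp (R ^ 2 / 2) * (c' * (√(2 ^ n))⁻¹)) _ hR
      fun x hx => ?_).trans (le_of_eq (by ring))
    have e : rescaledConv ρ (2 ^ n) x / gaussPDF x - 1 =
        (gaussPDF x)⁻¹ * (rescaledConv ρ (2 ^ n) x - gaussPDF x) := by
      have := (hg x).ne'
      field_simp
    rw [e, abs_mul, abs_of_pos (inv_pos.2 (hg x))]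
    refine mul_le_mul ?_ (hsup n x) (abs_nonneg _) (by positivity)
    rw [gaussPDF, mul_inv, inv_inv, ← Real.exp_neg]
    gcongr
    have : x ^ 2 ≤ R ^ 2 := by rw [← sq_abs x]; gcongr
    linarith
end
end
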